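/- arXiv:1912.07790 — 8 statements merged into one kernel-verified Lean document; each statement's English description precedes it below -/
import Mathlib

section
/- Let N ≥ 1 and let a_{ij} ≥ 0, for i ∈ {1,…,N} and j ∈ {0,1,…,N} with a_{ii} = 0, be the weights of a directed graph Ḡ on vertices {v₀, v₁, …, v_N}, where there is a directed edge (v_j, v_i) if and only if a_{ij} > 0. Define the matrix L = [l_{ij}] ∈ ℝ^{N×N} by l_{ij} = −a_{ij} for i ≠ j and l_{ii} = Σ_{j=1}^N a_{ij}, let Δ = diag(a_{10}, …, a_{N0}), and set H = L + Δ. If Ḡ contains a directed spanning tree with node v₀ as its root (i.e., every vertex v_i, i = 1,…,N, is reachable from v₀ by a directed path), then every eigenvalue of H (viewed as a complex matrix) has strictly positive real part. -/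
/-- A vertex where `‖x‖` attains its upper bound `M`, and where the weighted Laplacian of `x` equals
`μ * x` with `μ.re ≤ 0`, transmits the bound to all its in-neighbours. -/
theorem norm_eq_of_laplacian_eq_of_norm_eq {V : Type*} [Fintype V] {w : V → ℝ} {x : V → ℂ}
    {μ : ℂ} {M : ℝ} {i j : V} (hw : ∀ k, 0 ≤ w k) (hμ : μ.re ≤ 0)
    (h : ∑ k, (w k : ℂ) * (x i - x k) = μ * x i) (hM : ∀ k, ‖x k‖ ≤ M) (hi : ‖x i‖ = M)
    (hj : 0 < w j) : ‖x j‖ = M := by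
  have hM0 : 0 ≤ M := hi ▸ norm_nonneg _
  have hsum : (((∑ k, w k : ℝ) : ℂ) - μ) * x i = ∑ k, (w k : ℂ) * x k := by
    simp only [mul_sub, Finset.sum_sub_distrib, ← Finset.sum_mul] at h
    push_cast
    linear_combination h
  have hlow : ∑ k, w k ≤ ‖((∑ k, w k : ℝ) : ℂ) - μ‖ := by
    refine le_trans ?_ (Complex.re_le_norm _)
    rw [Complex.sub_re, Complex.ofReal_re]
    linarith
  have hupp : ‖((∑ k, w k : ℝ) : ℂ) - μ‖ * M ≤ ∑ k, w k * ‖x k‖ := by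
    rw [← hi, ← norm_mul, hsum]
    refine (norm_sum_le _ _).trans_eq (Finset.sum_congr rfl fun k _ => ?_)
    rw [norm_mul, Complex.norm_real, Real.norm_of_nonneg (hw k)]
  have hle : ∑ k, w k * (M - ‖x k‖) ≤ 0 := by
    simp only [mul_sub, Finset.sum_sub_distrib, ← Finset.sum_mul]
    linarith [mul_le_mul_of_nonneg_right hlow hM0]
  have hnn : ∀ k, 0 ≤ w k * (M - ‖x k‖) := fun k => mul_nonneg (hw k) (sub_nonneg.2 (hM k))
  have hzero : w j * (M - ‖x j‖) ≤ 0 :=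
    (Finset.single_le_sum (fun k _ => hnn k) (Finset.mem_univ j)).trans hle
  exact le_antisymm (hM j) (sub_nonpos.1 (nonpos_of_mul_nonpos_right hzero hj))

/-- If all vertices of a weighted digraph are reachable from `r`, then a function vanishing at `r`
whose weighted Laplacian is `μ * x` away from `r`, with `μ.re ≤ 0`, is zero. -/
theorem eq_zero_of_laplacian_eq_of_reachable {V : Type*} [Fintype V] {r : V} {a : V → V → ℝ}
    {x : V → ℂ} {μ : ℂ} (ha : ∀ i j, i ≠ r → 0 ≤ a i j)
    (hr : ∀ i, Relation.ReflTransGen (fun p q => q ≠ r ∧ 0 < a q p) r i) (hμ : μ.re ≤ 0)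
    (h : ∀ i, i ≠ r → ∑ j, (a i j : ℂ) * (x i - x j) = μ * x i) (hx : x r = 0) : x = 0 := by
  have : Nonempty V := ⟨r⟩
  obtain ⟨m, hm⟩ := Finite.exists_max fun i => ‖x i‖
  have hback : ∀ i, Relation.ReflTransGen (fun p q => q ≠ r ∧ 0 < a q p) r i →
      ‖x i‖ = ‖x m‖ → ‖x r‖ = ‖x m‖ := by
    intro i hi
    induction hi with
    | refl => exact id
    | tail _ hpq ih =>
      exact fun hq => ih (norm_eq_of_laplacian_eq_of_norm_eq (fun k => ha _ k hpq.1) hμ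
        (h _ hpq.1) hm hq hpq.2)
  have hm0 := hback m (hr m) rfl
  funext i
  have := hm i
  rw [← hm0, hx, norm_zero] at this
  exact norm_le_zero_iff.1 this


/-- Let `N ≥ 1` and let `a i j ≥ 0` (for `i ∈ {1,…,N}`, `j ∈ {0,…,N}`,
with `a i i = 0`) be the weights of a digraph `Ḡ` on vertices `{v₀,…,v_N}`, where there is a
directed edge `(v_j, v_i)` iff `a i j > 0`.  Let `L` be the Laplacian-type matrix with
`L i j = -a i j` for `i ≠ j` and `L i i = ∑_{j=1}^N a i j`, let `Δ = diag (a 1 0, …, a N 0)`,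
and `H = L + Δ`.  If every vertex is reachable from `v₀` by a directed path, then every
eigenvalue of `H` (over `ℂ`) has strictly positive real part. -/
theorem stmt_0 (N : ℕ) (hN : 1 ≤ N)
    (a : Fin (N + 1) → Fin (N + 1) → ℝ)
    (ha_nonneg : ∀ i j : Fin (N + 1), i ≠ 0 → 0 ≤ a i j)
    (ha_diag : ∀ i : Fin (N + 1), i ≠ 0 → a i i = 0)
    (htree : ∀ i : Fin (N + 1),
      Relation.ReflTransGen (fun p q : Fin (N + 1) => q ≠ 0 ∧ 0 < a q p) 0 i)
    (L Δ : Matrix (Fin N) (Fin N) ℝ)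
    (hL : ∀ i j : Fin N,
      L i j = if i = j then ∑ k : Fin N, a i.succ k.succ else -(a i.succ j.succ))
    (hΔ : Δ = Matrix.diagonal fun i : Fin N => a i.succ 0) :
    ∀ μ ∈ spectrum ℂ ((L + Δ).map Complex.ofReal), 0 < μ.re := by
  intro μ hμ
  by_contra! hre
  rw [← Matrix.spectrum_toLin', ← Module.End.hasEigenvalue_iff_mem_spectrum] at hμ
  obtain ⟨v, hv⟩ := hμ.exists_hasEigenvector
  have hev := hv.apply_eq_smul
  rw [Matrix.toLin'_apply] at hev
  refine hv.2 ?_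
  have hx : (Fin.cons 0 v : Fin (N + 1) → ℂ) = 0 := by
    refine eq_zero_of_laplacian_eq_of_reachable ha_nonneg htree hre (fun i hi => ?_)
      (Fin.cons_zero _ _)
    obtain ⟨i, rfl⟩ := Fin.exists_succ_eq.2 hi
    have hrow : ∀ j, ((L + Δ).map Complex.ofReal) i j * v j =
        (if i = j then ((∑ k : Fin N, a i.succ k.succ : ℝ) + a i.succ 0 : ℂ) * v i else 0)
          - a i.succ j.succ * v j := by
      intro j
      rw [Matrix.map_apply, Matrix.add_apply, hL, hΔ]
      by_cases hij : i = j
      · subst hij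
        simp [ha_diag i.succ hi]
      · simp [hij]
    have hi' := congrFun hev i
    simp only [Matrix.mulVec, dotProduct, hrow, Finset.sum_sub_distrib, Finset.sum_ite_eq,
      Finset.mem_univ, if_true, Pi.smul_apply, smul_eq_mul] at hi'
    rw [Fin.sum_univ_succ]
    simp only [Fin.cons_zero, Fin.cons_succ, mul_sub, Finset.sum_sub_distrib, ← Finset.sum_mul]
    push_cast at hi'
    linear_combination hi'
  funext i
  simpa using congrFun hx i.succ
end

section
/- Let A ∈ ℝ^{n×n} and C ∈ ℝ^{m×n}, and suppose P ∈ ℝ^{n×n} is a symmetric positive definite matrix satisfying the algebraic Riccati equation A P + P Aᵀ + I_n − P Cᵀ C P = 0. Then for every real σ > 1 and every ω ∈ ℝ, the complex matrix Aᵀ − (σ + iω) Cᵀ C P is Hurwitz, i.e., all of its eigenvalues have strictly negative real part. -/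
open Matrix

open scoped ComplexOrder MatrixOrder in
/-- A real positive definite matrix is positive definite as a complex matrix. -/
theorem Matrix.PosDef.map_ofReal {n : Type*} [Fintype n] [DecidableEq n] {P : Matrix n n ℝ}
    (hP : P.PosDef) : (P.map Complex.ofReal).PosDef := by
  obtain ⟨B, hB, rfl⟩ :=
    CStarAlgebra.isStrictlyPositive_iff_eq_star_mul_self.mp hP.isStrictlyPositive
  have hmap : (star B * B).map Complex.ofReal
      = (B.map Complex.ofReal)ᴴ * B.map Complex.ofReal := by
    ext i j
    simp [mul_apply, star_eq_conjTranspose]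
  rw [hmap]
  refine .conjTranspose_mul_self _ (mulVec_injective_of_isUnit ?_)
  exact hB.map (Complex.ofRealHom.mapMatrix)

open scoped ComplexOrder in
/-- Lyapunov's criterion: if `P` and `-(P M + Mᴴ P)` are positive definite, then `M` is Hurwitz. -/
theorem Matrix.PosDef.re_lt_zero_of_mem_spectrum {n : Type*} [Fintype n] [DecidableEq n]
    {P M : Matrix n n ℂ} (hP : P.PosDef) (hM : (-(P * M + Mᴴ * P)).PosDef) {μ : ℂ}
    (hμ : μ ∈ spectrum ℂ M) : μ.re < 0 := by
  rw [← spectrum_toLin', ← Module.End.hasEigenvalue_iff_mem_spectrum] at hμ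
  obtain ⟨v, hv⟩ := hμ.exists_hasEigenvector
  have hMv : M *ᵥ v = μ • v := by simpa using hv.apply_eq_smul
  have hPv := Complex.pos_iff.mp (hP.dotProduct_mulVec_pos hv.2)
  have hLv := (Complex.pos_iff.mp (hM.dotProduct_mulVec_pos hv.2)).1
  have key : star v ⬝ᵥ ((-(P * M + Mᴴ * P)) *ᵥ v)
      = -((μ + star μ) * (star v ⬝ᵥ (P *ᵥ v))) := by
    have h₁ : star v ⬝ᵥ ((P * M) *ᵥ v) = μ * (star v ⬝ᵥ (P *ᵥ v)) := by
      rw [← mulVec_mulVec, hMv, mulVec_smul, dotProduct_smul, smul_eq_mul]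
    have h₂ : star v ⬝ᵥ ((Mᴴ * P) *ᵥ v) = star μ * (star v ⬝ᵥ (P *ᵥ v)) := by
      rw [← mulVec_mulVec, dotProduct_mulVec, ← star_mulVec, hMv, star_smul, smul_dotProduct,
        smul_eq_mul]
    rw [neg_mulVec, dotProduct_neg, add_mulVec, dotProduct_add, h₁, h₂, add_mul]
  rw [key] at hLv
  simp only [Complex.neg_re, Complex.mul_re, Complex.add_re, Complex.star_def, Complex.conj_re,
    Complex.add_im, Complex.conj_im, add_neg_cancel, zero_mul, sub_zero] at hLv
  nlinarith [hPv.1]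

/-- If `P` is a symmetric positive definite solution of the Riccati equation
`A P + P Aᵀ + I − P Cᵀ C P = 0`, then for every `σ > 1` and `ω ∈ ℝ` the complex matrix
`Aᵀ − (σ + iω) Cᵀ C P` is Hurwitz. -/
theorem stmt_1 (n m : ℕ) (A : Matrix (Fin n) (Fin n) ℝ) (C : Matrix (Fin m) (Fin n) ℝ)
    (P : Matrix (Fin n) (Fin n) ℝ) (hP : P.PosDef)
    (hRic : A * P + P * Aᵀ + 1 - P * Cᵀ * C * P = 0)
    (σ ω : ℝ) (hσ : 1 < σ) :
    ∀ μ ∈ spectrum ℂ ((A.map Complex.ofReal)ᵀ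
        - ((σ : ℂ) + (ω : ℂ) * Complex.I) •
            ((C.map Complex.ofReal)ᵀ * C.map Complex.ofReal * P.map Complex.ofReal)),
      μ.re < 0 := by
  intro μ hμ
  open scoped ComplexOrder in
  refine hP.map_ofReal.re_lt_zero_of_mem_spectrum ?_ hμ
  set a := A.map Complex.ofReal with ha
  set c := C.map Complex.ofReal with hc
  set p := P.map Complex.ofReal with hp
  have hpH : pᴴ = p := hP.map_ofReal.isHermitian
  have haH : aᵀᴴ = a := by ext; simp [ha]
  have hcH : cᵀ = cᴴ := by ext; simp [hc]
  have hRic' : a * p + p * aᵀ + 1 - p * cᵀ * c * p = 0 := by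
    have h := congrArg (fun X => X.map Complex.ofRealHom) hRic
    simp only [Matrix.map_add, Matrix.map_sub, Matrix.map_mul, Matrix.transpose_map, map_add,
      map_sub, Matrix.map_one, map_zero, map_one, Matrix.map_zero, implies_true] at h
    exact h
  have key : -(p * (aᵀ - ((σ : ℂ) + ω * Complex.I) • (cᵀ * c * p))
      + (aᵀ - ((σ : ℂ) + ω * Complex.I) • (cᵀ * c * p))ᴴ * p)
      = 1 + ((2 * σ - 1 : ℝ) : ℂ) • ((c * p)ᴴ * (c * p)) := by
    have hs : star ((σ : ℂ) + ω * Complex.I) = (σ : ℂ) - ω * Complex.I := by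
      simp [sub_eq_add_neg]
    have hap : a * p = p * cᴴ * c * p - 1 - p * aᵀ := by
      rw [← hcH, ← sub_eq_zero, ← hRic']
      abel
    rw [conjTranspose_sub, conjTranspose_smul, hs, haH, hcH]
    simp only [conjTranspose_mul, conjTranspose_conjTranspose, hpH, mul_sub, sub_mul,
      Matrix.mul_smul, Matrix.smul_mul, ← Matrix.mul_assoc]
    rw [hap]
    push_cast
    module
  rw [key]
  exact PosDef.one.add_posSemidef
    ((posSemidef_conjTranspose_mul_self _).smul (by exact_mod_cast (by linarith : 0 ≤ 2 * σ - 1)))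
end

section
/- Let f : [0, ∞) → ℝ be a uniformly continuous function such that lim_{t→∞} ∫₀ᵗ f(τ) dτ exists and is finite. Then lim_{t→∞} f(t) = 0. -/
open Filter

/-- **Barbălat-type lemma.**  If `f : [0,∞) → ℝ` is uniformly continuous and
`lim_{t→∞} ∫₀ᵗ f(τ) dτ` exists and is finite, then `lim_{t→∞} f(t) = 0`. -/
theorem stmt_2 (f : ℝ → ℝ)
    (hUC : UniformContinuousOn f (Set.Ici 0))
    (hint : ∃ L : ℝ, Tendsto (fun t => ∫ τ in (0:ℝ)..t, f τ) atTop (nhds L)) :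
    Tendsto f atTop (nhds 0) := by
  obtain ⟨L, hL⟩ := hint
  have hInt : ∀ a b : ℝ, 0 ≤ a → 0 ≤ b → IntervalIntegrable f MeasureTheory.volume a b :=
    fun a b ha hb => (hUC.continuousOn.mono fun x hx =>
      (le_min ha hb).trans (Set.mem_Icc.1 hx).1).intervalIntegrable
  rw [Metric.tendsto_atTop]
  intro ε hε
  obtain ⟨δ, hδ, hf⟩ := Metric.uniformContinuousOn_iff.1 hUC (ε / 2) (half_pos hε)
  set h := δ / 2 with hh
  have hpos : 0 < h := half_pos hδ
  have hdiff : Tendsto (fun t => (∫ τ in (0:ℝ)..(t + h), f τ) - ∫ τ in (0:ℝ)..t, f τ)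
      atTop (nhds 0) := by
    simpa using (hL.comp (tendsto_atTop_add_const_right _ h tendsto_id)).sub hL
  obtain ⟨N, hN⟩ := Metric.tendsto_atTop.1 hdiff (ε / 2 * h) (by positivity)
  refine ⟨max N 0, fun t ht => ?_⟩
  have ht0 : 0 ≤ t := (le_max_right _ _).trans ht
  have hth : 0 ≤ t + h := by positivity
  have hsmall := hN t ((le_max_left _ _).trans ht)
  rw [intervalIntegral.integral_interval_sub_left (hInt 0 _ le_rfl hth) (hInt 0 t le_rfl ht0),
    Real.dist_eq, sub_zero] at hsmall
  have hclose : ‖∫ τ in t..(t + h), (f τ - f t)‖ ≤ ε / 2 * |t + h - t| := by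
    refine intervalIntegral.norm_integral_le_of_norm_le_const fun x hx => ?_
    rw [Set.uIoc_of_le (by linarith)] at hx
    rw [← dist_eq_norm]
    refine (hf x (ht0.trans hx.1.le) t ht0 ?_).le
    rw [Real.dist_eq, abs_of_pos (sub_pos.2 hx.1)]
    linarith [hx.2]
  rw [intervalIntegral.integral_sub (hInt t _ ht0 hth) intervalIntegrable_const,
    intervalIntegral.integral_const, add_sub_cancel_left, abs_of_pos hpos, smul_eq_mul,
    Real.norm_eq_abs] at hclose
  rw [Real.dist_eq, sub_zero]
  obtain ⟨hs₁, hs₂⟩ := abs_lt.1 hsmall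
  obtain ⟨hc₁, hc₂⟩ := abs_le.1 hclose
  exact abs_lt.2 ⟨by nlinarith, by nlinarith⟩
end

section
/- Let N ≥ 1, let a_{ij} ≥ 0 (i ∈ {1,…,N}, j ∈ {0,…,N}, a_{ii} = 0) be weights of a directed graph Ḡ on {v₀,…,v_N} (edge (v_j, v_i) iff a_{ij} > 0) containing a directed spanning tree rooted at v₀, and let r_1,…,r_N ≥ 1 be integers. Define the block matrix L̂ = [L̂_{ij}]_{i,j=1}^N where L̂_{ii} ∈ ℝ^{(rᵢ+1)×(rᵢ+1)} is the upper-bidiagonal matrix with diagonal entries (1, 1, …, 1, Σ_{j=1}^N a_{ij}), superdiagonal entries all equal to −1, and zeros elsewhere; and for i ≠ j, L̂_{ij} ∈ ℝ^{(rᵢ+1)×(rⱼ+1)} has entry −a_{ij} in its bottom-left corner (row rᵢ+1, column 1) and zeros elsewhere. Let Δ̂ = diag(Δ̂₁,…,Δ̂_N) with Δ̂ᵢ = diag(0,…,0, a_{i0}) ∈ ℝ^{(rᵢ+1)×(rᵢ+1)}. Then every eigenvalue of Ĥ = L̂ + Δ̂ (over ℂ) has strictly positive real part. -/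
/-- Discrete maximum principle: a function vanishing at a root `v` from which every vertex is
reachable, and subharmonic for the weights `a` away from `v`, is nonpositive. -/
theorem nonpos_of_subharmonic_of_reachable {V : Type*} [Fintype V] (v : V) (a : V → V → ℝ)
    (ha : ∀ i j, i ≠ v → 0 ≤ a i j)
    (htree : ∀ i, Relation.ReflTransGen (fun p q => q ≠ v ∧ 0 < a q p) v i)
    (y : V → ℝ) (hv : y v = 0)
    (hy : ∀ i, i ≠ v → (∑ j, a i j) * y i ≤ ∑ j, a i j * y j) (i : V) : y i ≤ 0 := by
  have : Nonempty V := ⟨v⟩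
  obtain ⟨m, hm⟩ := Finite.exists_max y
  by_contra! hi
  have hpos : 0 < y m := hi.trans_le (hm i)
  have key : ∀ q, y q < y m := by
    intro q
    induction htree q with
    | refl => rwa [hv]
    | @tail p q _ hpq ih =>
      refine lt_of_le_of_ne (hm q) fun heq => ?_
      have h := hy q hpq.1
      rw [heq, Finset.sum_mul] at h
      refine h.not_gt (Finset.sum_lt_sum (fun j _ => ?_) ⟨p, Finset.mem_univ _, ?_⟩)
      · exact mul_le_mul_of_nonneg_left (hm j) (ha q j hpq.1)
      · exact mul_lt_mul_of_pos_left ih hpq.2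
  exact lt_irrefl _ (key m)

theorem Complex.le_norm_ofReal_sub {μ : ℂ} (hμ : μ.re ≤ 0) (d : ℝ) : d ≤ ‖(d : ℂ) - μ‖ := by
  refine le_trans ?_ (Complex.re_le_norm _)
  simp only [Complex.sub_re, Complex.ofReal_re]
  linarith


/-- Positivity of the real parts of the eigenvalues of the expanded block
matrix `Ĥ = L̂ + Δ̂` built from the graph weights `a i j` and the chain lengths `r i`.
The block-row/column index set is `(i : Fin N) × Fin (r i + 1)`, where `⟨i, l⟩` is row
`l+1` of block `i+1` (in the paper's 1-based indexing). -/
theorem stmt_4 (N : ℕ) (hN : 1 ≤ N)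
    (a : Fin (N + 1) → Fin (N + 1) → ℝ)
    (ha_nonneg : ∀ i j : Fin (N + 1), i ≠ 0 → 0 ≤ a i j)
    (ha_diag : ∀ i : Fin (N + 1), i ≠ 0 → a i i = 0)
    (htree : ∀ i : Fin (N + 1),
      Relation.ReflTransGen (fun p q : Fin (N + 1) => q ≠ 0 ∧ 0 < a q p) 0 i)
    (r : Fin N → ℕ) (hr : ∀ i, 1 ≤ r i)
    (Lhat Δhat :
      Matrix ((i : Fin N) × Fin (r i + 1)) ((i : Fin N) × Fin (r i + 1)) ℝ)
    (hLhat : ∀ p q, Lhat p q =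
      if p.1 = q.1 then
        (if (p.2 : ℕ) = (q.2 : ℕ) then
          (if (p.2 : ℕ) = r p.1 then ∑ k : Fin N, a p.1.succ k.succ else 1)
         else if (q.2 : ℕ) = (p.2 : ℕ) + 1 then -1 else 0)
      else if (p.2 : ℕ) = r p.1 ∧ (q.2 : ℕ) = 0 then -(a p.1.succ q.1.succ) else 0)
    (hΔhat : ∀ p q, Δhat p q = if p = q ∧ (p.2 : ℕ) = r p.1 then a p.1.succ 0 else 0) :
    ∀ μ ∈ spectrum ℂ ((Lhat + Δhat).map Complex.ofReal), 0 < μ.re := by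
  intro μ hμ
  by_contra! hre
  rw [← Matrix.spectrum_toLin', ← Module.End.hasEigenvalue_iff_mem_spectrum] at hμ
  obtain ⟨x, hx⟩ := hμ.exists_hasEigenvector
  have hx0 := hx.2
  have hxe : ∀ p, ∑ q, ((Lhat p q + Δhat p q : ℝ) : ℂ) * x q = μ * x p := fun p => by
    simpa [Matrix.mulVec, dotProduct] using congrFun hx.apply_eq_smul p
  have chain : ∀ (i : Fin N) (l : ℕ) (h : l < r i),
      x ⟨i, ⟨l + 1, by omega⟩⟩ = (1 - μ) * x ⟨i, ⟨l, by omega⟩⟩ := by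
    intro i l h
    have hrow : ∀ q, ((Lhat ⟨i, ⟨l, by omega⟩⟩ q + Δhat ⟨i, ⟨l, by omega⟩⟩ q : ℝ) : ℂ) * x q =
        (if q = ⟨i, ⟨l, by omega⟩⟩ then x q else 0) -
          (if q = ⟨i, ⟨l + 1, by omega⟩⟩ then x q else 0) := by
      rintro ⟨j, m⟩
      rw [hLhat, hΔhat]
      by_cases hij : i = j
      · subst hij
        have hl : l ≠ r i := h.ne
        rcases eq_or_ne (m : ℕ) l with h1 | h1
        · simp [hl, h1, Fin.ext_iff]
        · rcases eq_or_ne (m : ℕ) (l + 1) with h2 | h2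
          · simp [hl, h2, Fin.ext_iff]
          · simp [hl, h1, h1.symm, h2, Fin.ext_iff]
      · have hji : j ≠ i := Ne.symm hij
        simp [hij, hji, h.ne]
    have := hxe ⟨i, ⟨l, by omega⟩⟩
    simp only [hrow, Finset.sum_sub_distrib, Finset.sum_ite_eq', Finset.mem_univ, if_true] at this
    linear_combination -this
  have pow : ∀ (i : Fin N) (l : ℕ) (h : l < r i + 1),
      x ⟨i, ⟨l, h⟩⟩ = (1 - μ) ^ l * x ⟨i, 0⟩ := by
    intro i l
    induction l with
    | zero => intro h; simp
    | succ l ih =>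
      intro h
      rw [chain i l (by omega), ih, pow_succ]
      ring
  have bottom : ∀ i : Fin N, (((∑ j, a i.succ j : ℝ) : ℂ) - μ) * x ⟨i, Fin.last _⟩ =
      ∑ j : Fin N, (a i.succ j.succ : ℂ) * x ⟨j, 0⟩ := by
    intro i
    have hrow : ∀ q, ((Lhat ⟨i, Fin.last _⟩ q + Δhat ⟨i, Fin.last _⟩ q : ℝ) : ℂ) * x q =
        (if q = ⟨i, Fin.last _⟩ then ((∑ j, a i.succ j : ℝ) : ℂ) * x q else 0) -
          (if q.2 = 0 then (a i.succ q.1.succ : ℂ) * x q else 0) := by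
      rintro ⟨j, m⟩
      rw [hLhat, hΔhat, Fin.sum_univ_succ]
      by_cases hij : i = j
      · subst hij
        have hm : (m : ℕ) ≠ r i + 1 := m.2.ne
        rcases eq_or_ne m (Fin.last _) with h1 | h1
        · subst h1
          simp [ha_diag, add_comm]
        · have h2 : r i ≠ (m : ℕ) := fun h => h1 (Fin.ext h.symm)
          simp [ha_diag, h1, h1.symm, h2, hm]
      · have hji : j ≠ i := Ne.symm hij
        by_cases hm : m = 0
        · simp [hij, hji, hm]
        · simp [hij, hji, hm]
    have := hxe ⟨i, Fin.last _⟩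
    simp only [hrow, Finset.sum_sub_distrib, Finset.sum_ite_eq', Finset.mem_univ, if_true] at this
    have hsum : ∑ q : (i : Fin N) × Fin (r i + 1),
        (if q.2 = 0 then (a i.succ q.1.succ : ℂ) * x q else 0) =
          ∑ j : Fin N, (a i.succ j.succ : ℂ) * x ⟨j, 0⟩ := by
      rw [Fintype.sum_sigma]
      exact Finset.sum_congr rfl fun j _ => Fintype.sum_ite_eq' 0 fun m => _ * x ⟨j, m⟩
    rw [hsum] at this
    linear_combination this
  have hnorm : ∀ i : Fin N, ‖x ⟨i, 0⟩‖ ≤ ‖x ⟨i, Fin.last _⟩‖ := by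
    intro i
    have hone : (1 : ℝ) ≤ ‖1 - μ‖ := by simpa using Complex.le_norm_ofReal_sub hre 1
    rw [Fin.last, pow i (r i), norm_mul, norm_pow]
    exact le_mul_of_one_le_left (norm_nonneg _) (one_le_pow₀ hone)
  have hle := nonpos_of_subharmonic_of_reachable 0 a ha_nonneg htree
    (Fin.cons 0 fun i => ‖x ⟨i, 0⟩‖) rfl (by
      intro i hi
      obtain ⟨i, rfl⟩ := Fin.exists_succ_eq.2 hi
      rw [Fin.sum_univ_succ (fun j => a i.succ j * _)]
      simp only [Fin.cons_succ, Fin.cons_zero, mul_zero, zero_add]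
      calc (∑ j, a i.succ j) * ‖x ⟨i, 0⟩‖
          ≤ ‖((∑ j, a i.succ j : ℝ) : ℂ) - μ‖ * ‖x ⟨i, Fin.last _⟩‖ :=
            mul_le_mul (Complex.le_norm_ofReal_sub hre _) (hnorm i) (norm_nonneg _)
              (norm_nonneg _)
        _ = ‖∑ j : Fin N, (a i.succ j.succ : ℂ) * x ⟨j, 0⟩‖ := by rw [← norm_mul, bottom]
        _ ≤ ∑ j : Fin N, ‖(a i.succ j.succ : ℂ) * x ⟨j, 0⟩‖ := norm_sum_le _ _
        _ = ∑ j : Fin N, a i.succ j.succ * ‖x ⟨j, 0⟩‖ := by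
            refine Finset.sum_congr rfl fun j _ => ?_
            rw [norm_mul, Complex.norm_real, Real.norm_of_nonneg (ha_nonneg _ _ hi)])
  refine hx0 (funext ?_)
  rintro ⟨i, l, hl⟩
  have hi : x ⟨i, 0⟩ = 0 := norm_le_zero_iff.1 (by simpa using hle i.succ)
  rw [pow, hi, mul_zero, Pi.zero_apply]
end

section
/- Let A ∈ ℝ^{ν×ν}, B ∈ ℝ^{ν×m}, C ∈ ℝ^{m×ν}, and H ∈ ℝ^{n×n}. Suppose that for every (complex) eigenvalue λ of H, the complex matrix A − λ B C is Hurwitz. Then the real matrix I_n ⊗ A − H ⊗ (B C) ∈ ℝ^{nν×nν} is Hurwitz, where ⊗ denotes the Kronecker product. -/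
open Matrix Kronecker

/-- Over an algebraically closed field, an eigenvalue of `f` has an eigenvector that is also an
eigenvector of a given endomorphism `g` commuting with `f`. -/
theorem exists_common_eigenvector_of_commute {K V : Type*} [Field K] [IsAlgClosed K]
    [AddCommGroup V] [Module K V] [FiniteDimensional K V] {f g : Module.End K V}
    (hfg : Commute f g) {μ : K} (hμ : f.HasEigenvalue μ) :
    ∃ (lam : K) (v : V), v ≠ 0 ∧ f v = μ • v ∧ g v = lam • v := by
  have hmaps : Set.MapsTo g (f.eigenspace μ) (f.eigenspace μ) := by
    intro v hv
    rw [SetLike.mem_coe, Module.End.mem_eigenspace_iff] at hv ⊢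
    have hcomm : f (g v) = g (f v) := LinearMap.congr_fun hfg.eq v
    rw [hcomm, hv, map_smul]
  have : Nontrivial (f.eigenspace μ) := Submodule.nontrivial_iff_ne_bot.mpr hμ
  obtain ⟨lam, hlam⟩ := Module.End.exists_eigenvalue (g.restrict hmaps)
  obtain ⟨v, hv⟩ := hlam.exists_hasEigenvector
  refine ⟨lam, v, fun h0 => hv.2 (Subtype.ext h0), Module.End.mem_eigenspace_iff.mp v.2, ?_⟩
  exact congrArg Subtype.val hv.apply_eq_smul

/-- The matrix form of `Module.End.HasEigenvalue.mem_spectrum`. -/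
theorem Matrix.mem_spectrum_of_mulVec_eq_smul {K ι : Type*} [Field K] [Fintype ι] [DecidableEq ι]
    {M : Matrix ι ι K} {μ : K} {v : ι → K} (hv : v ≠ 0) (h : M *ᵥ v = μ • v) :
    μ ∈ spectrum K M := by
  rw [← Matrix.spectrum_toLin']
  exact (Module.End.hasEigenvalue_of_hasEigenvector (x := v)
    ⟨Module.End.mem_eigenspace_iff.mpr (by simpa using h), hv⟩).mem_spectrum

theorem Matrix.sub_kronecker {R l m n p : Type*} [NonUnitalNonAssocRing R] (X Y : Matrix l m R)
    (Z : Matrix n p R) : (X - Y) ⊗ₖ Z = X ⊗ₖ Z - Y ⊗ₖ Z := by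
  ext
  simp [sub_mul]

theorem Matrix.kronecker_sub {R l m n p : Type*} [NonUnitalNonAssocRing R] (X : Matrix l m R)
    (Y Z : Matrix n p R) : X ⊗ₖ (Y - Z) = X ⊗ₖ Y - X ⊗ₖ Z := by
  ext
  simp [mul_sub]

theorem Matrix.spectrum_kronecker_one_subset {K ι κ : Type*} [Field K] [Fintype ι]
    [DecidableEq ι] [Fintype κ] [DecidableEq κ] (X : Matrix ι ι K) :
    spectrum K (X ⊗ₖ (1 : Matrix κ κ K)) ⊆ spectrum K X := by
  intro z hz hX
  refine hz ?_
  obtain ⟨Y, hY⟩ := hX.exists_right_inv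
  refine IsUnit.of_mul_eq_one (Y ⊗ₖ (1 : Matrix κ κ K)) ?_
  have hsub : algebraMap K (Matrix (ι × κ) (ι × κ) K) z - X ⊗ₖ (1 : Matrix κ κ K) =
      (algebraMap K (Matrix ι ι K) z - X) ⊗ₖ (1 : Matrix κ κ K) := by
    simp only [Algebra.algebraMap_eq_smul_one, sub_kronecker, smul_kronecker, one_kronecker_one]
  rw [hsub, ← mul_kronecker_mul, hY, one_mul, one_kronecker_one]

theorem Matrix.spectrum_one_kronecker_subset {K ι κ : Type*} [Field K] [Fintype ι]
    [DecidableEq ι] [Fintype κ] [DecidableEq κ] (X : Matrix κ κ K) :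
    spectrum K ((1 : Matrix ι ι K) ⊗ₖ X) ⊆ spectrum K X := by
  intro z hz hX
  refine hz ?_
  obtain ⟨Y, hY⟩ := hX.exists_right_inv
  refine IsUnit.of_mul_eq_one ((1 : Matrix ι ι K) ⊗ₖ Y) ?_
  have hsub : algebraMap K (Matrix (ι × κ) (ι × κ) K) z - (1 : Matrix ι ι K) ⊗ₖ X =
      (1 : Matrix ι ι K) ⊗ₖ (algebraMap K (Matrix κ κ K) z - X) := by
    simp only [Algebra.algebraMap_eq_smul_one, kronecker_sub, kronecker_smul, one_kronecker_one]
  rw [hsub, ← mul_kronecker_mul, hY, one_mul, one_kronecker_one]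

/-- Every eigenvalue of `1 ⊗ A - H ⊗ D` is an eigenvalue of `A - λ D` for some eigenvalue `λ`
of `H`. -/
theorem Matrix.exists_mem_spectrum_of_mem_spectrum_one_kronecker_sub {K ι κ : Type*} [Field K]
    [IsAlgClosed K] [Fintype ι] [DecidableEq ι] [Fintype κ] [DecidableEq κ]
    (A D : Matrix κ κ K) (H : Matrix ι ι K) {z : K}
    (hz : z ∈ spectrum K ((1 : Matrix ι ι K) ⊗ₖ A - H ⊗ₖ D)) :
    ∃ lam ∈ spectrum K H, z ∈ spectrum K (A - lam • D) := by
  have hcomm : Commute ((1 : Matrix ι ι K) ⊗ₖ A - H ⊗ₖ D) (H ⊗ₖ (1 : Matrix κ κ K)) := by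
    simp only [Commute, SemiconjBy, sub_mul, mul_sub, ← mul_kronecker_mul, one_mul, mul_one]
  rw [← Matrix.spectrum_toLin', ← Module.End.hasEigenvalue_iff_mem_spectrum] at hz
  obtain ⟨lam, v, hv, hMv, hHv⟩ :=
    exists_common_eigenvector_of_commute (hcomm.map (Matrix.toLinAlgEquiv' (R := K))) hz
  replace hMv : ((1 : Matrix ι ι K) ⊗ₖ A - H ⊗ₖ D) *ᵥ v = z • v := hMv
  replace hHv : (H ⊗ₖ (1 : Matrix κ κ K)) *ᵥ v = lam • v := hHv
  refine ⟨lam, spectrum_kronecker_one_subset H (mem_spectrum_of_mulVec_eq_smul hv hHv),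
    spectrum_one_kronecker_subset (ι := ι) _ (mem_spectrum_of_mulVec_eq_smul hv ?_)⟩
  have hHD : (H ⊗ₖ D) *ᵥ v = lam • (((1 : Matrix ι ι K) ⊗ₖ D) *ᵥ v) := by
    rw [← mulVec_smul, ← hHv, mulVec_mulVec, ← mul_kronecker_mul, one_mul, mul_one]
  rw [← hMv, kronecker_sub, kronecker_smul, sub_mulVec, sub_mulVec, smul_mulVec, hHD]



/-- If for every eigenvalue `λ` of `H` the complex matrix `A − λ B C` is
Hurwitz, then the real matrix `Iₙ ⊗ A − H ⊗ (B C)` is Hurwitz. -/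
theorem stmt_5 (ν m n : ℕ)
    (A : Matrix (Fin ν) (Fin ν) ℝ) (B : Matrix (Fin ν) (Fin m) ℝ) (C : Matrix (Fin m) (Fin ν) ℝ)
    (H : Matrix (Fin n) (Fin n) ℝ)
    (h : ∀ lam ∈ spectrum ℂ (H.map Complex.ofReal),
      ∀ z ∈ spectrum ℂ (A.map Complex.ofReal - lam • ((B * C).map Complex.ofReal)), z.re < 0) :
    ∀ z ∈ spectrum ℂ
        (((1 : Matrix (Fin n) (Fin n) ℝ) ⊗ₖ A - H ⊗ₖ (B * C)).map Complex.ofReal),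
      z.re < 0 := by
  intro z hz
  have hmap : ((1 : Matrix (Fin n) (Fin n) ℝ) ⊗ₖ A - H ⊗ₖ (B * C)).map Complex.ofReal =
      (1 : Matrix (Fin n) (Fin n) ℂ) ⊗ₖ A.map Complex.ofReal -
        H.map Complex.ofReal ⊗ₖ (B * C).map Complex.ofReal := by
    ext ⟨i, k⟩ ⟨j, l⟩
    simp only [map_apply, Matrix.sub_apply, kroneckerMap_apply, one_apply, Complex.ofReal_sub,
      Complex.ofReal_mul, apply_ite Complex.ofReal, Complex.ofReal_one, Complex.ofReal_zero]
  rw [hmap] at hz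
  obtain ⟨lam, hlam, hzlam⟩ := exists_mem_spectrum_of_mem_spectrum_one_kronecker_sub _ _ _ hz
  exact h lam hlam z hzlam
end

section
/- Let A ∈ ℝ^{n×n} be Hurwitz. Then there exists a symmetric positive definite matrix P ∈ ℝ^{n×n} such that Aᵀ P + P A = −I_n. -/
open Matrix

open scoped Matrix.Norms.Frobenius

/-- The Cayley transform sends the open left half-plane into the open unit disc. -/
theorem norm_lt_one_of_mem_spectrum_cayley {R : Type*} [Ring R] [Algebra ℂ R] {a v : R}
    (ha : ∀ z ∈ spectrum ℂ a, z.re < 0) (hv : v * (1 - a) = 1) (hv' : (1 - a) * v = 1)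
    {z : ℂ} (hz : z ∈ spectrum ℂ (v * (1 + a))) : ‖z‖ < 1 := by
  by_contra! h
  apply hz
  have hvu : IsUnit v := ⟨⟨v, 1 - a, hv, hv'⟩, rfl⟩
  have key : algebraMap ℂ R z - v * (1 + a) = v * ((z - 1) • (1 : R) - (z + 1) • a) := by
    have h1 : algebraMap ℂ R z = v * (z • (1 - a)) := by
      rw [mul_smul_comm, hv, Algebra.algebraMap_eq_smul_one]
    rw [h1, ← mul_sub]
    congr 1
    module
  change IsUnit _
  rw [key]
  refine hvu.mul ?_
  by_cases hz1 : z + 1 = 0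
  · rw [hz1, zero_smul, sub_zero, ← Algebra.algebraMap_eq_smul_one]
    refine (IsUnit.mk0 _ fun h0 => ?_).map _
    have : (2 : ℂ) = 0 := by linear_combination hz1 - h0
    norm_num at this
  · have hw : (z - 1) / (z + 1) ∉ spectrum ℂ a := fun hmem => by
      have := ha _ hmem
      rw [Complex.div_re, ← add_div, div_lt_iff₀ (Complex.normSq_pos.2 hz1)] at this
      have hn : 1 ≤ ‖z‖ ^ 2 := one_le_pow₀ h
      rw [← Complex.normSq_eq_norm_sq, Complex.normSq_apply] at hn
      simp at this
      nlinarith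
    rw [spectrum.notMem_iff] at hw
    have : (z - 1) • (1 : R) - (z + 1) • a
        = algebraMap ℂ R (z + 1) * (algebraMap ℂ R ((z - 1) / (z + 1)) - a) := by
      rw [mul_sub, ← map_mul, mul_div_cancel₀ _ hz1, Algebra.algebraMap_eq_smul_one (z - 1),
        ← Algebra.smul_def]
    rw [this]
    exact ((IsUnit.mk0 _ hz1).map _).mul hw

/-- In a complex Banach algebra, the powers of an element whose spectrum lies in the open unit disc
decay geometrically. -/
theorem exists_eventually_norm_pow_le {R : Type*} [NormedRing R] [NormedAlgebra ℂ R]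
    [CompleteSpace R] {b : R} (hb : ∀ z ∈ spectrum ℂ b, ‖z‖ < 1) :
    ∃ r : ℝ, 0 ≤ r ∧ r < 1 ∧ ∀ᶠ k : ℕ in Filter.atTop, ‖b ^ k‖ ≤ r ^ k := by
  cases subsingleton_or_nontrivial R
  · exact ⟨0, le_rfl, one_pos, .of_forall fun k => by
      rw [Subsingleton.elim (b ^ k) 0, norm_zero]; positivity⟩
  have h1 : spectralRadius ℂ b < 1 :=
    spectrum.spectralRadius_lt_of_forall_lt b (r := 1) fun z hz => hb z hz
  obtain ⟨r, hr, hr1⟩ := ENNReal.lt_iff_exists_nnreal_btwn.1 h1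
  refine ⟨r, r.2, by exact_mod_cast hr1, ?_⟩
  filter_upwards [(spectrum.pow_nnnorm_pow_one_div_tendsto_nhds_spectralRadius b).eventually_lt_const
    hr, Filter.eventually_gt_atTop 0] with k hk hk0
  have hk0' : (0 : ℝ) < k := by exact_mod_cast hk0
  rw [one_div, ENNReal.rpow_inv_lt_iff hk0', ENNReal.rpow_natCast] at hk
  exact_mod_cast hk.le

/-- The Stein equation `P = Q + Bᵀ P B` has a positive definite solution when `Q` is positive
definite and the spectrum of `B` lies in the open unit disc. -/
theorem exists_posDef_stein {ι : Type*} [Fintype ι] [DecidableEq ι] {B Q : Matrix ι ι ℝ}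
    (hB : ∀ z ∈ spectrum ℂ (B.map Complex.ofReal), ‖z‖ < 1) (hQ : Q.PosDef) :
    ∃ P : Matrix ι ι ℝ, P.PosDef ∧ P = Q + Bᵀ * P * B := by
  obtain ⟨r, hr0, hr1, hr⟩ := exists_eventually_norm_pow_le hB
  have hnorm (k : ℕ) : ‖(B.map Complex.ofReal) ^ k‖ = ‖B ^ k‖ := by
    have : (B.map Complex.ofReal) ^ k = (B ^ k).map Complex.ofReal :=
      (map_pow (Complex.ofRealHom.mapMatrix (m := ι)) B k).symm
    rw [this, frobenius_norm_map_eq _ _ Complex.norm_real]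
  let f : ℕ → Matrix ι ι ℝ := fun k => (B ^ k)ᵀ * Q * B ^ k
  have hf : Summable f := by
    have hg : Summable fun k : ℕ => ‖Q‖ * (r ^ 2) ^ k :=
      (summable_geometric_of_lt_one (by positivity) (by nlinarith)).mul_left _
    refine hg.of_norm_bounded_eventually_nat ?_
    filter_upwards [hr] with k hk
    rw [hnorm] at hk
    calc ‖f k‖ ≤ ‖(B ^ k)ᵀ‖ * ‖Q‖ * ‖B ^ k‖ :=
          (norm_mul_le _ _).trans (by gcongr; exact norm_mul_le _ _)
      _ = ‖B ^ k‖ * ‖Q‖ * ‖B ^ k‖ := by rw [frobenius_norm_transpose]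
      _ ≤ r ^ k * ‖Q‖ * r ^ k := by gcongr
      _ = ‖Q‖ * (r ^ 2) ^ k := by ring
  have hfpos (k : ℕ) : (f k).PosSemidef := by
    simpa [f] using hQ.posSemidef.conjTranspose_mul_mul_same (B ^ k)
  have hstein : ∑' k, f k = Q + Bᵀ * (∑' k, f k) * B := by
    conv_lhs => rw [hf.tsum_eq_zero_add]
    rw [← hf.tsum_mul_left, ← (hf.mul_left _).tsum_mul_right]
    congr 1
    · simp [f]
    · refine tsum_congr fun k => ?_
      simp only [f, pow_succ, transpose_mul, Matrix.mul_assoc]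
  have hpsd : (∑' k, f k).PosSemidef := by
    refine .of_dotProduct_mulVec_nonneg ?_ fun x => ?_
    · change (∑' k, f k)ᴴ = _
      rw [conjTranspose_tsum]
      exact tsum_congr fun k => (hfpos k).1
    · let φ : Matrix ι ι ℝ →+ ℝ :=
        { toFun := fun M => star x ⬝ᵥ (M *ᵥ x)
          map_zero' := by simp
          map_add' := fun M N => by rw [add_mulVec, dotProduct_add] }
      have hφ : Continuous φ := by
        change Continuous fun M : Matrix ι ι ℝ => star x ⬝ᵥ (M *ᵥ x)
        fun_prop
      exact (hf.hasSum.map φ hφ).nonneg fun k => (hfpos k).dotProduct_mulVec_nonneg x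
  refine ⟨∑' k, f k, ?_, hstein⟩
  rw [hstein]
  exact hQ.add_posSemidef (by simpa using hpsd.conjTranspose_mul_mul_same B)

/-- **Lyapunov equation.**  If `A` is Hurwitz, there exists a symmetric positive
definite `P` with `Aᵀ P + P A = −I`.  (Over `ℝ`, `Matrix.PosDef` includes the symmetry
`Pᵀ = P` via its Hermitian component.) -/
theorem stmt_7 (n : ℕ) (A : Matrix (Fin n) (Fin n) ℝ)
    (hA : ∀ z ∈ spectrum ℂ (A.map Complex.ofReal), z.re < 0) :
    ∃ P : Matrix (Fin n) (Fin n) ℝ, P.PosDef ∧ Pᵀ = P ∧ Aᵀ * P + P * A = -1 := by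
  let F := Complex.ofRealHom.mapMatrix (m := Fin n)
  have hdet : IsUnit (1 - A).det := by
    have h1 : (1 : ℂ) ∉ spectrum ℂ (F A) := fun h => by
      have := hA 1 h
      norm_num at this
    rw [spectrum.notMem_iff, map_one, ← map_one F, ← map_sub, isUnit_iff_isUnit_det,
      ← RingHom.map_det, isUnit_iff_ne_zero, map_ne_zero] at h1
    exact h1.isUnit
  let V := (1 - A)⁻¹
  have hV : V * (1 - A) = 1 := nonsing_inv_mul _ hdet
  have hV' : (1 - A) * V = 1 := mul_nonsing_inv _ hdet
  have hB : ∀ z ∈ spectrum ℂ ((V * (1 + A)).map Complex.ofReal), ‖z‖ < 1 := by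
    intro z hz
    refine norm_lt_one_of_mem_spectrum_cayley (a := F A) (v := F V) hA ?_ ?_ ?_
    · rw [← map_one F, ← map_sub, ← map_mul, hV]
    · rw [← map_one F, ← map_sub, ← map_mul, hV']
    · rw [← map_one F, ← map_add, ← map_mul]
      exact hz
  have hQ : ((2 : ℝ) • (Vᵀ * V)).PosDef := by
    have : (Vᴴ * V).PosDef :=
      .conjTranspose_mul_self V (mulVec_injective_of_isUnit ⟨⟨V, 1 - A, hV, hV'⟩, rfl⟩)
    rw [conjTranspose_eq_transpose_of_trivial] at this
    exact this.smul two_pos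
  obtain ⟨P, hP, hPS⟩ := exists_posDef_stein hB hQ
  refine ⟨P, hP, by simpa using hP.1.eq, ?_⟩
  have hcomm : V * (1 + A) * (1 - A) = 1 + A := by
    rw [Matrix.mul_assoc, show (1 + A) * (1 - A) = (1 - A) * (1 + A) by noncomm_ring,
      ← Matrix.mul_assoc, hV, Matrix.one_mul]
  have hconj : (1 - A)ᵀ * P * (1 - A) = (2 : ℝ) • 1 + (1 + A)ᵀ * P * (1 + A) := by
    conv_lhs => rw [hPS]
    rw [Matrix.mul_add, Matrix.add_mul]
    congr 1
    · calc (1 - A)ᵀ * ((2 : ℝ) • (Vᵀ * V)) * (1 - A)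
          = (2 : ℝ) • ((V * (1 - A))ᵀ * (V * (1 - A))) := by
            simp only [transpose_mul, Matrix.mul_smul, Matrix.smul_mul, Matrix.mul_assoc]
        _ = (2 : ℝ) • 1 := by rw [hV, transpose_one, Matrix.one_mul]
    · calc (1 - A)ᵀ * ((V * (1 + A))ᵀ * P * (V * (1 + A))) * (1 - A)
          = (V * (1 + A) * (1 - A))ᵀ * P * (V * (1 + A) * (1 - A)) := by
            simp only [transpose_mul, Matrix.mul_assoc]
        _ = (1 + A)ᵀ * P * (1 + A) := by rw [hcomm]
  simp only [transpose_sub, transpose_add, transpose_one, Matrix.sub_mul, Matrix.mul_sub,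
    Matrix.add_mul, Matrix.mul_add, Matrix.one_mul, Matrix.mul_one] at hconj
  have h2 : (2 : ℝ) • (Aᵀ * P + P * A) = (2 : ℝ) • (-1) := by
    linear_combination (norm := module) (-1 : ℝ) • hconj
  exact smul_right_injective _ two_ne_zero h2
end

section
/- Let f : [0,∞) → ℝ be differentiable, with f and f' both bounded on [0,∞), and suppose ∫₀^∞ f(t)² dt < ∞. Then lim_{t→∞} f(t) = 0. -/
open Filter Set MeasureTheory

/-- If `f : [0,∞) → ℝ` is differentiable with `f` and `f'` bounded, and
`∫₀^∞ f(t)² dt < ∞`, then `f(t) → 0` as `t → ∞`. -/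
theorem stmt_11 (f f' : ℝ → ℝ)
    (hderiv : ∀ t, 0 ≤ t → HasDerivWithinAt f (f' t) (Ici 0) t)
    (hf_bdd : ∃ B, ∀ t, 0 ≤ t → |f t| ≤ B)
    (hf'_bdd : ∃ B, ∀ t, 0 ≤ t → |f' t| ≤ B)
    (hL2 : IntegrableOn (fun t => (f t) ^ 2) (Ici 0)) :
    Tendsto f atTop (nhds 0) := by
  obtain ⟨B, hB⟩ := hf_bdd
  obtain ⟨C, hC⟩ := hf'_bdd
  have hd : ∀ t ∈ Ioi (0 : ℝ), HasDerivAt f (f' t) t := fun t ht =>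
    (hderiv t (le_of_lt ht)).hasDerivAt (Ici_mem_nhds ht)
  have hsq : IntegrableOn (fun t => (f t) ^ 2) (Ioi 0) := hL2.mono_set Ioi_subset_Ici_self
  have hf_meas : AEStronglyMeasurable f (volume.restrict (Ioi 0)) :=
    ContinuousOn.aestronglyMeasurable (fun t ht => (hd t ht).continuousAt.continuousWithinAt)
      measurableSet_Ioi
  have hf'_meas : AEStronglyMeasurable f' (volume.restrict (Ioi 0)) :=
    (aestronglyMeasurable_deriv f _).congr <|
      (ae_restrict_mem measurableSet_Ioi).mono fun t ht => (hd t ht).deriv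
  have hcube : IntegrableOn (fun t => f t * (f t) ^ 2) (Ioi 0) :=
    hsq.bdd_mul hf_meas <|
      (ae_restrict_mem measurableSet_Ioi).mono fun t ht => hB t (le_of_lt ht)
  have hcube' : IntegrableOn (fun t => f' t * (f t) ^ 2) (Ioi 0) :=
    hsq.bdd_mul hf'_meas <|
      (ae_restrict_mem measurableSet_Ioi).mono fun t ht => hC t (le_of_lt ht)
  have hlim : Tendsto (fun t => f t * (f t) ^ 2) atTop (nhds 0) :=
    tendsto_zero_of_hasDerivAt_of_integrableOn_Ioi
      (fun t ht => ((hd t ht).mul ((hd t ht).pow 2)).congr_deriv (by simp; ring))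
      (hcube'.const_mul 3) hcube
  have habs : Tendsto (fun t => |f t| ^ 3) atTop (nhds 0) :=
    hlim.abs.congr' (.of_forall fun t => by rw [abs_mul, abs_pow]; ring) |>.trans (by simp)
  rw [tendsto_zero_iff_abs_tendsto_zero]
  have hroot := habs.rpow_const (p := (1 / 3 : ℝ)) (Or.inr (by norm_num))
  rw [Real.zero_rpow (by norm_num)] at hroot
  refine hroot.congr fun t => ?_
  simpa using Real.pow_rpow_inv_natCast (abs_nonneg (f t)) (three_ne_zero : (3 : ℕ) ≠ 0)
end

section
/- Consider N heterogeneous nonlinear subsystems in parametric strict-feedback form: for i = 1,…,N, ẋ_{i,l} = x_{i,l+1} + ψ_{i,l}(x_{i,1},…,x_{i,l})ᵀ θ_i for l = 1,…,r_i−1, ẋ_{i,r_i} = u_i + ψ_{i,r_i}(x_{i,1},…,x_{i,r_i})ᵀ θ_i, y_i = x_{i,1}, where θ_i ∈ ℝ^{m_i} are unknown constant vectors and ψ_{i,l} are known smooth functions; a leader ẋ₀ = A x₀, y₀ = C x₀ with A ∈ ℝ^{ν×ν} neutrally stable (all eigenvalues semi-simple with zero real part) and (A, C) detectable; a communication digraph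 Ḡ on {v₀,…,v_N} with weights a_{ij} containing a directed spanning tree rooted at v₀. Let each agent run the distributed dynamic compensator η̇_{i,l} = A η_{i,l} − K C(η_{i,l} − η_{i,l+1}) (l = 1,…,r_i), η̇_{i,r_i+1} = A η_{i,r_i+1} − K C Σ_{j=0}^N a_{ij}(η_{i,r_i+1} − η_{i,1}) − K Σ_{j=0}^N a_{ij}(y_i − y_j), ŷ_i = C η_{i,1}, with gain K = μ P₀ Cᵀ, μ > 1/min Re(λ(Ĥ)), where P₀ solves A P₀ + P₀ Aᵀ + I − P₀ Cᵀ C P₀ = 0 and Ĥ is the expanded graph matrix. Let each agent use the adaptive backstepping controller with errors ê_{i,1} = y_i − ŷ_i, ê_{i,l} = x_{i,l} − α_{i,l−1} (l = 2,…,r_i), tuning functions τ_{i,1} = ψ_{i,1} ê_{i,1}, τ_{i,k} = τ_{i,k−1} + (ψ_{i,k} − Σ_{l=1}^{k−1} ψ_{i,l} ∂α_{i,k−1}/∂x_{i,l}) ê_{i,k}, virtual controls α_{i,1} = −c_{i,1} ê_{i,1} − ψ_{i,1}ᵀ θ̂_i + C A η_{i,1} − C K C(η_{i,1} − η_{i,2}),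 α_{i,k} defined recursively by the standard backstepping formula compensating the compensator dynamics and tuning-function cross terms, parameter update θ̂̇_i = τ_{i,r_i}, and u_i = α_{i,r_i}, where c_{i,l} > 0 are design constants. Then every solution of the closed-loop system is globally uniformly bounded, and lim_{t→∞} (y_i(t) − y₀(t)) = 0 for all i = 1,…,N. -/
open Filter Set Matrix

/-- A function whose squared norm on `[0, ∞)` is at most the decay rate of some nonnegative
differentiable storage function. -/
def SqDissipated {E : Type*} [NormedAddCommGroup E] (f : ℝ → E) : Prop :=
  ∃ W W' : ℝ → ℝ, (∀ t, 0 ≤ t → 0 ≤ W t) ∧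
    (∀ t, 0 ≤ t → HasDerivWithinAt W (W' t) (Ici 0) t) ∧ ∀ t, 0 ≤ t → ‖f t‖ ^ 2 ≤ -W' t

theorem antitoneOn_Ici_of_hasDerivWithinAt_nonpos {a : ℝ} (ha : 0 ≤ a) {f f' : ℝ → ℝ}
    (hf : ∀ t, 0 ≤ t → HasDerivWithinAt f (f' t) (Ici 0) t) (hf' : ∀ t, a ≤ t → f' t ≤ 0) :
    AntitoneOn f (Ici a) := by
  have hsub : Ici a ⊆ Ici (0 : ℝ) := Ici_subset_Ici.2 ha
  refine antitoneOn_of_hasDerivWithinAt_nonpos (f' := f') (convex_Ici a)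
    (fun t ht => ((hf t (hsub ht)).mono hsub).continuousWithinAt) ?_ ?_
  · intro t ht
    rw [interior_Ici] at ht ⊢
    exact (hf t (hsub (mem_Ici.2 (le_of_lt ht)))).mono (Ioi_subset_Ici_self.trans hsub)
  · intro t ht
    rw [interior_Ici] at ht
    exact hf' t (le_of_lt ht)

theorem exists_tendsto_of_antitoneOn_Ici {f : ℝ → ℝ} (hf : AntitoneOn f (Ici 0))
    (h0 : ∀ t, 0 ≤ t → 0 ≤ f t) : ∃ L, 0 ≤ L ∧ Tendsto f atTop (nhds L) := by
  have hg : Antitone (fun t => f (max t 0)) := fun s t hst =>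
    hf (le_max_right s 0) (le_max_right t 0) (max_le_max_right 0 hst)
  have hb : BddBelow (range fun t => f (max t 0)) :=
    ⟨0, by rintro _ ⟨t, rfl⟩; exact h0 _ (le_max_right t 0)⟩
  refine ⟨_, ?_, (tendsto_atTop_ciInf hg hb).congr' ?_⟩
  · exact le_ciInf fun t => h0 _ (le_max_right t 0)
  · filter_upwards [eventually_ge_atTop 0] with t ht
    simp [max_eq_left ht]

/-- A nonnegative function whose growth and whose size are both controlled by the decay of
nonnegative storage functions tends to zero. -/
theorem tendsto_zero_of_storage {U U' W₁ W₁' W₂ W₂' : ℝ → ℝ}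
    (hU : ∀ t, 0 ≤ t → 0 ≤ U t) (hW₁ : ∀ t, 0 ≤ t → 0 ≤ W₁ t) (hW₂ : ∀ t, 0 ≤ t → 0 ≤ W₂ t)
    (dU : ∀ t, 0 ≤ t → HasDerivWithinAt U (U' t) (Ici 0) t)
    (dW₁ : ∀ t, 0 ≤ t → HasDerivWithinAt W₁ (W₁' t) (Ici 0) t)
    (dW₂ : ∀ t, 0 ≤ t → HasDerivWithinAt W₂ (W₂' t) (Ici 0) t)
    (h₁ : ∀ t, 0 ≤ t → W₁' t ≤ 0) (hU₁ : ∀ t, 0 ≤ t → U' t + W₁' t ≤ 0)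
    (h₂ : ∀ t, 0 ≤ t → W₂' t ≤ -U t) : Tendsto U atTop (nhds 0) := by
  obtain ⟨L₁, -, hL₁⟩ := exists_tendsto_of_antitoneOn_Ici
    (antitoneOn_Ici_of_hasDerivWithinAt_nonpos le_rfl dW₁ h₁) hW₁
  obtain ⟨L₂, -, hL₂⟩ := exists_tendsto_of_antitoneOn_Ici
    (antitoneOn_Ici_of_hasDerivWithinAt_nonpos le_rfl
      (fun t ht => (dU t ht).add (dW₁ t ht)) hU₁)
    (fun t ht => add_nonneg (hU t ht) (hW₁ t ht))
  have hlim : Tendsto U atTop (nhds (L₂ - L₁)) :=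
    (hL₂.sub hL₁).congr fun t => by simp
  have hL : 0 ≤ L₂ - L₁ :=
    ge_of_tendsto hlim ((eventually_ge_atTop 0).mono hU)
  rcases hL.eq_or_lt with h | h
  · rwa [← h] at hlim
  exfalso
  set L := L₂ - L₁
  obtain ⟨T, hT⟩ := eventually_atTop.1
    ((hlim.eventually (lt_mem_nhds (half_lt_self h))).and (eventually_ge_atTop 0))
  have hT0 : 0 ≤ T := (hT T le_rfl).2
  have hanti := antitoneOn_Ici_of_hasDerivWithinAt_nonpos hT0
    (f := fun t => W₂ t + (L / 2) * t) (f' := fun t => W₂' t + (L / 2) * 1)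
    (fun t ht => (dW₂ t ht).add ((hasDerivWithinAt_id t _).const_mul (L / 2)))
    (fun t ht => by
      have := h₂ t (hT0.trans ht)
      have := (hT t ht).1
      linarith)
  have hs : T ≤ T + (W₂ T + 1) / (L / 2) := by
    have := hW₂ T hT0
    have : 0 ≤ (W₂ T + 1) / (L / 2) := by positivity
    linarith
  have h3 := hanti (self_mem_Ici) hs hs
  have h4 := hW₂ _ (hT0.trans hs)
  have h5 : L / 2 * ((W₂ T + 1) / (L / 2)) = W₂ T + 1 := by field_simp
  simp only [mul_add, h5] at h3
  linarith

namespace SqDissipated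

variable {E F : Type*} [NormedAddCommGroup E] [NormedAddCommGroup F]

theorem of_norm_le {f : ℝ → E} {g : ℝ → F} (k : ℝ) (hf : SqDissipated f)
    (h : ∀ t, 0 ≤ t → ‖g t‖ ≤ k * ‖f t‖) : SqDissipated g := by
  obtain ⟨W, W', h0, hd, hle⟩ := hf
  refine ⟨fun t => k ^ 2 * W t, fun t => k ^ 2 * W' t,
    fun t ht => mul_nonneg (sq_nonneg k) (h0 t ht), fun t ht => (hd t ht).const_mul _, ?_⟩
  intro t ht
  calc ‖g t‖ ^ 2 ≤ (k * ‖f t‖) ^ 2 := pow_le_pow_left₀ (norm_nonneg _) (h t ht) 2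
    _ = k ^ 2 * ‖f t‖ ^ 2 := by ring
    _ ≤ k ^ 2 * (-W' t) := mul_le_mul_of_nonneg_left (hle t ht) (sq_nonneg k)
    _ = -(k ^ 2 * W' t) := by ring

theorem add {f g : ℝ → E} (hf : SqDissipated f) (hg : SqDissipated g) :
    SqDissipated fun t => f t + g t := by
  obtain ⟨W, W', h0, hd, hle⟩ := hf
  obtain ⟨Z, Z', k0, kd, kle⟩ := hg
  refine ⟨fun t => 2 * (W t + Z t), fun t => 2 * (W' t + Z' t),
    fun t ht => mul_nonneg two_pos.le (add_nonneg (h0 t ht) (k0 t ht)),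
    fun t ht => ((hd t ht).add (kd t ht)).const_mul 2, ?_⟩
  intro t ht
  have h1 : ‖f t + g t‖ ^ 2 ≤ (‖f t‖ + ‖g t‖) ^ 2 :=
    pow_le_pow_left₀ (norm_nonneg _) (norm_add_le _ _) 2
  nlinarith [hle t ht, kle t ht, sq_nonneg (‖f t‖ - ‖g t‖)]

protected theorem zero : SqDissipated fun _ : ℝ => (0 : E) :=
  ⟨fun _ => 0, fun _ => 0, fun _ _ => le_rfl, fun _ _ => hasDerivWithinAt_const _ _ _,
    fun _ _ => by simp⟩

theorem sum {ι : Type*} (s : Finset ι) {f : ι → ℝ → E} (hf : ∀ i ∈ s, SqDissipated (f i)) :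
    SqDissipated fun t => ∑ i ∈ s, f i t := by
  classical
  induction s using Finset.induction_on with
  | empty => simpa using SqDissipated.zero
  | insert i s hi ih =>
    simp only [Finset.sum_insert hi]
    exact (hf i (s.mem_insert_self i)).add
      (ih fun j hj => hf j (Finset.mem_insert_of_mem hj))

theorem clm {𝕜 : Type*} [NontriviallyNormedField 𝕜] [NormedSpace 𝕜 E] [NormedSpace 𝕜 F]
    {f : ℝ → E} (hf : SqDissipated f) (G : E →L[𝕜] F) : SqDissipated fun t => G (f t) :=
  hf.of_norm_le ‖G‖ fun t _ => G.le_opNorm (f t)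

theorem neg {f : ℝ → E} (hf : SqDissipated f) : SqDissipated fun t => -f t :=
  hf.of_norm_le 1 fun t _ => by simp

/-- Barbalat-type statement: a bounded square-dissipated real function with bounded
derivative tends to zero. -/
theorem tendsto_zero {f f' : ℝ → ℝ} (hf : SqDissipated f)
    (hd : ∀ t, 0 ≤ t → HasDerivWithinAt f (f' t) (Ici 0) t)
    {B B' : ℝ} (hB : ∀ t, 0 ≤ t → |f t| ≤ B) (hB' : ∀ t, 0 ≤ t → |f' t| ≤ B') :
    Tendsto f atTop (nhds 0) := by
  obtain ⟨W, W', h0, hW, hle⟩ := hf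
  have hBn : 0 ≤ B := (abs_nonneg _).trans (hB 0 le_rfl)
  have hBn' : 0 ≤ B' := (abs_nonneg _).trans (hB' 0 le_rfl)
  have hle' : ∀ t, 0 ≤ t → f t ^ 2 ≤ -W' t := fun t ht => by simpa using hle t ht
  have key : Tendsto (fun t => f t ^ 4) atTop (nhds 0) := by
    refine tendsto_zero_of_storage (U' := fun t => (4 : ℕ) * f t ^ 3 * f' t)
      (W₁ := fun t => 4 * B * B' * W t) (W₁' := fun t => 4 * B * B' * W' t)
      (W₂ := fun t => B ^ 2 * W t) (W₂' := fun t => B ^ 2 * W' t)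
      (fun t _ => by positivity)
      (fun t ht => mul_nonneg (by positivity) (h0 t ht))
      (fun t ht => mul_nonneg (by positivity) (h0 t ht))
      (fun t ht => (hd t ht).fun_pow 4)
      (fun t ht => (hW t ht).const_mul _) (fun t ht => (hW t ht).const_mul _) ?_ ?_ ?_
    · intro t ht
      have : W' t ≤ 0 := by nlinarith [hle' t ht, sq_nonneg (f t)]
      exact mul_nonpos_of_nonneg_of_nonpos (by positivity) this
    · intro t ht
      have h1 : f t * f' t ≤ B * B' := by
        calc f t * f' t ≤ |f t * f' t| := le_abs_self _
          _ = |f t| * |f' t| := abs_mul _ _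
          _ ≤ B * B' := mul_le_mul (hB t ht) (hB' t ht) (abs_nonneg _) hBn
      have h2 : f t * f' t * f t ^ 2 ≤ B * B' * f t ^ 2 :=
        mul_le_mul_of_nonneg_right h1 (sq_nonneg _)
      have h3 : B * B' * f t ^ 2 ≤ B * B' * (-W' t) :=
        mul_le_mul_of_nonneg_left (hle' t ht) (by positivity)
      push_cast
      nlinarith
    · intro t ht
      have h1 : f t ^ 2 ≤ B ^ 2 := sq_le_sq' (abs_le.1 (hB t ht)).1 (abs_le.1 (hB t ht)).2
      have h2 : f t ^ 2 * f t ^ 2 ≤ B ^ 2 * f t ^ 2 :=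
        mul_le_mul_of_nonneg_right h1 (sq_nonneg _)
      have h3 : B ^ 2 * f t ^ 2 ≤ B ^ 2 * (-W' t) :=
        mul_le_mul_of_nonneg_left (hle' t ht) (by positivity)
      nlinarith
  have h4 : Tendsto (fun t => Real.sqrt (Real.sqrt (f t ^ 4))) atTop (nhds 0) := by
    simpa using key.sqrt.sqrt
  refine (tendsto_zero_iff_abs_tendsto_zero f).2 (h4.congr fun t => ?_)
  rw [show f t ^ 4 = (f t ^ 2) ^ 2 by ring, Real.sqrt_sq (sq_nonneg _), Real.sqrt_sq_eq_abs]
  rfl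

end SqDissipated

/-- A strictly dissipative linear system driven by a square-dissipated input has a
square-dissipated state that tends to zero. -/
theorem sqDissipated_and_tendsto_of_dissipative {E : Type*} [NormedAddCommGroup E]
    [InnerProductSpace ℂ E] (G : E → E) {ε : ℝ} (hε : 0 < ε)
    (hG : ∀ v, (inner ℂ v (G v)).re ≤ -ε * ‖v‖ ^ 2) {β h : ℝ → E} (hh : SqDissipated h)
    (hβ : ∀ t, 0 ≤ t → HasDerivWithinAt β (G (β t) + h t) (Ici 0) t) :
    SqDissipated β ∧ Tendsto β atTop (nhds 0) := by
  let _ : InnerProductSpace ℝ E := InnerProductSpace.rclikeToReal ℂ E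
  obtain ⟨W, W', h0, hW, hle⟩ := hh
  have hV : ∀ t, 0 ≤ t → HasDerivWithinAt (fun t => ‖β t‖ ^ 2)
      (2 * (inner ℂ (β t) (G (β t) + h t)).re) (Ici 0) t := fun t ht =>
    (hβ t ht).norm_sq
  have hbound : ∀ t, 0 ≤ t → 2 * (inner ℂ (β t) (G (β t) + h t)).re ≤
      -ε * ‖β t‖ ^ 2 + ε⁻¹ * (-W' t) := fun t ht => by
    rw [inner_add_right, Complex.add_re]
    have h1 := hG (β t)
    have h2 : (inner ℂ (β t) (h t)).re ≤ ‖β t‖ * ‖h t‖ := re_inner_le_norm (𝕜 := ℂ) _ _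
    have h3 : ε⁻¹ * ‖h t‖ ^ 2 ≤ ε⁻¹ * (-W' t) :=
      mul_le_mul_of_nonneg_left (hle t ht) (by positivity)
    have h4 : 0 ≤ ε⁻¹ * (ε * ‖β t‖ - ‖h t‖) ^ 2 := by positivity
    have h5 : ε⁻¹ * (ε * ‖β t‖ - ‖h t‖) ^ 2 =
        ε * ‖β t‖ ^ 2 - 2 * (‖β t‖ * ‖h t‖) + ε⁻¹ * ‖h t‖ ^ 2 := by
      field_simp
      ring
    linarith
  have hW' : ∀ t, 0 ≤ t → W' t ≤ 0 := fun t ht => by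
    linarith [hle t ht, sq_nonneg ‖h t‖]
  have hstore : ∀ t, 0 ≤ t → HasDerivWithinAt (fun t => ε⁻¹ * (‖β t‖ ^ 2 + ε⁻¹ * W t))
      (ε⁻¹ * (2 * (inner ℂ (β t) (G (β t) + h t)).re + ε⁻¹ * W' t)) (Ici 0) t :=
    fun t ht => ((hV t ht).add ((hW t ht).const_mul _)).const_mul _
  have hpos : ∀ t, 0 ≤ t → 0 ≤ ε⁻¹ * (‖β t‖ ^ 2 + ε⁻¹ * W t) := fun t ht => by
    have := h0 t ht
    positivity
  have hdec : ∀ t, 0 ≤ t →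
      ‖β t‖ ^ 2 ≤ -(ε⁻¹ * (2 * (inner ℂ (β t) (G (β t) + h t)).re + ε⁻¹ * W' t)) :=
    fun t ht => by
      have h1 : ε⁻¹ * (2 * (inner ℂ (β t) (G (β t) + h t)).re + ε⁻¹ * W' t) ≤
          ε⁻¹ * (-ε * ‖β t‖ ^ 2) :=
        mul_le_mul_of_nonneg_left (by linarith [hbound t ht]) (by positivity)
      have h2 : ε⁻¹ * (-ε * ‖β t‖ ^ 2) = -‖β t‖ ^ 2 := by field_simp
      linarith
  refine ⟨⟨_, _, hpos, hstore, hdec⟩, ?_⟩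
  have hlim : Tendsto (fun t => ‖β t‖ ^ 2) atTop (nhds 0) :=
    tendsto_zero_of_storage (fun t _ => sq_nonneg _)
      (fun t ht => mul_nonneg (inv_nonneg.2 hε.le) (h0 t ht)) hpos hV
      (fun t ht => (hW t ht).const_mul ε⁻¹) hstore
      (fun t ht => mul_nonpos_of_nonneg_of_nonpos (by positivity) (hW' t ht))
      (fun t ht => by
        have := hbound t ht
        have : 0 ≤ ε * ‖β t‖ ^ 2 := by positivity
        linarith)
      (fun t ht => by linarith [hdec t ht])
  rw [tendsto_zero_iff_norm_tendsto_zero]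
  simpa using hlim.sqrt

theorem Matrix.spectrum_transpose_eq {ι : Type*} [Fintype ι] [DecidableEq ι]
    (H : Matrix ι ι ℂ) : spectrum ℂ Hᵀ = spectrum ℂ H := by
  ext z
  rw [spectrum.mem_iff, spectrum.mem_iff, ← Matrix.isUnit_transpose (algebraMap ℂ _ z - H)]
  simp [Matrix.algebraMap_eq_diagonal]

open scoped MatrixOrder in
theorem Matrix.PosDef.exists_isUnit_mul_transpose {n : ℕ} {P : Matrix (Fin n) (Fin n) ℝ}
    (hP : P.PosDef) : ∃ R : Matrix (Fin n) (Fin n) ℝ, IsUnit R ∧ P = R * Rᵀ := by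
  obtain ⟨B, hB⟩ := CStarAlgebra.nonneg_iff_eq_star_mul_self.1 hP.posSemidef.nonneg
  have h : P = Bᵀ * Bᵀᵀ := by
    rw [hB, Matrix.star_eq_conjTranspose, Matrix.conjTranspose_eq_transpose_of_trivial,
      Matrix.transpose_transpose]
  refine ⟨Bᵀ, ?_, h⟩
  rw [Matrix.isUnit_iff_isUnit_det]
  have := hP.det_pos
  rw [h, Matrix.det_mul] at this
  exact isUnit_iff_ne_zero.2 fun h0 => by simp [h0] at this

/-- The Lyapunov inequality for `A - z P Cᵀ C` with `1 / 2 ≤ Re z`, where `P` solves the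
Riccati equation, written for a quadratic form in the dual variable. -/
theorem riccati_dissipation {n : ℕ} {A P : Matrix (Fin n) (Fin n) ℝ}
    {C : Matrix (Fin 1) (Fin n) ℝ} (hP : P.PosDef)
    (hRic : A * P + P * Aᵀ + 1 - P * Cᵀ * C * P = 0) {z : ℂ} (hz : 1 / 2 ≤ z.re)
    (w : Fin n → ℂ) :
    (star w ⬝ᵥ (((A.map Complex.ofReal - z • (P * Cᵀ * C).map Complex.ofReal) *
      P.map Complex.ofReal) *ᵥ w)).re ≤ -(1 / 2) * (star w ⬝ᵥ w).re := by
  set c : Matrix (Fin n) (Fin n) ℝ →+* Matrix (Fin n) (Fin n) ℂ :=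
    (Complex.ofRealHom : ℝ →+* ℂ).mapMatrix with hc
  have hcm : ∀ X : Matrix (Fin n) (Fin n) ℝ, X.map Complex.ofReal = c X := fun X => rfl
  have hcs : ∀ X : Matrix (Fin n) (Fin n) ℝ, (c X)ᴴ = c Xᵀ := fun X => by
    ext i j
    simp [hc, Matrix.conjTranspose_apply]
  have hPs : Pᵀ = P := by
    rw [← Matrix.conjTranspose_eq_transpose_of_trivial]; exact hP.isHermitian
  simp only [hcm]
  set F := (c A - z • c (P * Cᵀ * C)) * c P with hF
  set D : Matrix (Fin 1) (Fin n) ℂ := (C * P).map Complex.ofReal with hD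
  have hDD : c (P * Cᵀ * C * P) = Dᴴ * D := by
    have h1 : P * Cᵀ * C * P = (C * P)ᵀ * (C * P) := by
      simp [Matrix.transpose_mul, hPs, Matrix.mul_assoc]
    rw [h1]
    ext i j
    simp [hc, hD, Matrix.mul_apply]
    exact Or.inl (Finset.sum_congr rfl fun _ _ => mul_comm _ _)
  have hsum : F + Fᴴ = -1 - (2 * z.re - 1 : ℂ) • (Dᴴ * D) := by
    have hR : c A * c P + c P * c Aᵀ = c (P * Cᵀ * C * P) - 1 := by
      have := congrArg c hRic
      simp only [map_add, map_sub, map_mul, map_one, map_zero] at this ⊢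
      exact eq_sub_of_add_eq (sub_eq_zero.1 this)
    have h1 : Fᴴ = c P * c Aᵀ - (starRingEnd ℂ z) • c (P * Cᵀ * C * P) := by
      rw [hF, Matrix.conjTranspose_mul, Matrix.conjTranspose_sub, Matrix.conjTranspose_smul,
        hcs, hcs, hcs, hPs, Matrix.mul_sub, Matrix.mul_smul, ← map_mul c P (_)ᵀ]
      congr 3
      simp [Matrix.transpose_mul, hPs, Matrix.mul_assoc]
    have h2 : F = c A * c P - z • c (P * Cᵀ * C * P) := by
      rw [hF, Matrix.sub_mul, Matrix.smul_mul, map_mul c (P * Cᵀ * C) P]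
    have h3 : (z + starRingEnd ℂ z) = 2 * z.re := by
      rw [Complex.add_conj]; push_cast; ring
    rw [h1, h2, ← hDD]
    calc _ = (c A * c P + c P * c Aᵀ) - (z + starRingEnd ℂ z) • c (P * Cᵀ * C * P) := by
            rw [add_smul]; abel
      _ = _ := by rw [hR, h3, sub_smul, one_smul]; abel
  have hre : (star w ⬝ᵥ (F *ᵥ w)).re * 2 = (star w ⬝ᵥ ((F + Fᴴ) *ᵥ w)).re := by
    have : star w ⬝ᵥ (Fᴴ *ᵥ w) = star (star w ⬝ᵥ (F *ᵥ w)) := by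
      rw [Matrix.dotProduct_mulVec, ← Matrix.star_mulVec, Matrix.star_dotProduct,
        dotProduct_comm]
    rw [Matrix.add_mulVec, dotProduct_add, this, Complex.add_re]
    simp
    ring
  have hnn : 0 ≤ (star w ⬝ᵥ ((Dᴴ * D) *ᵥ w)).re := by
    rw [← Matrix.mulVec_mulVec, Matrix.dotProduct_mulVec, ← Matrix.star_mulVec]
    simp only [dotProduct, Complex.re_sum]
    refine Finset.sum_nonneg fun i _ => ?_
    simp only [Pi.star_apply, RCLike.star_def, Complex.mul_re, Complex.conj_re, Complex.conj_im]
    nlinarith [mul_self_nonneg ((D *ᵥ w) i).re, mul_self_nonneg ((D *ᵥ w) i).im]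
  have hexp : (star w ⬝ᵥ ((F + Fᴴ) *ᵥ w)).re =
      -(star w ⬝ᵥ w).re - (2 * z.re - 1) * (star w ⬝ᵥ ((Dᴴ * D) *ᵥ w)).re := by
    rw [hsum, Matrix.sub_mulVec, Matrix.neg_mulVec, Matrix.one_mulVec, Matrix.smul_mulVec,
      dotProduct_sub, dotProduct_neg, dotProduct_smul, smul_eq_mul]
    have : (2 * z.re - 1 : ℂ) = ((2 * z.re - 1 : ℝ) : ℂ) := by push_cast; ring
    rw [this, Complex.sub_re, Complex.re_ofReal_mul, Complex.neg_re]
  have := mul_nonneg (show 0 ≤ 2 * z.re - 1 by linarith) hnn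
  linarith

theorem riccati_mode_stable {n : ℕ} {A P : Matrix (Fin n) (Fin n) ℝ}
    {C : Matrix (Fin 1) (Fin n) ℝ} (hP : P.PosDef)
    (hRic : A * P + P * Aᵀ + 1 - P * Cᵀ * C * P = 0) {z : ℂ} (hz : 1 / 2 ≤ z.re)
    {ξ g : ℝ → Fin n → ℂ} (hg : SqDissipated g)
    (hξ : ∀ t, 0 ≤ t → HasDerivWithinAt ξ
      ((A.map Complex.ofReal - z • (P * Cᵀ * C).map Complex.ofReal) *ᵥ ξ t + g t) (Ici 0) t) :
    SqDissipated ξ ∧ Tendsto ξ atTop (nhds 0) := by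
  obtain ⟨R₀, hR₀, hPR⟩ := hP.exists_isUnit_mul_transpose
  set F := A.map Complex.ofReal - z • (P * Cᵀ * C).map Complex.ofReal with hF
  set R : Matrix (Fin n) (Fin n) ℂ := R₀.map Complex.ofReal with hR
  have hRu : IsUnit R := hR₀.map (Complex.ofRealHom : ℝ →+* ℂ).mapMatrix
  have hRdet : IsUnit R.det := (Matrix.isUnit_iff_isUnit_det R).1 hRu
  have hPc : P.map Complex.ofReal = R * Rᴴ := by
    rw [hPR]
    ext i j
    simp [hR, Matrix.mul_apply]
  let e := (EuclideanSpace.equiv (Fin n) ℂ).symm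
  let Φ : (Fin n → ℂ) →L[ℂ] EuclideanSpace ℂ (Fin n) :=
    (e : (Fin n → ℂ) →L[ℂ] EuclideanSpace ℂ (Fin n)) ∘L
      (Matrix.mulVecLin R⁻¹).toContinuousLinearMap
  let Ψ : EuclideanSpace ℂ (Fin n) →L[ℂ] (Fin n → ℂ) :=
    (Matrix.mulVecLin R).toContinuousLinearMap ∘L
      (e.symm : EuclideanSpace ℂ (Fin n) →L[ℂ] (Fin n → ℂ))
  let Θ : EuclideanSpace ℂ (Fin n) →L[ℂ] EuclideanSpace ℂ (Fin n) :=
    (Matrix.toEuclideanLin Rᴴ).toContinuousLinearMap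
  have hΨΦ : ∀ v, Ψ (Φ v) = v := fun v => by
    simp [Φ, Ψ, Matrix.mulVec_mulVec, Matrix.mul_nonsing_inv _ hRdet]
  let G : EuclideanSpace ℂ (Fin n) → EuclideanSpace ℂ (Fin n) := fun v => Φ (F *ᵥ Ψ v)
  have hε : (0 : ℝ) < 1 / (2 * (‖Θ‖ ^ 2 + 1)) := by positivity
  have hG : ∀ v, (inner ℂ v (G v)).re ≤ -(1 / (2 * (‖Θ‖ ^ 2 + 1))) * ‖v‖ ^ 2 := by
    intro v
    set w : Fin n → ℂ := (Rᴴ)⁻¹ *ᵥ WithLp.ofLp v with hw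
    have hRHdet : IsUnit (Rᴴ).det := by rw [Matrix.det_conjTranspose]; exact hRdet.star
    have hvw : WithLp.ofLp v = Rᴴ *ᵥ w := by
      rw [hw, Matrix.mulVec_mulVec, Matrix.mul_nonsing_inv _ hRHdet, Matrix.one_mulVec]
    have hvΘ : v = Θ (WithLp.toLp 2 w) := by
      apply WithLp.ofLp_injective
      rw [hvw]
      simp [Θ]
    have h1 : inner ℂ v (G v) = star w ⬝ᵥ ((F * P.map Complex.ofReal) *ᵥ w) := by
      rw [EuclideanSpace.inner_eq_star_dotProduct, dotProduct_comm, hPc]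
      have : WithLp.ofLp (G v) = R⁻¹ *ᵥ (F *ᵥ (R *ᵥ WithLp.ofLp v)) := rfl
      rw [this, hvw, Matrix.star_mulVec, Matrix.conjTranspose_conjTranspose,
        ← Matrix.dotProduct_mulVec, Matrix.mulVec_mulVec _ R R⁻¹,
        Matrix.mul_nonsing_inv _ hRdet, Matrix.one_mulVec]
      simp only [Matrix.mulVec_mulVec]
    have h2 : (star w ⬝ᵥ w).re = ‖(WithLp.toLp 2 w : EuclideanSpace ℂ (Fin n))‖ ^ 2 := by
      have := inner_self_eq_norm_sq (𝕜 := ℂ) (WithLp.toLp 2 w : EuclideanSpace ℂ (Fin n))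
      rw [← this, EuclideanSpace.inner_eq_star_dotProduct, dotProduct_comm]
      rfl
    have h3 := riccati_dissipation hP hRic hz w
    rw [← hF, ← h1, h2] at h3
    refine h3.trans ?_
    have h4 : ‖v‖ ^ 2 ≤
        (‖Θ‖ ^ 2 + 1) * ‖(WithLp.toLp 2 w : EuclideanSpace ℂ (Fin n))‖ ^ 2 := by
      have h5 : ‖v‖ ^ 2 ≤ (‖Θ‖ * ‖(WithLp.toLp 2 w : EuclideanSpace ℂ (Fin n))‖) ^ 2 := by
        rw [hvΘ]
        exact pow_le_pow_left₀ (norm_nonneg _) (Θ.le_opNorm _) 2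
      nlinarith [sq_nonneg ‖(WithLp.toLp 2 w : EuclideanSpace ℂ (Fin n))‖]
    have h6 : (1 / (2 * (‖Θ‖ ^ 2 + 1))) * ‖v‖ ^ 2 ≤ (1 / (2 * (‖Θ‖ ^ 2 + 1))) *
        ((‖Θ‖ ^ 2 + 1) * ‖(WithLp.toLp 2 w : EuclideanSpace ℂ (Fin n))‖ ^ 2) :=
      mul_le_mul_of_nonneg_left h4 hε.le
    have h7 : (1 / (2 * (‖Θ‖ ^ 2 + 1))) *
        ((‖Θ‖ ^ 2 + 1) * ‖(WithLp.toLp 2 w : EuclideanSpace ℂ (Fin n))‖ ^ 2) =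
        1 / 2 * ‖(WithLp.toLp 2 w : EuclideanSpace ℂ (Fin n))‖ ^ 2 := by field_simp
    linarith
  have hβ : ∀ t, 0 ≤ t →
      HasDerivWithinAt (fun t => Φ (ξ t)) (G (Φ (ξ t)) + Φ (g t)) (Ici 0) t := by
    intro t ht
    have := (Φ.restrictScalars ℝ).hasFDerivAt.comp_hasDerivWithinAt t (hξ t ht)
    simp only [G, hΨΦ, ← map_add]
    exact this
  obtain ⟨h1, h2⟩ := sqDissipated_and_tendsto_of_dissipative G hε hG (hg.clm Φ) hβ
  refine ⟨?_, ?_⟩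
  · simpa only [hΨΦ] using h1.clm Ψ
  · simpa only [hΨΦ, map_zero] using (Ψ.continuous.tendsto 0).comp h2 |>.congr
      fun t => by simp [hΨΦ]

/-- Modal decomposition: a network of identical linear systems coupled through `H` is stable
as soon as the modes attached to the spectrum of `H` are. -/
theorem network_stable_of_modes {ι : Type*} [Fintype ι] [DecidableEq ι] {n : ℕ}
    (A M : Matrix (Fin n) (Fin n) ℂ) (H : Matrix ι ι ℂ)
    (hmode : ∀ z ∈ spectrum ℂ H, ∀ ξ g : ℝ → Fin n → ℂ, SqDissipated g →
      (∀ t, 0 ≤ t → HasDerivWithinAt ξ ((A - z • M) *ᵥ ξ t + g t) (Ici 0) t) →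
      SqDissipated ξ ∧ Tendsto ξ atTop (nhds 0))
    {e g : ι → ℝ → Fin n → ℂ} (hg : ∀ p, SqDissipated (g p))
    (he : ∀ p t, 0 ≤ t → HasDerivWithinAt (e p)
      (A *ᵥ e p t - M *ᵥ (∑ q, H p q • e q t) + g p t) (Ici 0) t) (p : ι) :
    SqDissipated (e p) ∧ Tendsto (e p) atTop (nhds 0) := by
  set ξ : (ι → ℂ) → ℝ → Fin n → ℂ := fun v t => ∑ p, v p • e p t with hξ
  have hsmulD : ∀ (f : ℝ → Fin n → ℂ) (a : ℂ), SqDissipated f →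
      SqDissipated fun t => a • f t := fun f a hf =>
    hf.of_norm_le ‖a‖ fun t _ => (norm_smul a (f t)).le
  let S : Submodule ℂ (ι → ℂ) :=
    { carrier := {v | SqDissipated (ξ v) ∧ Tendsto (ξ v) atTop (nhds 0)}
      zero_mem' := by
        have : ξ 0 = fun _ => 0 := by ext t; simp [hξ]
        simp only [mem_ofPred_eq, this]
        exact ⟨SqDissipated.zero, tendsto_const_nhds⟩
      add_mem' := by
        intro v w hv hw
        have : ξ (v + w) = fun t => ξ v t + ξ w t := by
          funext t; simp [hξ, add_smul, Finset.sum_add_distrib]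
        simp only [mem_ofPred_eq, this]
        exact ⟨hv.1.add hw.1, by simpa using hv.2.add hw.2⟩
      smul_mem' := by
        intro a v hv
        have : ξ (a • v) = fun t => a • ξ v t := by
          funext t; simp [hξ, mul_smul, Finset.smul_sum]
        simp only [mem_ofPred_eq, this]
        exact ⟨hsmulD _ _ hv.1, by simpa using hv.2.const_smul a⟩ }
  let T : Module.End ℂ (ι → ℂ) := Matrix.toLin' Hᵀ
  have hdξ : ∀ v t, 0 ≤ t → HasDerivWithinAt (ξ v)
      (A *ᵥ ξ v t - M *ᵥ ξ (T v) t + ∑ p, v p • g p t) (Ici 0) t := by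
    intro v t ht
    have h1 : HasDerivWithinAt (ξ v) (∑ p, v p •
        (A *ᵥ e p t - M *ᵥ (∑ q, H p q • e q t) + g p t)) (Ici 0) t :=
      HasDerivWithinAt.fun_sum fun p _ => (he p t ht).const_smul (v p)
    convert h1 using 1
    have h2 : ξ (T v) t = ∑ p, v p • ∑ q, H p q • e q t := by
      simp only [hξ, T, Matrix.toLin'_apply, Matrix.mulVec, dotProduct, Matrix.transpose_apply,
        Finset.sum_smul, Finset.smul_sum, smul_smul]
      rw [Finset.sum_comm]
      exact Finset.sum_congr rfl fun _ _ => Finset.sum_congr rfl fun _ _ => by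
        rw [mul_comm]
    rw [h2]
    simp only [hξ, Matrix.mulVec_sum, Matrix.mulVec_smul, smul_add, smul_sub,
      Finset.sum_add_distrib, Finset.sum_sub_distrib]
  have hgen : ∀ z, z ∈ spectrum ℂ H → ∀ k : ℕ, ∀ v,
      ((T - z • (1 : Module.End ℂ (ι → ℂ))) ^ k) v = 0 → v ∈ S := by
    intro z hz k
    induction k with
    | zero =>
      intro v hv
      have : v = 0 := by simpa using hv
      rw [this]
      exact S.zero_mem
    | succ k ih =>
      intro v hv
      rw [pow_succ, Module.End.mul_apply] at hv
      have hw := ih _ hv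
      set w := (T - z • (1 : Module.End ℂ (ι → ℂ))) v with hwdef
      have hTv : T v = z • v + w := by simp [hwdef]
      have hMw : SqDissipated fun t => -(M *ᵥ ξ w t) :=
        (hw.1.clm (Matrix.mulVecLin M).toContinuousLinearMap).neg
      refine hmode z hz (ξ v) (fun t => -(M *ᵥ ξ w t) + ∑ p, v p • g p t)
        (hMw.add (SqDissipated.sum _ fun p _ => hsmulD _ _ (hg p))) fun t ht => ?_
      convert hdξ v t ht using 1
      have : ξ (T v) t = z • ξ v t + ξ w t := by
        simp [hTv, hξ, add_smul, mul_smul, Finset.sum_add_distrib, Finset.smul_sum]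
      rw [this, Matrix.sub_mulVec, Matrix.smul_mulVec, Matrix.mulVec_add, Matrix.mulVec_smul]
      abel
  have htop : S = ⊤ := by
    rw [eq_top_iff, ← Module.End.iSup_maxGenEigenspace_eq_top T]
    refine iSup_le fun z v hv => ?_
    obtain ⟨k, hk⟩ := (Module.End.mem_maxGenEigenspace _ _ _).1 hv
    by_cases hz : z ∈ spectrum ℂ H
    · exact hgen z hz k v hk
    · have hu : IsUnit (T - z • (1 : Module.End ℂ (ι → ℂ))) := by
        rw [← Matrix.spectrum_transpose_eq, ← Matrix.spectrum_toLin', spectrum.notMem_iff,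
          ← IsUnit.neg_iff] at hz
        simpa [Algebra.algebraMap_eq_smul_one] using hz
      have : v = 0 := by
        have hinj := (Module.End.isUnit_iff _).1 (hu.pow k)
        exact hinj.1 (by rw [hk, map_zero])
      rw [this]
      exact S.zero_mem
  have hp : (Pi.single p 1 : ι → ℂ) ∈ S := htop ▸ Submodule.mem_top
  have hsingle : ξ (Pi.single p 1) = e p := by
    funext t
    simp [hξ]
  have hp' : SqDissipated (ξ (Pi.single p 1)) ∧ Tendsto (ξ (Pi.single p 1)) atTop (nhds 0) := hp
  rwa [hsingle] at hp'

/-- A signal that is bounded on `[0, ∞)`. -/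
def BddSignal {E : Type*} [NormedAddCommGroup E] (f : ℝ → E) : Prop :=
  ∃ B, ∀ t, 0 ≤ t → ‖f t‖ ≤ B

namespace BddSignal

variable {E F : Type*} [NormedAddCommGroup E] [NormedAddCommGroup F]

theorem comp_continuous [ProperSpace E] {f : ℝ → E} (hf : BddSignal f) {G : E → F}
    (hG : Continuous G) : BddSignal fun t => G (f t) := by
  obtain ⟨B, hB⟩ := hf
  obtain ⟨B', hB'⟩ := (isCompact_closedBall (0 : E) B).exists_bound_of_continuousOn
    hG.continuousOn
  exact ⟨B', fun t ht => hB' _ (mem_closedBall_zero_iff.2 (hB t ht))⟩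

theorem prodMk {f : ℝ → E} {g : ℝ → F} (hf : BddSignal f) (hg : BddSignal g) :
    BddSignal fun t => (f t, g t) := by
  obtain ⟨B, hB⟩ := hf
  obtain ⟨B', hB'⟩ := hg
  exact ⟨max B B', fun t ht => max_le_max (hB t ht) (hB' t ht)⟩

theorem add {f g : ℝ → E} (hf : BddSignal f) (hg : BddSignal g) :
    BddSignal fun t => f t + g t := by
  obtain ⟨B, hB⟩ := hf
  obtain ⟨B', hB'⟩ := hg
  exact ⟨B + B', fun t ht => norm_add_le_of_le (hB t ht) (hB' t ht)⟩

theorem pi {ι : Type*} [Fintype ι] {f : ℝ → ι → E} (hf : ∀ i, BddSignal fun t => f t i) :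
    BddSignal f := by
  choose B hB using hf
  refine ⟨∑ i, |B i|, fun t ht => ?_⟩
  refine (pi_norm_le_iff_of_nonneg (Finset.sum_nonneg fun i _ => abs_nonneg _)).2 fun i => ?_
  exact (hB i t ht).trans ((le_abs_self _).trans
    (Finset.single_le_sum (f := fun i => |B i|) (fun j _ => abs_nonneg _) (Finset.mem_univ i)))

theorem apply {ι : Type*} [Fintype ι] {f : ℝ → ι → E} (hf : BddSignal f) (i : ι) :
    BddSignal fun t => f t i := by
  obtain ⟨B, hB⟩ := hf
  exact ⟨B, fun t ht => (norm_le_pi_norm (f t) i).trans (hB t ht)⟩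

theorem of_tendsto {f : ℝ → E} {L : E} (hc : ContinuousOn f (Ici 0))
    (hf : Tendsto f atTop (nhds L)) : BddSignal f := by
  obtain ⟨T, hT⟩ := eventually_atTop.1 (hf.norm.eventually (gt_mem_nhds (lt_add_one ‖L‖)))
  obtain ⟨B, hB⟩ := (isCompact_Icc (a := (0 : ℝ)) (b := T)).exists_bound_of_continuousOn
    (hc.mono Icc_subset_Ici_self)
  refine ⟨max B (‖L‖ + 1), fun t ht => ?_⟩
  rcases le_total t T with h | h
  · exact (hB t ⟨ht, h⟩).trans (le_max_left _ _)
  · exact (hT t h).le.trans (le_max_right _ _)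

end BddSignal

/-- Trajectories of a diagonalizable linear system with imaginary spectrum are bounded. -/
theorem bddSignal_of_neutrally_stable {n : ℕ} {A : Matrix (Fin n) (Fin n) ℝ}
    (hA : ∃ (S : Matrix (Fin n) (Fin n) ℂ) (D : Fin n → ℂ),
      IsUnit S ∧ A.map Complex.ofReal = S * Matrix.diagonal D * S⁻¹ ∧ ∀ k, (D k).re = 0)
    {x : ℝ → Fin n → ℝ}
    (hx : ∀ t, 0 ≤ t → HasDerivWithinAt x (A *ᵥ x t) (Ici 0) t) : BddSignal x := by
  obtain ⟨S, D, hS, hSD, hD⟩ := hA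
  have hdet : IsUnit S.det := (Matrix.isUnit_iff_isUnit_det S).1 hS
  set z : ℝ → Fin n → ℂ := fun t k => (x t k : ℂ) with hz
  set w : ℝ → Fin n → ℂ := fun t => S⁻¹ *ᵥ z t with hw
  have hzw : ∀ t, z t = S *ᵥ w t := fun t => by
    simp [hw, Matrix.mulVec_mulVec, Matrix.mul_nonsing_inv _ hdet]
  have dz : ∀ t, 0 ≤ t → HasDerivWithinAt z (A.map Complex.ofReal *ᵥ z t) (Ici 0) t := by
    intro t ht
    rw [hasDerivWithinAt_pi]
    intro k
    refine ((hasDerivWithinAt_pi.1 (hx t ht)) k).ofReal_comp.congr_deriv ?_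
    simp [Matrix.mulVec, dotProduct, hz]
  have dw : ∀ t, 0 ≤ t → ∀ k, HasDerivWithinAt (fun t => w t k) (D k * w t k) (Ici 0) t := by
    intro t ht
    have h1 := ((Matrix.mulVecLin S⁻¹).toContinuousLinearMap.restrictScalars
      ℝ).hasFDerivAt.comp_hasDerivWithinAt t (dz t ht)
    have h2 : HasDerivWithinAt w (S⁻¹ *ᵥ (A.map Complex.ofReal *ᵥ z t)) (Ici 0) t := h1
    have h3 : S⁻¹ *ᵥ (A.map Complex.ofReal *ᵥ z t) = fun k => D k * w t k := by
      rw [hSD, hzw, Matrix.mulVec_mulVec, Matrix.mulVec_mulVec, ← Matrix.mul_assoc,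
        ← Matrix.mul_assoc, Matrix.nonsing_inv_mul _ hdet, Matrix.one_mul, Matrix.mul_assoc,
        Matrix.nonsing_inv_mul _ hdet, Matrix.mul_one]
      ext k
      simp [Matrix.mulVec_diagonal]
    rw [h3] at h2
    exact hasDerivWithinAt_pi.1 h2
  have hwb : BddSignal w := BddSignal.pi fun k => by
    refine ⟨‖w 0 k‖, fun t ht => ?_⟩
    have hanti := antitoneOn_Ici_of_hasDerivWithinAt_nonpos le_rfl
      (fun t ht => (dw t ht k).norm_sq) (fun t ht => by
        have : inner ℝ (w t k) (D k * w t k) = 0 := by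
          rw [Complex.inner]
          simp [Complex.mul_re, Complex.mul_im, hD]
          ring
        rw [this, mul_zero])
    exact le_of_sq_le_sq (hanti (mem_Ici.2 le_rfl) (mem_Ici.2 ht) ht) (norm_nonneg _)
  have hzb : BddSignal z := by
    have := hwb.comp_continuous (Matrix.mulVecLin S).toContinuousLinearMap.continuous
    have h : z = fun t => (Matrix.mulVecLin S).toContinuousLinearMap (w t) := funext hzw
    rwa [h]
  obtain ⟨B, hB⟩ := hzb
  refine BddSignal.pi fun k => ⟨B, fun t ht => ?_⟩
  have := (norm_le_pi_norm (z t) k).trans (hB t ht)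
  simpa [hz] using this

/-- A weakly diagonally dominant matrix with nonpositive off-diagonal entries, such that no
nonempty set of zero-sum rows is closed under its digraph, has spectrum in the open right
half-plane. -/
theorem re_pos_of_mem_spectrum_of_dominant {ι : Type*} [Fintype ι] [DecidableEq ι]
    {H : Matrix ι ι ℝ} (hoff : ∀ p q, p ≠ q → H p q ≤ 0) (hrow : ∀ p, 0 ≤ ∑ q, H p q)
    (hclosed : ∀ s : Set ι, s.Nonempty →
      ¬ ∀ p ∈ s, ∑ q, H p q = 0 ∧ ∀ q, H p q ≠ 0 → q ∈ s)
    {z : ℂ} (hz : z ∈ spectrum ℂ (H.map Complex.ofReal)) : 0 < z.re := by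
  by_contra! hre
  rw [← Matrix.spectrum_toLin', ← Module.End.hasEigenvalue_iff_mem_spectrum] at hz
  obtain ⟨v, hv⟩ := hz.exists_hasEigenvector
  have hHv : ∀ p, ∑ q, (H p q : ℂ) * v q = z * v p := fun p => by
    have := congrFun hv.apply_eq_smul p
    simpa [Matrix.toLin'_apply, Matrix.mulVec, dotProduct] using this
  have hne : Nonempty ι := by
    by_contra h
    rw [not_nonempty_iff] at h
    exact hv.2 (Subsingleton.elim _ _)
  obtain ⟨p₀, -, hp₀⟩ := Finset.exists_max_image Finset.univ (fun p => ‖v p‖)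
    Finset.univ_nonempty
  set m := ‖v p₀‖ with hm
  have hmax : ∀ q, ‖v q‖ ≤ m := fun q => hp₀ q (Finset.mem_univ q)
  have hmpos : 0 < m := by
    rcases (norm_nonneg (v p₀)).eq_or_lt with h | h
    · refine absurd (funext fun q => ?_) hv.2
      have := hmax q
      rw [hm, ← h] at this
      exact norm_le_zero_iff.1 this
    · exact h
  refine hclosed {p | ‖v p‖ = m} ⟨p₀, rfl⟩ fun p hp => ?_
  have hp' : ‖v p‖ = m := hp
  have h1 : ((H p p : ℂ) - z) * v p = ∑ q ∈ Finset.univ.erase p, (-(H p q : ℂ)) * v q := by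
    have := hHv p
    rw [← Finset.add_sum_erase _ _ (Finset.mem_univ p)] at this
    simp only [neg_mul, Finset.sum_neg_distrib]
    linear_combination this
  have h2 : H p p * m ≤ ∑ q ∈ Finset.univ.erase p, (-H p q) * ‖v q‖ := by
    calc H p p * m ≤ ‖(H p p : ℂ) - z‖ * m := by
          refine mul_le_mul_of_nonneg_right ?_ hmpos.le
          have := Complex.re_le_norm ((H p p : ℂ) - z)
          simp only [Complex.sub_re, Complex.ofReal_re] at this
          linarith
      _ = ‖∑ q ∈ Finset.univ.erase p, (-(H p q : ℂ)) * v q‖ := by rw [← h1, norm_mul, hp']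
      _ ≤ ∑ q ∈ Finset.univ.erase p, ‖(-(H p q : ℂ)) * v q‖ := norm_sum_le _ _
      _ = _ := by
          refine Finset.sum_congr rfl fun q hq => ?_
          rw [norm_mul, norm_neg, Complex.norm_real, Real.norm_eq_abs,
            abs_of_nonpos (hoff p q (Finset.ne_of_mem_erase hq).symm)]
  have h3 : ∑ q ∈ Finset.univ.erase p, (-H p q) * (m - ‖v q‖) + (∑ q, H p q) * m ≤ 0 := by
    rw [← Finset.add_sum_erase _ _ (Finset.mem_univ p), add_mul, Finset.sum_mul]
    simp only [mul_sub, Finset.sum_sub_distrib, neg_mul, Finset.sum_neg_distrib] at h2 ⊢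
    linarith
  have hterm : ∀ q ∈ Finset.univ.erase p, 0 ≤ (-H p q) * (m - ‖v q‖) := fun q hq =>
    mul_nonneg (neg_nonneg.2 (hoff p q (Finset.ne_of_mem_erase hq).symm))
      (sub_nonneg.2 (hmax q))
  have h4 := Finset.sum_nonneg hterm
  have h5 : 0 ≤ (∑ q, H p q) * m := mul_nonneg (hrow p) hmpos.le
  refine ⟨?_, fun q hq => ?_⟩
  · have : (∑ q, H p q) * m = 0 := by linarith
    exact (mul_eq_zero.1 this).resolve_right hmpos.ne'
  · by_cases hqp : q = p
    · rw [hqp]; exact hp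
    have hmem : q ∈ Finset.univ.erase p := Finset.mem_erase.2 ⟨hqp, Finset.mem_univ q⟩
    have h6 := (Finset.sum_eq_zero_iff_of_nonneg hterm).1 (by linarith) q hmem
    rcases mul_eq_zero.1 h6 with h | h
    · exact absurd (neg_eq_zero.1 h) hq
    · exact (sub_eq_zero.1 h).symm

section ExpandedGraph

variable {N : ℕ} {r : Fin N → ℕ} {a : Fin (N + 1) → Fin (N + 1) → ℝ}
  {H : Matrix ((i : Fin N) × Fin (r i + 1)) ((i : Fin N) × Fin (r i + 1)) ℝ}

/-- The entries of the expanded graph matrix. -/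
def IsExpandedGraphMatrix (r : Fin N → ℕ) (a : Fin (N + 1) → Fin (N + 1) → ℝ)
    (H : Matrix ((i : Fin N) × Fin (r i + 1)) ((i : Fin N) × Fin (r i + 1)) ℝ) : Prop :=
  ∀ p q, H p q =
    (if p.1 = q.1 then
      (if (p.2 : ℕ) = (q.2 : ℕ) then
        (if (p.2 : ℕ) = r p.1 then ∑ k : Fin N, a p.1.succ k.succ else 1)
       else if (q.2 : ℕ) = (p.2 : ℕ) + 1 then -1 else 0)
     else if (p.2 : ℕ) = r p.1 ∧ (q.2 : ℕ) = 0 then -(a p.1.succ q.1.succ) else 0)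
    + (if p = q ∧ (p.2 : ℕ) = r p.1 then a p.1.succ 0 else 0)

namespace IsExpandedGraphMatrix

variable {𝕜 : Type*} [AddCommGroup 𝕜] [Module ℝ 𝕜]

theorem sum_smul_of_lt (hH : IsExpandedGraphMatrix r a H) (i : Fin N) (l : Fin (r i + 1))
    (hl : (l : ℕ) < r i) (f : ((i : Fin N) × Fin (r i + 1)) → 𝕜) :
    ∑ q, H ⟨i, l⟩ q • f q = f ⟨i, l⟩ - f ⟨i, ⟨(l : ℕ) + 1, Nat.succ_lt_succ hl⟩⟩ := by
  have hentry : ∀ q, H ⟨i, l⟩ q = (if q = ⟨i, l⟩ then 1 else 0) -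
      (if q = ⟨i, ⟨(l : ℕ) + 1, Nat.succ_lt_succ hl⟩⟩ then 1 else 0) := by
    rintro ⟨j, k⟩
    rw [hH]
    by_cases hij : i = j
    · subst hij
      simp only [Sigma.mk.injEq, heq_eq_eq, true_and, Fin.ext_iff, if_true]
      split_ifs <;> first | omega | simp
    · have hji : ¬ j = i := fun h => hij h.symm
      simp [hij, hji, hl.ne]
  simp [hentry, sub_smul, Finset.sum_sub_distrib, ite_smul]

theorem sum_smul_last (hH : IsExpandedGraphMatrix r a H) (hr : ∀ i, 1 ≤ r i)
    (ha : ∀ i : Fin (N + 1), i ≠ 0 → a i i = 0) (i : Fin N)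
    (f : ((i : Fin N) × Fin (r i + 1)) → 𝕜) :
    ∑ q, H ⟨i, Fin.last (r i)⟩ q • f q =
      (∑ j, a i.succ j) • f ⟨i, Fin.last (r i)⟩ - ∑ j : Fin N, a i.succ j.succ • f ⟨j, 0⟩ := by
  have hentry : ∀ q : ((i : Fin N) × Fin (r i + 1)), H ⟨i, Fin.last (r i)⟩ q =
      (if q = ⟨i, Fin.last (r i)⟩ then ∑ j, a i.succ j else 0) -
      (if q.2 = 0 then a i.succ q.1.succ else 0) := by
    rintro ⟨j, k⟩
    have hri := hr i
    rw [hH]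
    by_cases hij : i = j
    · subst hij
      simp only [Sigma.mk.injEq, heq_eq_eq, true_and, Fin.ext_iff, if_true, Fin.val_last,
        Fin.sum_univ_succ, ha _ (Fin.succ_ne_zero i), Fin.val_zero, and_true]
      split_ifs <;> first | omega | simp [add_comm]
    · have hji : ¬ j = i := fun h => hij h.symm
      simp only [hij, hji, Sigma.mk.injEq, false_and, if_false, Fin.val_last, true_and,
        Fin.ext_iff, Fin.val_zero]
      split_ifs <;> simp
  simp only [hentry, sub_smul, Finset.sum_sub_distrib, ite_smul, zero_smul, Finset.sum_ite_eq',
    Finset.mem_univ, if_true, Fintype.sum_sigma]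
  congr 1
  refine Finset.sum_congr rfl fun j _ => ?_
  rw [Fintype.sum_eq_single 0 fun k hk => if_neg hk, if_pos rfl]

theorem re_pos_of_mem_spectrum (hH : IsExpandedGraphMatrix r a H) (hr : ∀ i, 1 ≤ r i)
    (ha : ∀ i : Fin (N + 1), i ≠ 0 → a i i = 0)
    (ha_nonneg : ∀ i j : Fin (N + 1), i ≠ 0 → 0 ≤ a i j)
    (htree : ∀ i : Fin (N + 1),
      Relation.ReflTransGen (fun p q : Fin (N + 1) => q ≠ 0 ∧ 0 < a q p) 0 i)
    {z : ℂ} (hz : z ∈ spectrum ℂ (H.map Complex.ofReal)) : 0 < z.re := by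
  have hrow_lt : ∀ (i : Fin N) (l : Fin (r i + 1)), (l : ℕ) < r i →
      ∑ q, H ⟨i, l⟩ q = 0 := fun i l hl => by
    simpa using hH.sum_smul_of_lt i l hl (fun _ => (1 : ℝ))
  have hrow_last : ∀ i : Fin N, ∑ q, H ⟨i, Fin.last (r i)⟩ q = a i.succ 0 := fun i => by
    have := hH.sum_smul_last hr ha i (fun _ => (1 : ℝ))
    simpa [Fin.sum_univ_succ] using this
  refine re_pos_of_mem_spectrum_of_dominant ?_ ?_ ?_ hz
  · rintro ⟨i, l⟩ ⟨j, k⟩ hpq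
    rw [hH, if_neg fun h : _ ∧ _ => hpq h.1, add_zero]
    by_cases hij : i = j
    · subst hij
      have : (l : ℕ) ≠ k := fun h => hpq (by rw [Fin.ext h])
      simp only [if_true, this, if_false]
      split_ifs <;> norm_num
    · simp only [hij, if_false]
      split_ifs
      · exact neg_nonpos.2 (ha_nonneg _ _ (Fin.succ_ne_zero i))
      · exact le_rfl
  · rintro ⟨i, l⟩
    rcases (Nat.lt_succ_iff.1 l.2).lt_or_eq with hl | hl
    · exact (hrow_lt i l hl).ge
    · obtain rfl : l = Fin.last (r i) := Fin.ext hl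
      rw [hrow_last]
      exact ha_nonneg _ _ (Fin.succ_ne_zero i)
  · rintro s ⟨⟨i₀, l₀⟩, hs₀⟩ hs
    have hup : ∀ (i : Fin N) (n : ℕ) (l : Fin (r i + 1)), (l : ℕ) + n = r i → ⟨i, l⟩ ∈ s →
        (⟨i, Fin.last (r i)⟩ : (i : Fin N) × Fin (r i + 1)) ∈ s := by
      intro i n
      induction n with
      | zero =>
        intro l hl h
        obtain rfl : l = Fin.last (r i) := Fin.ext hl
        exact h
      | succ n ih =>
        intro l hl h
        refine ih ⟨l + 1, by omega⟩ (by simp; omega) ((hs _ h).2 _ ?_)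
        have hlr : (l : ℕ) ≠ r i := by omega
        rw [hH]
        simp [hlr]
    have hlast : ∀ (i : Fin N) (l : Fin (r i + 1)), ⟨i, l⟩ ∈ s →
        (⟨i, Fin.last (r i)⟩ : (i : Fin N) × Fin (r i + 1)) ∈ s := fun i l h =>
      hup i (r i - l) l (by omega) h
    have hnot : ∀ q, Relation.ReflTransGen
        (fun p q : Fin (N + 1) => q ≠ 0 ∧ 0 < a q p) 0 q → ∀ i : Fin N, q = i.succ →
        (⟨i, Fin.last (r i)⟩ : (i : Fin N) × Fin (r i + 1)) ∉ s := by
      intro q hq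
      induction hq with
      | refl => exact fun i hi => absurd hi (Fin.succ_ne_zero i).symm
      | @tail p q _ hpq ih =>
        rintro i rfl hmem
        rcases Fin.eq_zero_or_eq_succ p with rfl | ⟨j, rfl⟩
        · have := (hs _ hmem).1
          rw [hrow_last] at this
          exact hpq.2.ne' this
        · refine ih j rfl (hlast j 0 ((hs _ hmem).2 _ ?_))
          have hij : i ≠ j := fun h => by
            subst h
            exact hpq.2.ne' (ha _ (Fin.succ_ne_zero i))
          rw [hH]
          simp [hij, hpq.2.ne']
    exact hnot _ (htree i₀.succ) i₀ rfl (hlast _ _ hs₀)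

end IsExpandedGraphMatrix

end ExpandedGraph

/-- Cancellation of the tuning-function cross terms in adaptive backstepping. -/
theorem tuning_cross_terms_cancel {V : Type*} [AddCommGroup V] [Module ℝ V] (E : ℕ → ℝ)
    (w : ℕ → V) (G : ℕ → V →ₗ[ℝ] ℝ) (hG : G 1 = 0) (n : ℕ) :
    ∑ j ∈ Finset.range n, E (j + 1) *
      (G (j + 1) (∑ i ∈ Finset.range (j + 1), E (i + 1) • w i -
          ∑ i ∈ Finset.range n, E (i + 1) • w i) +
        ∑ l ∈ Finset.Icc 2 j, E l * G l (w j)) = 0 := by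
  induction n with
  | zero => simp
  | succ n ih =>
    have hreindex : ∑ l ∈ Finset.Icc 2 n, E l * G l (w n) =
        ∑ j ∈ Finset.range n, E (j + 1) * G (j + 1) (w n) := by
      rw [Finset.range_eq_Ico, Finset.sum_Ico_add' (fun l => E l * G l (w n)) 0 n 1]
      refine Finset.sum_subset (fun l hl => ?_) fun l hl hl' => ?_
      · simp only [Finset.mem_Icc, Finset.mem_Ico] at hl ⊢
        omega
      · simp only [Finset.mem_Icc, Finset.mem_Ico] at hl hl'
        obtain rfl : l = 1 := by omega
        simp [hG]
    rw [Finset.sum_range_succ, sub_self, map_zero, zero_add, hreindex]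
    have hstep : ∀ j ∈ Finset.range n, E (j + 1) *
        (G (j + 1) (∑ i ∈ Finset.range (j + 1), E (i + 1) • w i -
            ∑ i ∈ Finset.range (n + 1), E (i + 1) • w i) +
          ∑ l ∈ Finset.Icc 2 j, E l * G l (w j)) =
        E (j + 1) *
        (G (j + 1) (∑ i ∈ Finset.range (j + 1), E (i + 1) • w i -
            ∑ i ∈ Finset.range n, E (i + 1) • w i) +
          ∑ l ∈ Finset.Icc 2 j, E l * G l (w j)) -
        E (n + 1) * (E (j + 1) * G (j + 1) (w n)) := by
      intro j _
      rw [Finset.sum_range_succ _ n, ← sub_sub, map_sub (G (j + 1)), map_smul, smul_eq_mul]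
      ring
    rw [Finset.sum_congr rfl hstep, Finset.sum_sub_distrib, ih, Finset.mul_sum]
    ring

theorem sum_backstepping_telescope (E : ℕ → ℝ) (n : ℕ) :
    ∑ j ∈ Finset.range n, E (j + 1) * (E (j + 2) - E j) = E n * E (n + 1) - E 0 * E 1 := by
  rw [← Finset.sum_range_sub (fun j => E j * E (j + 1))]
  exact Finset.sum_congr rfl fun j _ => by ring

/-- The space of plant states, compensator states and parameter estimates of one agent. -/
abbrev AgentSpace (r m ν : ℕ) : Type :=
  (Fin r → ℝ) × (Fin (r + 1) → Fin ν → ℝ) × (Fin m → ℝ)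

/-- The recursive adaptive backstepping design of one agent. -/
structure IsBacksteppingDesign {r m ν : ℕ} (hr : 1 ≤ r) (ψ : Fin r → (Fin r → ℝ) → Fin m → ℝ)
    (A M : Matrix (Fin ν) (Fin ν) ℝ) (C : Matrix (Fin 1) (Fin ν) ℝ) (c : Fin r → ℝ)
    (α : ℕ → (Fin r → ℝ) → (Fin (r + 1) → Fin ν → ℝ) → (Fin m → ℝ) → ℝ)
    (τ : ℕ → (Fin r → ℝ) → (Fin (r + 1) → Fin ν → ℝ) → (Fin m → ℝ) → Fin m → ℝ)
    (ehat : ℕ → (Fin r → ℝ) → (Fin (r + 1) → Fin ν → ℝ) → (Fin m → ℝ) → ℝ) : Prop where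
  ehat_one : ∀ xv ηv th, ehat 1 xv ηv th = xv ⟨0, hr⟩ - C.mulVec (ηv 0) 0
  ehat_step : ∀ (k : ℕ) (_ : 2 ≤ k) (_ : k ≤ r) xv ηv th,
      ehat k xv ηv th = xv ⟨k - 1, by omega⟩ - α (k - 1) xv ηv th
  tau_one : ∀ xv ηv th, τ 1 xv ηv th = ehat 1 xv ηv th • ψ ⟨0, hr⟩ xv
  alpha_one : ∀ xv ηv th, α 1 xv ηv th =
      -(c ⟨0, hr⟩) * ehat 1 xv ηv th - (∑ j, ψ ⟨0, hr⟩ xv j * th j)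
        + C.mulVec (A.mulVec (ηv 0)) 0
        - C.mulVec (M.mulVec (ηv 0 - ηv ⟨1, Nat.succ_lt_succ hr⟩)) 0
  tau_step : ∀ (k : ℕ) (_ : 2 ≤ k) (_ : k ≤ r) xv ηv th,
      τ k xv ηv th = τ (k - 1) xv ηv th
        + ehat k xv ηv th •
            (ψ ⟨k - 1, by omega⟩ xv
              - ∑ l : Fin r, if (l : ℕ) < k - 1 then
                  fderiv ℝ (fun x' => α (k - 1) x' ηv th) xv (Pi.single l 1) • ψ l xv
                else 0)
  alpha_step : ∀ (k : ℕ) (_ : 2 ≤ k) (_ : k ≤ r) xv ηv th,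
      α k xv ηv th =
        -(c ⟨k - 1, by omega⟩) * ehat k xv ηv th - ehat (k - 1) xv ηv th
        - (∑ j, ψ ⟨k - 1, by omega⟩ xv j * th j)
        + (∑ l : Fin r, if hl : (l : ℕ) < k - 1 then
            fderiv ℝ (fun x' => α (k - 1) x' ηv th) xv (Pi.single l 1)
              * (xv ⟨(l : ℕ) + 1, by omega⟩ + ∑ j, ψ l xv j * th j)
          else 0)
        + (∑ l : Fin (r + 1), if hl : (l : ℕ) < k then
            fderiv ℝ (fun η' => α (k - 1) xv η' th) ηv
              (Pi.single l (A.mulVec (ηv l)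
                - M.mulVec (ηv l - ηv ⟨(l : ℕ) + 1, by omega⟩)))
          else 0)
        + fderiv ℝ (fun th' => α (k - 1) xv ηv th') th (τ k xv ηv th)
        + ∑ l ∈ Finset.Icc 2 (k - 1), ehat l xv ηv th *
            fderiv ℝ (fun th' => α (l - 1) xv ηv th') th
              (ψ ⟨k - 1, by omega⟩ xv
                - ∑ l' : Fin r, if (l' : ℕ) < k - 1 then
                    fderiv ℝ (fun x' => α (k - 1) x' ηv th) xv (Pi.single l' 1) • ψ l' xv
                  else 0)

namespace AgentSpace

variable {r m ν : ℕ} {β : Type*}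

/-- The uncurried form of a function of the agent variables. -/
def unc (F : (Fin r → ℝ) → (Fin (r + 1) → Fin ν → ℝ) → (Fin m → ℝ) → β) :
    AgentSpace r m ν → β := fun p => F p.1 p.2.1 p.2.2

variable {F : (Fin r → ℝ) → (Fin (r + 1) → Fin ν → ℝ) → (Fin m → ℝ) → ℝ}

theorem fderiv_fst (p : AgentSpace r m ν) (hF : DifferentiableAt ℝ (unc F) p) (v : Fin r → ℝ) :
    fderiv ℝ (fun x' => F x' p.2.1 p.2.2) p.1 v = fderiv ℝ (unc F) p (v, 0, 0) := by
  have h : HasFDerivAt (fun x' => F x' p.2.1 p.2.2) _ p.1 :=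
    HasFDerivAt.comp (g := unc F) (f := fun x' => (x', p.2)) p.1 hF.hasFDerivAt
      (hasFDerivAt_prodMk_left p.1 p.2)
  rw [h.fderiv]
  rfl

theorem fderiv_snd (p : AgentSpace r m ν) (hF : DifferentiableAt ℝ (unc F) p)
    (v : Fin (r + 1) → Fin ν → ℝ) :
    fderiv ℝ (fun η' => F p.1 η' p.2.2) p.2.1 v = fderiv ℝ (unc F) p (0, v, 0) := by
  have h : HasFDerivAt (fun η' => F p.1 η' p.2.2) _ p.2.1 :=
    HasFDerivAt.comp (g := unc F) (f := fun η' => (p.1, η', p.2.2)) p.2.1 hF.hasFDerivAt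
      (HasFDerivAt.comp (g := fun q => (p.1, q)) (f := fun η' => (η', p.2.2)) p.2.1
        (hasFDerivAt_prodMk_right p.1 p.2) (hasFDerivAt_prodMk_left p.2.1 p.2.2))
  rw [h.fderiv]
  rfl

theorem fderiv_trd (p : AgentSpace r m ν) (hF : DifferentiableAt ℝ (unc F) p) (v : Fin m → ℝ) :
    fderiv ℝ (fun θ' => F p.1 p.2.1 θ') p.2.2 v = fderiv ℝ (unc F) p (0, 0, v) := by
  have h : HasFDerivAt (fun θ' => F p.1 p.2.1 θ') _ p.2.2 :=
    HasFDerivAt.comp (g := unc F) (f := fun θ' => (p.1, p.2.1, θ')) p.2.2 hF.hasFDerivAt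
      (HasFDerivAt.comp (g := fun q => (p.1, q)) (f := fun θ' => (p.2.1, θ')) p.2.2
        (hasFDerivAt_prodMk_right p.1 p.2) (hasFDerivAt_prodMk_right p.2.1 p.2.2))
  rw [h.fderiv]
  rfl

/-- Two points agree in the first `k` plant states, the first `k + 1` compensator states and
the parameter estimate. -/
def Agree (k : ℕ) (p q : AgentSpace r m ν) : Prop :=
  (∀ l : Fin r, (l : ℕ) < k → p.1 l = q.1 l) ∧
    (∀ l : Fin (r + 1), (l : ℕ) < k + 1 → p.2.1 l = q.2.1 l) ∧ p.2.2 = q.2.2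

theorem Agree.mono {k n : ℕ} {p q : AgentSpace r m ν} (h : Agree n p q) (hk : k ≤ n) :
    Agree k p q :=
  ⟨fun l hl => h.1 l (hl.trans_le hk), fun l hl => h.2.1 l (hl.trans_le (by omega)), h.2.2⟩

theorem Agree.add {k : ℕ} {p v : AgentSpace r m ν} (h : Agree k v 0) : Agree k (p + v) p :=
  ⟨fun l hl => by simp [h.1 l hl], fun l hl => by simp [h.2.1 l hl], by simp [h.2.2]⟩

/-- Dependence on the variables of level at most `k` only. -/
def DependsOnLevel (k : ℕ) (f : AgentSpace r m ν → β) : Prop :=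
  ∀ p q, Agree k p q → f p = f q

theorem DependsOnLevel.fderiv_eq {k : ℕ} {f : AgentSpace r m ν → ℝ} (hf : DependsOnLevel k f) :
    DependsOnLevel k (fderiv ℝ f) := by
  intro p q hpq
  have hv : Agree k (q - p) 0 :=
    ⟨fun l hl => by simp [hpq.1 l hl], fun l hl => by simp [hpq.2.1 l hl], by simp [hpq.2.2]⟩
  have h : (fun x => f (x + (q - p))) = f := funext fun x => hf _ _ hv.add
  have h2 := fderiv_comp_add_right (𝕜 := ℝ) (f := f) (x := p) (q - p)
  rw [h, add_sub_cancel] at h2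
  exact h2

theorem DependsOnLevel.fderiv_apply_eq_zero {k : ℕ} {f : AgentSpace r m ν → ℝ}
    (hf : DependsOnLevel k f) (p : AgentSpace r m ν) {v : AgentSpace r m ν}
    (hv : Agree k v 0) : fderiv ℝ f p v = 0 := by
  by_cases hd : DifferentiableAt ℝ f p
  · rw [← hd.lineDeriv_eq_fderiv, lineDeriv]
    have : (fun t : ℝ => f (p + t • v)) = fun _ => f p := funext fun t =>
      hf _ _ (Agree.add ⟨fun l hl => by simp [hv.1 l hl], fun l hl => by simp [hv.2.1 l hl],
        by simp [hv.2.2]⟩)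
    rw [this]
    simp
  · rw [fderiv_zero_of_not_differentiableAt hd]
    rfl

theorem clm_apply_eq_sum (L : AgentSpace r m ν →L[ℝ] ℝ) (v : AgentSpace r m ν) :
    L v = ∑ l, L (Pi.single l 1, 0, 0) * v.1 l + ∑ l, L (0, Pi.single l (v.2.1 l), 0) +
      L (0, 0, v.2.2) := by
  have h1 : (v.1, (0 : (Fin (r + 1) → Fin ν → ℝ) × (Fin m → ℝ))) =
      ∑ l, v.1 l • ((Pi.single l 1, 0, 0) : AgentSpace r m ν) := by
    ext1
    · rw [Prod.fst_sum]
      ext i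
      simp [Finset.sum_apply, Pi.single_apply]
    · rw [Prod.snd_sum]
      simp
      rfl
  have h2 : ((0, v.2.1, 0) : AgentSpace r m ν) =
      ∑ l, ((0, Pi.single l (v.2.1 l), 0) : AgentSpace r m ν) := by
    ext1
    · rw [Prod.fst_sum]
      simp
    · rw [Prod.snd_sum]
      ext1
      · rw [Prod.fst_sum]
        exact (Finset.univ_sum_single v.2.1).symm
      · rw [Prod.snd_sum]
        simp
  have h3 : v = (v.1, 0) + (0, v.2.1, 0) + (0, 0, v.2.2) := by
    ext1
    · simp
    · ext1 <;> simp
  conv_lhs => rw [h3]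
  rw [map_add, map_add, h1, h2, map_sum, map_sum]
  simp only [map_smul, smul_eq_mul, mul_comm]

theorem DependsOnLevel.mono {r m ν k n : ℕ} {β : Type*} {f : AgentSpace r m ν → β}
    (hf : DependsOnLevel k f) (hk : k ≤ n) : DependsOnLevel n f :=
  fun p q h => hf p q (h.mono hk)

/-- The regressor `ψ_{j+1} - ∑_{l ≤ j} (∂α_j/∂x_l) ψ_l` of the `(j+1)`-st backstepping error. -/
noncomputable def regressor {r m ν : ℕ} (ψ : Fin r → (Fin r → ℝ) → Fin m → ℝ)
    (α : ℕ → (Fin r → ℝ) → (Fin (r + 1) → Fin ν → ℝ) → (Fin m → ℝ) → ℝ)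
    (j : ℕ) (p : AgentSpace r m ν) : Fin m → ℝ :=
  (if h : j < r then ψ ⟨j, h⟩ p.1 else 0) -
    ∑ l : Fin r, if (l : ℕ) < j then
      fderiv ℝ (unc (α j)) p (Pi.single l 1, 0, 0) • ψ l p.1 else 0

end AgentSpace

theorem IsLinearMap.hasFDerivAt {E : Type*} [NormedAddCommGroup E] [NormedSpace ℝ E]
    [FiniteDimensional ℝ E] {f : E → ℝ} (hf : IsLinearMap ℝ f) (p : E) :
    HasFDerivAt f (LinearMap.toContinuousLinearMap (hf.mk' f)) p :=
  (LinearMap.toContinuousLinearMap (hf.mk' f)).hasFDerivAt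

theorem IsLinearMap.differentiableAt {E : Type*} [NormedAddCommGroup E] [NormedSpace ℝ E]
    [FiniteDimensional ℝ E] {f : E → ℝ} (hf : IsLinearMap ℝ f) {p : E} :
    DifferentiableAt ℝ f p := (hf.hasFDerivAt p).differentiableAt

theorem IsLinearMap.fderiv_apply {E : Type*} [NormedAddCommGroup E] [NormedSpace ℝ E]
    [FiniteDimensional ℝ E] {f : E → ℝ} (hf : IsLinearMap ℝ f) (p v : E) :
    fderiv ℝ f p v = f v := by
  rw [(hf.hasFDerivAt p).fderiv]
  rfl

namespace IsBacksteppingDesign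

open AgentSpace

variable {r m ν : ℕ} {hr : 1 ≤ r} {ψ : Fin r → (Fin r → ℝ) → Fin m → ℝ}
  {A M : Matrix (Fin ν) (Fin ν) ℝ} {C : Matrix (Fin 1) (Fin ν) ℝ} {c : Fin r → ℝ}
  {α : ℕ → (Fin r → ℝ) → (Fin (r + 1) → Fin ν → ℝ) → (Fin m → ℝ) → ℝ}
  {τ : ℕ → (Fin r → ℝ) → (Fin (r + 1) → Fin ν → ℝ) → (Fin m → ℝ) → Fin m → ℝ}
  {ehat : ℕ → (Fin r → ℝ) → (Fin (r + 1) → Fin ν → ℝ) → (Fin m → ℝ) → ℝ}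

theorem ehat_succ (h : IsBacksteppingDesign hr ψ A M C c α τ ehat) {k : ℕ} (hk : 1 ≤ k)
    (hkr : k < r) (p : AgentSpace r m ν) :
    unc (ehat (k + 1)) p = p.1 ⟨k, hkr⟩ - unc (α k) p :=
  h.ehat_step (k + 1) (by omega) hkr p.1 p.2.1 p.2.2

theorem regressor_eq {k : ℕ} (hkr : k < r) (p : AgentSpace r m ν)
    (hd : DifferentiableAt ℝ (unc (α k)) p) :
    ψ ⟨k, hkr⟩ p.1 - (∑ l : Fin r, if (l : ℕ) < k then
      fderiv ℝ (fun x' => α k x' p.2.1 p.2.2) p.1 (Pi.single l 1) • ψ l p.1 else 0) =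
    regressor ψ α k p := by
  simp only [regressor, dif_pos hkr, fderiv_fst p hd]

theorem tau_succ (h : IsBacksteppingDesign hr ψ A M C c α τ ehat) {k : ℕ} (hk : 1 ≤ k)
    (hkr : k < r) (p : AgentSpace r m ν) (hd : DifferentiableAt ℝ (unc (α k)) p) :
    unc (τ (k + 1)) p = unc (τ k) p + unc (ehat (k + 1)) p • regressor ψ α k p := by
  rw [← regressor_eq hkr p hd]
  exact h.tau_step (k + 1) (by omega) hkr p.1 p.2.1 p.2.2

theorem alpha_succ (h : IsBacksteppingDesign hr ψ A M C c α τ ehat) {k : ℕ} (hk : 1 ≤ k)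
    (hkr : k < r) (p : AgentSpace r m ν)
    (hd : ∀ j, 1 ≤ j → j ≤ k → DifferentiableAt ℝ (unc (α j)) p) :
    unc (α (k + 1)) p = -(c ⟨k, hkr⟩) * unc (ehat (k + 1)) p - unc (ehat k) p
      - (∑ j, ψ ⟨k, hkr⟩ p.1 j * p.2.2 j)
      + (∑ l : Fin r, if hl : (l : ℕ) < k then
          fderiv ℝ (unc (α k)) p (Pi.single l 1, 0, 0)
            * (p.1 ⟨(l : ℕ) + 1, by omega⟩ + ∑ j, ψ l p.1 j * p.2.2 j)
        else 0)
      + (∑ l : Fin (r + 1), if hl : (l : ℕ) < k + 1 then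
          fderiv ℝ (unc (α k)) p
            (0, Pi.single l (A.mulVec (p.2.1 l)
              - M.mulVec (p.2.1 l - p.2.1 ⟨(l : ℕ) + 1, by omega⟩)), 0)
        else 0)
      + fderiv ℝ (unc (α k)) p (0, 0, unc (τ (k + 1)) p)
      + ∑ l ∈ Finset.Icc 2 k, unc (ehat l) p *
          fderiv ℝ (unc (α (l - 1))) p (0, 0, regressor ψ α k p) := by
  have hk' := hd k hk le_rfl
  rw [← regressor_eq hkr p hk']
  have := h.alpha_step (k + 1) (by omega) hkr p.1 p.2.1 p.2.2
  simp only [Nat.add_sub_cancel] at this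
  rw [unc, this]
  simp only [fderiv_fst p hk', fderiv_snd p hk', fderiv_trd p hk']
  congr 1
  refine Finset.sum_congr rfl fun l hl => ?_
  rw [Finset.mem_Icc] at hl
  rw [fderiv_trd p (hd (l - 1) (by omega) (by omega))]
  rfl

theorem contDiff (h : IsBacksteppingDesign hr ψ A M C c α τ ehat)
    (hψ : ∀ l, ContDiff ℝ (⊤ : ℕ∞) (ψ l)) :
    ∀ k, 1 ≤ k → k ≤ r → ContDiff ℝ (⊤ : ℕ∞) (unc (ehat k)) ∧
      ContDiff ℝ (⊤ : ℕ∞) (unc (τ k)) ∧ ContDiff ℝ (⊤ : ℕ∞) (unc (α k)) := by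
  have hψ' : ∀ l, ContDiff ℝ (⊤ : ℕ∞) fun p : AgentSpace r m ν => ψ l p.1 := fun l =>
    (hψ l).comp contDiff_fst
  have hx : ∀ l, ContDiff ℝ (⊤ : ℕ∞) fun p : AgentSpace r m ν => p.1 l := fun l => by fun_prop
  have hη : ∀ l, ContDiff ℝ (⊤ : ℕ∞) fun p : AgentSpace r m ν => p.2.1 l := fun l => by fun_prop
  have hmul : ∀ {q : ℕ} (B : Matrix (Fin q) (Fin ν) ℝ) {f : AgentSpace r m ν → Fin ν → ℝ},
      ContDiff ℝ (⊤ : ℕ∞) f → ContDiff ℝ (⊤ : ℕ∞) fun p => B.mulVec (f p) := fun B f hf =>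
    (LinearMap.toContinuousLinearMap B.mulVecLin).contDiff.comp hf
  have hdot : ∀ l, ContDiff ℝ (⊤ : ℕ∞)
      fun p : AgentSpace r m ν => ∑ j, ψ l p.1 j * p.2.2 j := fun l =>
    ContDiff.sum fun j _ => ((contDiff_pi.1 (hψ' l)) j).mul (by fun_prop)
  have hfd : ∀ {f : AgentSpace r m ν → ℝ} {g : AgentSpace r m ν → AgentSpace r m ν},
      ContDiff ℝ (⊤ : ℕ∞) f → ContDiff ℝ (⊤ : ℕ∞) g →
      ContDiff ℝ (⊤ : ℕ∞) fun p => fderiv ℝ f p (g p) := fun hf hg =>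
    (hf.fderiv_right (by simp)).clm_apply hg
  have hcongr : ∀ {W : Type} [NormedAddCommGroup W] [NormedSpace ℝ W]
      {f g : AgentSpace r m ν → W}, (∀ p, f p = g p) → ContDiff ℝ (⊤ : ℕ∞) g →
      ContDiff ℝ (⊤ : ℕ∞) f := fun hfg hg => by rwa [funext hfg]
  intro k
  induction k using Nat.strong_induction_on with
  | _ k ih =>
  intro hk1 hkr
  obtain rfl | hk2 := hk1.eq_or_lt
  · have he : ContDiff ℝ (⊤ : ℕ∞) (unc (ehat 1)) :=
      hcongr (fun p => h.ehat_one p.1 p.2.1 p.2.2)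
        ((hx ⟨0, hr⟩).sub (contDiff_pi.1 (hmul C (hη 0)) 0))
    refine ⟨he, ?_, ?_⟩
    · exact hcongr (fun p => h.tau_one p.1 p.2.1 p.2.2) (he.smul (hψ' ⟨0, hr⟩))
    · exact hcongr (fun p => h.alpha_one p.1 p.2.1 p.2.2)
        ((((contDiff_const.mul he).sub (hdot ⟨0, hr⟩)).add
          (contDiff_pi.1 (hmul C (hmul A (hη 0))) 0)).sub
          (contDiff_pi.1 (hmul C (hmul M ((hη 0).sub (hη _)))) 0))
  · obtain ⟨n, rfl⟩ : ∃ n, k = n + 1 := ⟨k - 1, by omega⟩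
    have hn1 : 1 ≤ n := by omega
    have hnr : n < r := by omega
    obtain ⟨hen, hτn, hαn⟩ := ih n (by omega) hn1 hnr.le
    have hα : ∀ j, 1 ≤ j → j ≤ n → ContDiff ℝ (⊤ : ℕ∞) (unc (α j)) := fun j hj hjn =>
      (ih j (by omega) hj (by omega)).2.2
    have hd : ∀ p j, 1 ≤ j → j ≤ n → DifferentiableAt ℝ (unc (α j)) p := fun p j hj hjn =>
      ((hα j hj hjn).differentiable (by simp)) p
    have he : ContDiff ℝ (⊤ : ℕ∞) (unc (ehat (n + 1))) :=
      hcongr (fun p => h.ehat_succ hn1 hnr p) ((hx ⟨n, hnr⟩).sub hαn)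
    have hw : ContDiff ℝ (⊤ : ℕ∞) (regressor (ν := ν) ψ α n) := by
      unfold regressor
      simp only [dif_pos hnr]
      refine (hψ' _).sub (ContDiff.sum fun l _ => ?_)
      split_ifs
      · exact (hfd hαn contDiff_const).smul (hψ' l)
      · exact contDiff_const
    have hτ : ContDiff ℝ (⊤ : ℕ∞) (unc (τ (n + 1))) :=
      hcongr (fun p => h.tau_succ hn1 hnr p (hd p n hn1 le_rfl)) (hτn.add (he.smul hw))
    refine ⟨he, hτ, hcongr (fun p => h.alpha_succ hn1 hnr p (hd p)) ?_⟩
    refine (((((contDiff_const.mul he).sub hen).sub (hdot _)).add (ContDiff.sum fun l _ => ?_)).add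
      (ContDiff.sum fun l _ => ?_)).add (hfd hαn ?_) |>.add (ContDiff.sum fun l hl => ?_)
    · split_ifs
      · exact (hfd hαn contDiff_const).mul ((hx _).add (hdot l))
      · exact contDiff_const
    · split_ifs
      · refine hfd hαn (contDiff_const.prodMk (ContDiff.prodMk ?_ contDiff_const))
        exact (ContinuousLinearMap.single ℝ (fun _ : Fin (r + 1) => Fin ν → ℝ) l).contDiff.comp
          ((hmul A (hη l)).sub (hmul M ((hη l).sub (hη _))))
      · exact contDiff_const
    · exact contDiff_const.prodMk (contDiff_const.prodMk hτ)
    · rw [Finset.mem_Icc] at hl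
      exact (ih l (by omega) (by omega) (by omega)).1.mul
        (hfd (hα (l - 1) (by omega) (by omega)) (contDiff_const.prodMk (contDiff_const.prodMk hw)))

theorem dependsOnLevel_regressor {k : ℕ} (hkr : k < r) (hk : 1 ≤ k → DependsOnLevel k (unc (α k)))
    (hψ : ∀ (l : Fin r) (xv xv' : Fin r → ℝ),
      (∀ k : Fin r, (k : ℕ) ≤ (l : ℕ) → xv k = xv' k) → ψ l xv = ψ l xv') :
    DependsOnLevel (k + 1) (regressor (ν := ν) ψ α k) := by
  intro p q hpq
  have hψ' : ∀ l : Fin r, (l : ℕ) ≤ k → ψ l p.1 = ψ l q.1 := fun l hl =>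
    hψ l _ _ fun j hj => hpq.1 j (by omega)
  rw [regressor, regressor, dif_pos hkr, dif_pos hkr, hψ' _ le_rfl]
  congr 1
  refine Finset.sum_congr rfl fun l _ => ?_
  split_ifs with hl
  · rw [hψ' l hl.le, (hk (by omega)).fderiv_eq p q (hpq.mono (by omega))]
  · rfl

theorem dependsOnLevel (h : IsBacksteppingDesign hr ψ A M C c α τ ehat)
    (hψ : ∀ l, ContDiff ℝ (⊤ : ℕ∞) (ψ l))
    (hψ_dep : ∀ (l : Fin r) (xv xv' : Fin r → ℝ),
      (∀ k : Fin r, (k : ℕ) ≤ (l : ℕ) → xv k = xv' k) → ψ l xv = ψ l xv') :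
    ∀ k, 1 ≤ k → k ≤ r → DependsOnLevel k (unc (ehat k)) ∧
      DependsOnLevel k (unc (τ k)) ∧ DependsOnLevel k (unc (α k)) := by
  intro k
  induction k using Nat.strong_induction_on with
  | _ k ih =>
  intro hk1 hkr
  obtain rfl | hk2 := hk1.eq_or_lt
  · have he : DependsOnLevel 1 (unc (ehat 1)) := fun p q hpq => by
      simp only [unc, h.ehat_one, hpq.1 ⟨0, hr⟩ (by simp), hpq.2.1 0 (by simp)]
    have hψ' : ∀ {p q : AgentSpace r m ν}, Agree 1 p q → ψ ⟨0, hr⟩ p.1 = ψ ⟨0, hr⟩ q.1 :=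
      fun hpq => hψ_dep _ _ _ fun j hj => hpq.1 j (Nat.lt_succ_of_le hj)
    refine ⟨he, fun p q hpq => ?_, fun p q hpq => ?_⟩
    · have := he p q hpq
      simp only [unc] at this
      simp only [unc, h.tau_one, hψ' hpq, this]
    · have := he p q hpq
      simp only [unc] at this
      simp only [unc, h.alpha_one, this, hψ' hpq]
      simp only [hpq.2.2, hpq.2.1 0 (by simp),
        hpq.2.1 ⟨1, Nat.succ_lt_succ hr⟩ (by simp)]
  · obtain ⟨n, rfl⟩ : ∃ n, k = n + 1 := ⟨k - 1, by omega⟩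
    have hn1 : 1 ≤ n := by omega
    have hnr : n < r := by omega
    obtain ⟨hen, hτn, hαn⟩ := ih n (by omega) hn1 hnr.le
    have hd : ∀ p j, 1 ≤ j → j ≤ n → DifferentiableAt ℝ (unc (α j)) p := fun p j hj hjn =>
      ((h.contDiff hψ j hj (by omega)).2.2.differentiable (by simp)) p
    have hfd : ∀ j, 1 ≤ j → j ≤ n → DependsOnLevel (n + 1) (fderiv ℝ (unc (α j))) :=
      fun j hj hjn => ((ih j (by omega) hj (by omega)).2.2.fderiv_eq).mono (by omega)
    have hw := dependsOnLevel_regressor (ν := ν) hnr (fun _ => hαn) hψ_dep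
    have he : DependsOnLevel (n + 1) (unc (ehat (n + 1))) := fun p q hpq => by
      rw [h.ehat_succ hn1 hnr, h.ehat_succ hn1 hnr, hαn.mono n.le_succ p q hpq,
        hpq.1 ⟨n, hnr⟩ n.lt_succ_self]
    have hτ : DependsOnLevel (n + 1) (unc (τ (n + 1))) := fun p q hpq => by
      rw [h.tau_succ hn1 hnr p (hd p n hn1 le_rfl), h.tau_succ hn1 hnr q (hd q n hn1 le_rfl),
        hτn.mono n.le_succ p q hpq, he p q hpq, hw p q hpq]
    refine ⟨he, hτ, fun p q hpq => ?_⟩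
    have hψ' : ∀ l : Fin r, (l : ℕ) ≤ n → ψ l p.1 = ψ l q.1 := fun l hl =>
      hψ_dep l _ _ fun j hj => hpq.1 j (by omega)
    rw [h.alpha_succ hn1 hnr p (hd p), h.alpha_succ hn1 hnr q (hd q), he p q hpq,
      hen.mono n.le_succ p q hpq, hτ p q hpq, hw p q hpq, hψ' ⟨n, hnr⟩ le_rfl, hpq.2.2,
      hfd n hn1 le_rfl p q hpq]
    congr 1
    · congr 1
      congr 1
      · congr 1
        refine Finset.sum_congr rfl fun l _ => ?_
        split_ifs with hl
        · rw [hψ' l hl.le, hpq.1 ⟨l + 1, _⟩ (Nat.succ_lt_succ hl)]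
        · rfl
      · refine Finset.sum_congr rfl fun l _ => ?_
        split_ifs with hl
        · rw [hpq.2.1 l (by omega), hpq.2.1 ⟨l + 1, _⟩ (Nat.succ_lt_succ hl)]
        · rfl
    · refine Finset.sum_congr rfl fun l hl => ?_
      rw [Finset.mem_Icc] at hl
      rw [hfd (l - 1) (by omega) (by omega) p q hpq,
        ((ih l (by omega) (by omega) (by omega)).1.mono (by omega)) p q hpq]

theorem tau_eq_sum (h : IsBacksteppingDesign hr ψ A M C c α τ ehat)
    (hψ : ∀ l, ContDiff ℝ (⊤ : ℕ∞) (ψ l)) (p : AgentSpace r m ν) {k : ℕ} (hk : 1 ≤ k)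
    (hkr : k ≤ r) :
    unc (τ k) p = ∑ i ∈ Finset.range k, unc (ehat (i + 1)) p • regressor ψ α i p := by
  induction k, hk using Nat.le_induction with
  | base => simpa [regressor, unc, Nat.lt_of_succ_le hr] using h.tau_one p.1 p.2.1 p.2.2
  | succ k hk ih =>
    rw [Finset.sum_range_succ, ← ih (by omega), h.tau_succ hk hkr]
    exact ((h.contDiff hψ k hk (by omega)).2.2.differentiable (by simp)) p

/-- The backstepping errors at a point, extended by zero outside the range `1, …, r`. -/
def err (ehat : ℕ → (Fin r → ℝ) → (Fin (r + 1) → Fin ν → ℝ) → (Fin m → ℝ) → ℝ)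
    (p : AgentSpace r m ν) (k : ℕ) : ℝ := if 1 ≤ k ∧ k ≤ r then unc (ehat k) p else 0

theorem err_of_mem {k : ℕ} (hk : 1 ≤ k) (hkr : k ≤ r) (p : AgentSpace r m ν) :
    err ehat p k = unc (ehat k) p := if_pos ⟨hk, hkr⟩

/-- The derivative of the virtual control `α_{k-1}` in the direction of the parameter
estimate, for `2 ≤ k`. -/
noncomputable def parDeriv
    (α : ℕ → (Fin r → ℝ) → (Fin (r + 1) → Fin ν → ℝ) → (Fin m → ℝ) → ℝ)
    (p : AgentSpace r m ν) (k : ℕ) : (Fin m → ℝ) →ₗ[ℝ] ℝ :=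
  if 2 ≤ k then (fderiv ℝ (unc (α (k - 1))) p).toLinearMap ∘ₗ
    LinearMap.inr ℝ _ _ ∘ₗ LinearMap.inr ℝ _ _ else 0

theorem parDeriv_apply {k : ℕ} (hk : 2 ≤ k) (p : AgentSpace r m ν) (v : Fin m → ℝ) :
    parDeriv α p k v = fderiv ℝ (unc (α (k - 1))) p (0, 0, v) := by
  rw [parDeriv, if_pos hk]
  rfl

/-- The error dynamics of the closed loop. -/
theorem fderiv_ehat (h : IsBacksteppingDesign hr ψ A M C c α τ ehat)
    (hψ : ∀ l, ContDiff ℝ (⊤ : ℕ∞) (ψ l))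
    (hψ_dep : ∀ (l : Fin r) (xv xv' : Fin r → ℝ),
      (∀ k : Fin r, (k : ℕ) ≤ (l : ℕ) → xv k = xv' k) → ψ l xv = ψ l xv')
    {θ : Fin m → ℝ} {p v : AgentSpace r m ν}
    (hv1 : ∀ (l : Fin r) (hl : (l : ℕ) + 1 < r), v.1 l = p.1 ⟨l + 1, hl⟩ + ψ l p.1 ⬝ᵥ θ)
    (hv1' : ∀ l : Fin r, (l : ℕ) + 1 = r → v.1 l = unc (α r) p + ψ l p.1 ⬝ᵥ θ)
    (hv2 : ∀ (l : Fin (r + 1)) (hl : (l : ℕ) < r), v.2.1 l =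
      A.mulVec (p.2.1 l) - M.mulVec (p.2.1 l - p.2.1 ⟨(l : ℕ) + 1, Nat.succ_lt_succ hl⟩))
    (hv3 : v.2.2 = unc (τ r) p) {k : ℕ} (hk : k < r) :
    fderiv ℝ (unc (ehat (k + 1))) p v =
      err ehat p (k + 2) - err ehat p k - c ⟨k, hk⟩ * err ehat p (k + 1)
        + regressor ψ α k p ⬝ᵥ (θ - p.2.2)
        + (parDeriv α p (k + 1) (∑ i ∈ Finset.range (k + 1), err ehat p (i + 1) •
              regressor ψ α i p - ∑ i ∈ Finset.range r, err ehat p (i + 1) • regressor ψ α i p)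
          + ∑ l ∈ Finset.Icc 2 k, err ehat p l * parDeriv α p l (regressor ψ α k p)) := by
  have hd : ∀ j, 1 ≤ j → j ≤ r → DifferentiableAt ℝ (unc (α j)) p := fun j hj hjn =>
    ((h.contDiff hψ j hj hjn).2.2.differentiable (by simp)) p
  have hτ : ∀ n, 1 ≤ n → n ≤ r → ∑ i ∈ Finset.range n, err ehat p (i + 1) •
      regressor ψ α i p = unc (τ n) p := fun n hn hnr => by
    rw [h.tau_eq_sum hψ p hn hnr]
    refine Finset.sum_congr rfl fun i hi => ?_
    rw [Finset.mem_range] at hi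
    rw [err_of_mem (by omega) (by omega)]
  have hvk : v.1 ⟨k, hk⟩ = err ehat p (k + 2) + unc (α (k + 1)) p + ψ ⟨k, hk⟩ p.1 ⬝ᵥ θ := by
    by_cases hkr : k + 1 < r
    · rw [hv1 ⟨k, hk⟩ hkr, err_of_mem (by omega) (by omega), h.ehat_succ (by omega) hkr]
      ring
    · rw [hv1' ⟨k, hk⟩ (by simp only; omega), err, if_neg (by omega),
        show k + 1 = r by omega, zero_add]
  rw [hτ (k + 1) (by omega) hk, hτ r hr le_rfl, err_of_mem (by omega) hk]
  rcases Nat.eq_zero_or_pos k with rfl | hk1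
  · have hlin : IsLinearMap ℝ
        fun q : AgentSpace r m ν => q.1 ⟨0, hr⟩ - C.mulVec (q.2.1 0) 0 :=
      ⟨fun q q' => by simp [Matrix.mulVec_add]; ring,
        fun s q => by simp [Matrix.mulVec_smul]; ring⟩
    have hf : unc (ehat 1) = fun q : AgentSpace r m ν => q.1 ⟨0, hr⟩ - C.mulVec (q.2.1 0) 0 :=
      funext fun q => h.ehat_one _ _ _
    have hα : unc (α 1) p = _ := h.alpha_one p.1 p.2.1 p.2.2
    have hw : regressor (ν := ν) ψ α 0 p = ψ ⟨0, hr⟩ p.1 := by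
      simp [regressor, Nat.lt_of_succ_le hr]
    have hv : (v.1 ⟨0, hr⟩ - C.mulVec (v.2.1 0) 0 : ℝ) = fderiv ℝ (unc (ehat 1)) p v := by
      rw [hf, hlin.fderiv_apply]
    rw [zero_add, ← hv, hvk, hv2 0 hr, hw, zero_add, hα, parDeriv, if_neg (by omega),
      Matrix.mulVec_sub C, dotProduct_sub]
    simp [err, dotProduct, unc]
    ring
  · have hf : fderiv ℝ (unc (ehat (k + 1))) p v = v.1 ⟨k, hk⟩ - fderiv ℝ (unc (α k)) p v := by
      have : unc (ehat (k + 1)) = fun q : AgentSpace r m ν => q.1 ⟨k, hk⟩ - unc (α k) q :=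
        funext fun q => h.ehat_succ hk1 hk q
      rw [this]
      have hlin : IsLinearMap ℝ fun q : AgentSpace r m ν => q.1 ⟨k, hk⟩ :=
        ⟨fun _ _ => rfl, fun _ _ => rfl⟩
      rw [fderiv_fun_sub hlin.differentiableAt (hd k hk1 hk.le)]
      exact congrArg (· - _) (hlin.fderiv_apply p v)
    have hdep := (h.dependsOnLevel hψ hψ_dep k hk1 hk.le).2.2
    have hs1 : ∑ l, fderiv ℝ (unc (α k)) p (Pi.single l 1, 0, 0) * v.1 l =
        ∑ l : Fin r, (if hl : (l : ℕ) < k then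
          fderiv ℝ (unc (α k)) p (Pi.single l 1, 0, 0)
            * (p.1 ⟨(l : ℕ) + 1, by omega⟩ + ψ l p.1 ⬝ᵥ p.2.2) else 0) +
        ∑ l : Fin r, (if (l : ℕ) < k then
          fderiv ℝ (unc (α k)) p (Pi.single l 1, 0, 0) * (ψ l p.1 ⬝ᵥ (θ - p.2.2)) else 0) := by
      rw [← Finset.sum_add_distrib]
      refine Finset.sum_congr rfl fun l _ => ?_
      split_ifs with hl
      · rw [hv1 l (by omega), dotProduct_sub]
        ring
      · have hz : fderiv ℝ (unc (α k)) p (Pi.single l 1, 0, 0) = 0 :=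
          hdep.fderiv_apply_eq_zero p
            ⟨fun j hj => Pi.single_eq_of_ne (by rintro rfl; exact hl hj) _, fun j hj => rfl, rfl⟩
        rw [hz, zero_mul, add_zero]
    have hs2 : ∑ l, fderiv ℝ (unc (α k)) p (0, Pi.single l (v.2.1 l), 0) =
        ∑ l : Fin (r + 1), (if hl : (l : ℕ) < k + 1 then
          fderiv ℝ (unc (α k)) p
            (0, Pi.single l (A.mulVec (p.2.1 l)
              - M.mulVec (p.2.1 l - p.2.1 ⟨(l : ℕ) + 1, by omega⟩)), 0) else 0) := by
      refine Finset.sum_congr rfl fun l _ => ?_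
      split_ifs with hl
      · rw [hv2 l (by omega)]
      · exact hdep.fderiv_apply_eq_zero p
          ⟨fun j hj => rfl, fun j hj => Pi.single_eq_of_ne (by rintro rfl; exact hl hj) _, rfl⟩
    have hw : regressor ψ α k p ⬝ᵥ (θ - p.2.2) = ψ ⟨k, hk⟩ p.1 ⬝ᵥ (θ - p.2.2) -
        ∑ l : Fin r, (if (l : ℕ) < k then
          fderiv ℝ (unc (α k)) p (Pi.single l 1, 0, 0) * (ψ l p.1 ⬝ᵥ (θ - p.2.2)) else 0) := by
      rw [regressor, dif_pos hk, sub_dotProduct, sum_dotProduct]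
      congr 1
      refine Finset.sum_congr rfl fun l _ => ?_
      split_ifs
      · rw [smul_dotProduct, smul_eq_mul]
      · exact zero_dotProduct _
    have hpar : ∑ l ∈ Finset.Icc 2 k, err ehat p l * parDeriv α p l (regressor ψ α k p) =
        ∑ l ∈ Finset.Icc 2 k, unc (ehat l) p *
          fderiv ℝ (unc (α (l - 1))) p (0, 0, regressor ψ α k p) := by
      refine Finset.sum_congr rfl fun l hl => ?_
      rw [Finset.mem_Icc] at hl
      rw [err_of_mem (by omega) (by omega), parDeriv_apply hl.1]
    have hα := h.alpha_succ hk1 hk p fun j hj hjk => hd j hj (hjk.trans hk.le)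
    rw [hf, hvk, hα, clm_apply_eq_sum _ v, hs1, hs2, hw, hpar, hv3, map_sub,
      parDeriv_apply (by omega), parDeriv_apply (by omega), err_of_mem hk1 hk.le, dotProduct_sub,
      Nat.add_sub_cancel]
    simp only [dotProduct]
    ring

/-- A velocity at `p` of the closed loop of one agent, with unconstrained last compensator
component. -/
structure IsClosedLoopVelocity (ψ : Fin r → (Fin r → ℝ) → Fin m → ℝ)
    (A M : Matrix (Fin ν) (Fin ν) ℝ)
    (α : ℕ → (Fin r → ℝ) → (Fin (r + 1) → Fin ν → ℝ) → (Fin m → ℝ) → ℝ)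
    (τ : ℕ → (Fin r → ℝ) → (Fin (r + 1) → Fin ν → ℝ) → (Fin m → ℝ) → Fin m → ℝ)
    (θ : Fin m → ℝ) (p v : AgentSpace r m ν) : Prop where
  plant : ∀ (l : Fin r) (hl : (l : ℕ) + 1 < r), v.1 l = p.1 ⟨l + 1, hl⟩ + ψ l p.1 ⬝ᵥ θ
  plant_last : ∀ l : Fin r, (l : ℕ) + 1 = r → v.1 l = unc (α r) p + ψ l p.1 ⬝ᵥ θ
  compensator : ∀ (l : Fin (r + 1)) (hl : (l : ℕ) < r), v.2.1 l =
      A.mulVec (p.2.1 l) - M.mulVec (p.2.1 l - p.2.1 ⟨(l : ℕ) + 1, Nat.succ_lt_succ hl⟩)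
  parameter : v.2.2 = unc (τ r) p

/-- The Lyapunov identity of adaptive backstepping. -/
theorem sum_ehat_mul_fderiv_ehat (h : IsBacksteppingDesign hr ψ A M C c α τ ehat)
    (hψ : ∀ l, ContDiff ℝ (⊤ : ℕ∞) (ψ l))
    (hψ_dep : ∀ (l : Fin r) (xv xv' : Fin r → ℝ),
      (∀ k : Fin r, (k : ℕ) ≤ (l : ℕ) → xv k = xv' k) → ψ l xv = ψ l xv')
    {θ : Fin m → ℝ} {p v : AgentSpace r m ν} (hv : IsClosedLoopVelocity ψ A M α τ θ p v) :
    ∑ k : Fin r, unc (ehat (k + 1)) p * fderiv ℝ (unc (ehat (k + 1))) p v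
      - (θ - p.2.2) ⬝ᵥ v.2.2 = -∑ k : Fin r, c k * unc (ehat (k + 1)) p ^ 2 := by
  set E := err ehat p with hE
  have hEk : ∀ k : Fin r, unc (ehat (k + 1)) p = E (k + 1) := fun k =>
    (err_of_mem (by omega) k.2 p).symm
  have hcross := tuning_cross_terms_cancel E (fun k => regressor ψ α k p) (parDeriv α p)
    (by rw [parDeriv, if_neg (by omega)]) r
  have htel := sum_backstepping_telescope E r
  have hE0 : E 0 = 0 := if_neg (by omega)
  have hEr : E (r + 1) = 0 := if_neg (by omega)
  have hpar : (θ - p.2.2) ⬝ᵥ v.2.2 =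
      ∑ k ∈ Finset.range r, E (k + 1) * (regressor ψ α k p ⬝ᵥ (θ - p.2.2)) := by
    rw [hv.parameter, h.tau_eq_sum hψ p hr le_rfl, dotProduct_comm, sum_dotProduct]
    refine Finset.sum_congr rfl fun k hk => ?_
    rw [smul_dotProduct, smul_eq_mul, hE, err_of_mem (by omega) (Finset.mem_range.1 hk)]
  rw [hE0, hEr, mul_zero, zero_mul, sub_zero] at htel
  rw [← Fin.sum_univ_eq_sum_range (fun k => E (k + 1) * (E (k + 2) - E k))] at htel
  rw [← Fin.sum_univ_eq_sum_range
    (fun k => E (k + 1) * (regressor ψ α k p ⬝ᵥ (θ - p.2.2)))] at hpar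
  rw [← Fin.sum_univ_eq_sum_range (fun j => E (j + 1) * (parDeriv α p (j + 1)
    (∑ i ∈ Finset.range (j + 1), E (i + 1) • regressor ψ α i p -
      ∑ i ∈ Finset.range r, E (i + 1) • regressor ψ α i p) +
    ∑ l ∈ Finset.Icc 2 j, E l * parDeriv α p l (regressor ψ α j p)))] at hcross
  rw [hpar, sub_eq_iff_eq_add, ← add_zero (-_ + _), ← hcross, ← add_zero (-_ + _ + _), ← htel,
    ← Finset.sum_neg_distrib, ← Finset.sum_add_distrib, ← Finset.sum_add_distrib,
    ← Finset.sum_add_distrib]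
  refine Finset.sum_congr rfl fun k _ => ?_
  rw [hEk, h.fderiv_ehat hψ hψ_dep hv.plant hv.plant_last hv.compensator hv.parameter k.2]
  ring

/-- Along closed-loop trajectories the backstepping errors and the parameter estimates are
bounded, and the errors are square-dissipated. -/
theorem bddSignal_ehat (h : IsBacksteppingDesign hr ψ A M C c α τ ehat)
    (hψ : ∀ l, ContDiff ℝ (⊤ : ℕ∞) (ψ l))
    (hψ_dep : ∀ (l : Fin r) (xv xv' : Fin r → ℝ),
      (∀ k : Fin r, (k : ℕ) ≤ (l : ℕ) → xv k = xv' k) → ψ l xv = ψ l xv')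
    (hc : ∀ k, 0 < c k) {θ : Fin m → ℝ} {p v : ℝ → AgentSpace r m ν}
    (hv : ∀ t, 0 ≤ t → IsClosedLoopVelocity ψ A M α τ θ (p t) (v t))
    (hp : ∀ t, 0 ≤ t → HasDerivWithinAt p (v t) (Ici 0) t) :
    (∀ k, 1 ≤ k → k ≤ r → BddSignal (fun t => unc (ehat k) (p t)) ∧
      SqDissipated fun t => unc (ehat k) (p t)) ∧ BddSignal fun t => (p t).2.2 := by
  set V : ℝ → ℝ := fun t => (∑ k : Fin r, unc (ehat (k + 1)) (p t) ^ 2 +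
    (θ - (p t).2.2) ⬝ᵥ (θ - (p t).2.2)) / 2 with hV
  set V' : ℝ → ℝ := fun t => -∑ k : Fin r, c k * unc (ehat (k + 1)) (p t) ^ 2 with hV'
  have hd : ∀ t, 0 ≤ t → HasDerivWithinAt V (V' t) (Ici 0) t := fun t ht => by
    have hE : ∀ k : Fin r, HasDerivWithinAt (fun t => unc (ehat (k + 1)) (p t))
        (fderiv ℝ (unc (ehat (k + 1))) (p t) (v t)) (Ici 0) t := fun k =>
      (((h.contDiff hψ _ (by omega) k.2).1.differentiable (by simp)) _).hasFDerivAt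
        |>.comp_hasDerivWithinAt t (hp t ht)
    have hθ : ∀ j, HasDerivWithinAt (fun t => (θ - (p t).2.2) j) (-(v t).2.2 j) (Ici 0) t :=
      fun j => by
        have h2 : HasDerivWithinAt (fun t => (p t).2.2) (v t).2.2 (Ici 0) t := (hp t ht).snd.snd
        exact (hasDerivWithinAt_pi.1 h2 j).const_sub _
    have := ((HasDerivWithinAt.fun_sum fun k (_ : k ∈ Finset.univ) => (hE k).pow 2).add
      (HasDerivWithinAt.fun_sum fun j (_ : j ∈ Finset.univ) => (hθ j).mul (hθ j))).div_const 2
    refine this.congr_deriv ?_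
    refine Eq.trans ?_ (h.sum_ehat_mul_fderiv_ehat hψ hψ_dep (hv t ht))
    rw [add_div, Finset.sum_div,
      Finset.sum_div, sub_eq_add_neg (Finset.sum _ _), dotProduct, ← Finset.sum_neg_distrib]
    congr 1 <;> refine Finset.sum_congr rfl fun k _ => ?_
    · simp
      ring
    · ring
  have hV'0 : ∀ t, V' t ≤ 0 := fun t =>
    neg_nonpos.2 (Finset.sum_nonneg fun k _ => mul_nonneg (hc k).le (sq_nonneg _))
  have hle : ∀ t, 0 ≤ t → V t ≤ V 0 := fun t ht =>
    antitoneOn_Ici_of_hasDerivWithinAt_nonpos le_rfl hd (fun t _ => hV'0 t) (mem_Ici.2 le_rfl)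
      (mem_Ici.2 ht) ht
  have hdot : ∀ t, 0 ≤ (θ - (p t).2.2) ⬝ᵥ (θ - (p t).2.2) := fun t =>
    Finset.sum_nonneg fun j _ => mul_self_nonneg _
  have hsum : ∀ t, 0 ≤ ∑ k : Fin r, unc (ehat (k + 1)) (p t) ^ 2 := fun t =>
    Finset.sum_nonneg fun k _ => sq_nonneg _
  have hV0 : ∀ t, 0 ≤ V t := fun t => div_nonneg (add_nonneg (hsum t) (hdot t)) two_pos.le
  refine ⟨fun k hk hkr => ?_, ?_⟩
  · obtain ⟨k, rfl⟩ : ∃ n, k = n + 1 := ⟨k - 1, by omega⟩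
    constructor
    · refine ⟨√(2 * V 0), fun t ht => Real.abs_le_sqrt ?_⟩
      have h1 := Finset.single_le_sum (f := fun k : Fin r => unc (ehat (k + 1)) (p t) ^ 2)
        (fun k _ => sq_nonneg _) (Finset.mem_univ (⟨k, hkr⟩ : Fin r))
      have h2 := hle t ht
      simp only [hV] at h1 h2 ⊢
      linarith [hdot t]
    · have hck := hc ⟨k, hkr⟩
      refine ⟨fun t => V t / c ⟨k, hkr⟩, fun t => V' t / c ⟨k, hkr⟩,
        fun t _ => div_nonneg (hV0 t) hck.le, fun t ht => (hd t ht).div_const _, fun t ht => ?_⟩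
      rw [← neg_div, le_div_iff₀ hck, hV', neg_neg, Real.norm_eq_abs, sq_abs, mul_comm]
      exact Finset.single_le_sum (f := fun k : Fin r => c k * unc (ehat (k + 1)) (p t) ^ 2)
        (fun k _ => mul_nonneg (hc k).le (sq_nonneg _)) (Finset.mem_univ (⟨k, hkr⟩ : Fin r))
  · refine BddSignal.pi fun j => ⟨|θ j| + √(2 * V 0), fun t ht => ?_⟩
    have h1 := Finset.single_le_sum
      (f := fun j => (θ - (p t).2.2) j * (θ - (p t).2.2) j)
      (fun k _ => mul_self_nonneg _) (Finset.mem_univ j)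
    have h2 := hle t ht
    have h3 : |(θ - (p t).2.2) j| ≤ √(2 * V 0) := Real.abs_le_sqrt <| by
      simp only [hV, dotProduct] at h1 h2 ⊢
      have h4 := hsum t
      nlinarith
    have h4 : (p t).2.2 j = θ j - (θ - (p t).2.2) j := by simp
    change |(p t).2.2 j| ≤ _
    rw [h4]
    exact (abs_sub _ _).trans (by linarith)

theorem bddSignal_state (h : IsBacksteppingDesign hr ψ A M C c α τ ehat)
    (hψ : ∀ l, ContDiff ℝ (⊤ : ℕ∞) (ψ l))
    (hψ_dep : ∀ (l : Fin r) (xv xv' : Fin r → ℝ),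
      (∀ k : Fin r, (k : ℕ) ≤ (l : ℕ) → xv k = xv' k) → ψ l xv = ψ l xv')
    {p : ℝ → AgentSpace r m ν}
    (he : ∀ k, 1 ≤ k → k ≤ r → BddSignal fun t => unc (ehat k) (p t))
    (hη : BddSignal fun t => (p t).2.1) (hθ : BddSignal fun t => (p t).2.2) : BddSignal p := by
  suffices hx : ∀ k (hk : k < r), BddSignal fun t => (p t).1 ⟨k, hk⟩ from
    (BddSignal.pi (f := fun t => (p t).1) fun l => hx l l.2).prodMk (hη.prodMk hθ)
  intro k
  induction k using Nat.strong_induction_on with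
  | _ k ih =>
  intro hk
  rcases Nat.eq_zero_or_pos k with rfl | hk1
  · have h1 : BddSignal fun t => C.mulVec ((p t).2.1 0) 0 :=
      (hη.apply 0).comp_continuous (G := fun w => C.mulVec w 0) (by fun_prop)
    convert (he 1 le_rfl hr).add h1 using 2 with t
    simp only [unc, h.ehat_one]
    ring
  · set q : ℝ → AgentSpace r m ν := fun t =>
      (fun l : Fin r => if (l : ℕ) < k then (p t).1 l else 0, (p t).2.1, (p t).2.2) with hq
    have hqb : BddSignal q := by
      refine BddSignal.prodMk (f := fun t (l : Fin r) => if (l : ℕ) < k then (p t).1 l else 0)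
        (BddSignal.pi fun l => ?_) (hη.prodMk hθ)
      by_cases hl : (l : ℕ) < k
      · simpa only [if_pos hl] using ih l hl l.2
      · simp only [if_neg hl]
        exact ⟨0, fun t _ => by simp⟩
    have hα : ∀ t, unc (α k) (q t) = unc (α k) (p t) := fun t =>
      (h.dependsOnLevel hψ hψ_dep k hk1 hk.le).2.2 _ _
        ⟨fun l hl => if_pos hl, fun _ _ => rfl, rfl⟩
    have h2 := hqb.comp_continuous (h.contDiff hψ k hk1 hk.le).2.2.continuous
    convert (he (k + 1) (by omega) hk).add h2 using 2 with t
    rw [hα, h.ehat_succ hk1 hk]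
    ring

/-- Along bounded closed-loop trajectories the backstepping errors tend to zero. -/
theorem tendsto_ehat (h : IsBacksteppingDesign hr ψ A M C c α τ ehat)
    (hψ : ∀ l, ContDiff ℝ (⊤ : ℕ∞) (ψ l))
    (hψ_dep : ∀ (l : Fin r) (xv xv' : Fin r → ℝ),
      (∀ k : Fin r, (k : ℕ) ≤ (l : ℕ) → xv k = xv' k) → ψ l xv = ψ l xv')
    {θ : Fin m → ℝ} {p v : ℝ → AgentSpace r m ν}
    (hv : ∀ t, 0 ≤ t → IsClosedLoopVelocity ψ A M α τ θ (p t) (v t))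
    (hp : ∀ t, 0 ≤ t → HasDerivWithinAt p (v t) (Ici 0) t) (hb : BddSignal p)
    (hs : SqDissipated fun t => unc (ehat 1) (p t)) :
    Tendsto (fun t => unc (ehat 1) (p t)) atTop (nhds 0) := by
  have hcd := fun k hk hkr => (h.contDiff hψ k hk hkr).1
  have hE : ∀ t, 0 ≤ t → HasDerivWithinAt (fun t => unc (ehat 1) (p t))
      (fderiv ℝ (unc (ehat 1)) (p t) (v t)) (Ici 0) t := fun t ht =>
    (((hcd 1 le_rfl hr).differentiable (by simp)) _).hasFDerivAt.comp_hasDerivWithinAt t (hp t ht)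
  have herr : ∀ k, Continuous fun p : AgentSpace r m ν => err ehat p k := fun k => by
    unfold err
    split_ifs with hk
    · exact (hcd k hk.1 hk.2).continuous
    · exact continuous_const
  have hψc : Continuous fun p : AgentSpace r m ν => regressor ψ α 0 p ⬝ᵥ (θ - p.2.2) := by
    have : Continuous fun p : AgentSpace r m ν => regressor ψ α 0 p := by
      simpa [regressor, Nat.lt_of_succ_le hr, Function.comp_def] using
        (hψ ⟨0, hr⟩).continuous.comp continuous_fst
    exact this.dotProduct (by fun_prop)
  obtain ⟨B, hB⟩ := hb.comp_continuous (hcd 1 le_rfl hr).continuous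
  obtain ⟨B', hB'⟩ := hb.comp_continuous (G := fun p => err ehat p 2 - err ehat p 0 -
    c ⟨0, hr⟩ * err ehat p 1 + regressor ψ α 0 p ⬝ᵥ (θ - p.2.2))
    ((((herr 2).sub (herr 0)).sub (continuous_const.mul (herr 1))).add hψc)
  refine hs.tendsto_zero (B' := B') hE hB fun t ht => ?_
  have hvt := hv t ht
  have := h.fderiv_ehat hψ hψ_dep hvt.plant hvt.plant_last hvt.compensator hvt.parameter hr
  simp only [zero_add, parDeriv, if_neg (show ¬ 2 ≤ 1 by omega), LinearMap.zero_apply,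
    Finset.Icc_eq_empty (show ¬ 2 ≤ 0 by omega), Finset.sum_empty, add_zero] at this
  rw [this]
  exact hB' t ht

end IsBacksteppingDesign

/-- Networks coupled through a Riccati gain whose eigenmodes are stable converge under
square-dissipated perturbations. -/
theorem network_tendsto_of_riccati {n : ℕ} {ι : Type*} [Fintype ι] [DecidableEq ι]
    {A P : Matrix (Fin n) (Fin n) ℝ} {C : Matrix (Fin 1) (Fin n) ℝ} (hP : P.PosDef)
    (hRic : A * P + P * Aᵀ + 1 - P * Cᵀ * C * P = 0) {H : Matrix ι ι ℝ} {μ : ℝ}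
    (hμ : ∀ z ∈ spectrum ℂ (H.map Complex.ofReal), 1 / 2 ≤ μ * z.re)
    {e g : ι → ℝ → Fin n → ℝ} (hg : ∀ p, SqDissipated (g p))
    (he : ∀ p t, 0 ≤ t → HasDerivWithinAt (e p)
      (A *ᵥ e p t - (μ • (P * Cᵀ * C)) *ᵥ (∑ q, H p q • e q t) + g p t) (Ici 0) t) (p : ι) :
    Tendsto (e p) atTop (nhds 0) := by
  set cplx : (Fin n → ℝ) →L[ℝ] (Fin n → ℂ) :=
    ContinuousLinearMap.pi fun k => Complex.ofRealCLM ∘L ContinuousLinearMap.proj k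
  have happ : ∀ v k, cplx v k = (v k : ℂ) := fun v k => rfl
  have hmul : ∀ (B : Matrix (Fin n) (Fin n) ℝ) v,
      cplx (B *ᵥ v) = B.map Complex.ofReal *ᵥ cplx v := fun B v => by
    ext k
    simp [happ, mulVec, dotProduct]
  have hsm : ∀ (s : ℝ) v, cplx (s • v) = (s : ℂ) • cplx v := fun s v => by
    ext k
    simp [happ]
  have key := (network_stable_of_modes (A.map Complex.ofReal)
    ((μ • (P * Cᵀ * C)).map Complex.ofReal) (H.map Complex.ofReal) (e := fun p t => cplx (e p t))
    (g := fun p t => cplx (g p t)) (fun z hz ξ h hh hξ => ?_) (fun q => (hg q).clm cplx)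
    (fun q t ht => ?_) p).2
  · have hre : Tendsto (fun t k => (cplx (e p t) k).re) atTop (nhds 0) := by
      have hc : Continuous fun (w : Fin n → ℂ) k => (w k).re := by fun_prop
      have := (hc.tendsto 0).comp key
      simpa [Function.comp_def, Pi.zero_def] using this
    exact hre
  · refine riccati_mode_stable hP hRic (z := z * μ) ?_ hh fun t ht => ?_
    · simpa [mul_comm] using hμ z hz
    · convert hξ t ht using 4
      ext i j
      simp [mul_assoc]
  · have := cplx.hasFDerivAt.comp_hasDerivWithinAt t (he q t ht)
    refine this.congr_deriv ?_
    rw [map_add, map_sub, hmul, hmul, map_sum]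
    simp only [hsm, Matrix.map_apply]

/-- **Theorem 2 of the paper.**  Closed-loop adaptive output consensus.

Conventions for the formalization:
* Agent `i` has order `r i ≥ 1` and unknown parameter `θ i : Fin (m i) → ℝ`; the Fin-index
  `l ∈ {0,…,r i − 1}` of the state `x i t l` and of `ψ i l` corresponds to the paper index
  `l+1 ∈ {1,…,rᵢ}`; likewise `η i l` (`l ∈ {0,…,r i}`) is the paper's `η_{i,l+1}`.
* `α i k`, `τ i k`, `ehat i k` (with `k` the paper's 1-based step index) are the virtual
  controls, tuning functions and error variables, as functions of the point
  `(x, η, θ̂) ∈ ℝ^{rᵢ} × (ℝ^ν)^{rᵢ+1} × ℝ^{mᵢ}`; partial derivatives such as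
  `∂α_{i,k−1}/∂x_{i,l}` are rendered with `fderiv` in the corresponding coordinate.
* Neutral stability of `A` (Assumption 1) is rendered as: `A` is diagonalizable over `ℂ`
  with all eigenvalues of zero real part.  Assumption 2 is the spanning-tree condition.

Conclusion: along any closed-loop solution all signals (`x i`, `η i l`, `θ̂ i`) are
globally uniformly bounded on `[0,∞)`, and `y_i(t) − y₀(t) → 0` for every agent `i`. -/
theorem stmt_13
    (ν N : ℕ) (hν : 1 ≤ ν) (hN : 1 ≤ N)
    (r : Fin N → ℕ) (hr : ∀ i, 1 ≤ r i) (m : Fin N → ℕ)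
    -- plant nonlinearities (known, smooth, ψ_{i,l} depends only on x_{i,1},…,x_{i,l})
    (ψ : (i : Fin N) → Fin (r i) → (Fin (r i) → ℝ) → Fin (m i) → ℝ)
    (hψ_smooth : ∀ i l, ContDiff ℝ (⊤ : ℕ∞) (ψ i l))
    (hψ_dep : ∀ i (l : Fin (r i)) (xv xv' : Fin (r i) → ℝ),
      (∀ k : Fin (r i), (k : ℕ) ≤ (l : ℕ) → xv k = xv' k) → ψ i l xv = ψ i l xv')
    -- unknown constant parameters
    (θ : (i : Fin N) → Fin (m i) → ℝ)
    -- the leader: A neutrally stable (Assumption 1), (A, C) detectable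
    (A : Matrix (Fin ν) (Fin ν) ℝ) (C : Matrix (Fin 1) (Fin ν) ℝ)
    (hA_ns : ∃ (S : Matrix (Fin ν) (Fin ν) ℂ) (D : Fin ν → ℂ),
      IsUnit S ∧ A.map Complex.ofReal = S * Matrix.diagonal D * S⁻¹ ∧ ∀ k, (D k).re = 0)
    (hdet : ∃ K₀ : Matrix (Fin ν) (Fin 1) ℝ,
      ∀ z ∈ spectrum ℂ ((A - K₀ * C).map Complex.ofReal), z.re < 0)
    -- the positive definite solution of the Riccati equation
    (P₀ : Matrix (Fin ν) (Fin ν) ℝ) (hP₀ : P₀.PosDef)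
    (hRic : A * P₀ + P₀ * Aᵀ + 1 - P₀ * Cᵀ * C * P₀ = 0)
    -- the communication digraph (Assumption 2)
    (a : Fin (N + 1) → Fin (N + 1) → ℝ)
    (ha_nonneg : ∀ i j : Fin (N + 1), i ≠ 0 → 0 ≤ a i j)
    (ha_diag : ∀ i : Fin (N + 1), i ≠ 0 → a i i = 0)
    (htree : ∀ i : Fin (N + 1),
      Relation.ReflTransGen (fun p q : Fin (N + 1) => q ≠ 0 ∧ 0 < a q p) 0 i)
    -- the expanded graph matrix Ĥ = L̂ + Δ̂ and the compensator gain K = μ P₀ Cᵀ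
    (Hhat : Matrix ((i : Fin N) × Fin (r i + 1)) ((i : Fin N) × Fin (r i + 1)) ℝ)
    (hHhat : ∀ p q, Hhat p q =
      (if p.1 = q.1 then
        (if (p.2 : ℕ) = (q.2 : ℕ) then
          (if (p.2 : ℕ) = r p.1 then ∑ k : Fin N, a p.1.succ k.succ else 1)
         else if (q.2 : ℕ) = (p.2 : ℕ) + 1 then -1 else 0)
       else if (p.2 : ℕ) = r p.1 ∧ (q.2 : ℕ) = 0 then -(a p.1.succ q.1.succ) else 0)
      + (if p = q ∧ (p.2 : ℕ) = r p.1 then a p.1.succ 0 else 0))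
    (μ : ℝ) (hμ : ∀ z ∈ spectrum ℂ (Hhat.map Complex.ofReal), 1 / z.re < μ)
    (K : Matrix (Fin ν) (Fin 1) ℝ) (hK : K = μ • (P₀ * Cᵀ))
    -- positive design constants c_{i,l}
    (c : (i : Fin N) → Fin (r i) → ℝ) (hc : ∀ i k, 0 < c i k)
    -- error variables, tuning functions and virtual controls of the backstepping design
    (α : (i : Fin N) → ℕ →
      (Fin (r i) → ℝ) → (Fin (r i + 1) → Fin ν → ℝ) → (Fin (m i) → ℝ) → ℝ)
    (τ : (i : Fin N) → ℕ →
      (Fin (r i) → ℝ) → (Fin (r i + 1) → Fin ν → ℝ) → (Fin (m i) → ℝ) → Fin (m i) → ℝ)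
    (ehat : (i : Fin N) → ℕ →
      (Fin (r i) → ℝ) → (Fin (r i + 1) → Fin ν → ℝ) → (Fin (m i) → ℝ) → ℝ)
    -- ehat_{i,1} = y_i − ŷ_i = x_{i,1} − C η_{i,1}
    (hehat1 : ∀ i xv ηv th, ehat i 1 xv ηv th = xv ⟨0, hr i⟩ - C.mulVec (ηv 0) 0)
    -- ehat_{i,k} = x_{i,k} − α_{i,k−1}
    (hehatk : ∀ i (k : ℕ) (hk2 : 2 ≤ k) (hkr : k ≤ r i) xv ηv th,
      ehat i k xv ηv th = xv ⟨k - 1, by omega⟩ - α i (k - 1) xv ηv th)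
    -- τ_{i,1} = ψ_{i,1} ehat_{i,1}
    (hτ1 : ∀ i xv ηv th, τ i 1 xv ηv th = ehat i 1 xv ηv th • ψ i ⟨0, hr i⟩ xv)
    -- α_{i,1} = −c_{i,1} ehat_{i,1} − ψ_{i,1}ᵀ θ̂ + C A η_{i,1} − C K C (η_{i,1} − η_{i,2})
    (hα1 : ∀ i xv ηv th, α i 1 xv ηv th =
      -(c i ⟨0, hr i⟩) * ehat i 1 xv ηv th - (∑ j, ψ i ⟨0, hr i⟩ xv j * th j)
        + C.mulVec (A.mulVec (ηv 0)) 0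
        - C.mulVec ((K * C).mulVec (ηv 0 - ηv ⟨1, Nat.succ_lt_succ (hr i)⟩)) 0)
    -- τ_{i,k} = τ_{i,k−1} + (ψ_{i,k} − Σ_{l=1}^{k−1} ψ_{i,l} ∂α_{i,k−1}/∂x_{i,l}) ehat_{i,k}
    (hτk : ∀ i (k : ℕ) (hk2 : 2 ≤ k) (hkr : k ≤ r i) xv ηv th,
      τ i k xv ηv th = τ i (k - 1) xv ηv th
        + ehat i k xv ηv th •
            (ψ i ⟨k - 1, by omega⟩ xv
              - ∑ l : Fin (r i), if (l : ℕ) < k - 1 then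
                  fderiv ℝ (fun x' => α i (k - 1) x' ηv th) xv (Pi.single l 1) • ψ i l xv
                else 0))
    -- the recursive backstepping formula for α_{i,k}, 2 ≤ k ≤ r_i
    (hαk : ∀ i (k : ℕ) (hk2 : 2 ≤ k) (hkr : k ≤ r i) xv ηv th,
      α i k xv ηv th =
        -(c i ⟨k - 1, by omega⟩) * ehat i k xv ηv th - ehat i (k - 1) xv ηv th
        - (∑ j, ψ i ⟨k - 1, by omega⟩ xv j * th j)
        + (∑ l : Fin (r i), if hl : (l : ℕ) < k - 1 then
            fderiv ℝ (fun x' => α i (k - 1) x' ηv th) xv (Pi.single l 1)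
              * (xv ⟨(l : ℕ) + 1, by omega⟩ + ∑ j, ψ i l xv j * th j)
          else 0)
        + (∑ l : Fin (r i + 1), if hl : (l : ℕ) < k then
            fderiv ℝ (fun η' => α i (k - 1) xv η' th) ηv
              (Pi.single l (A.mulVec (ηv l)
                - (K * C).mulVec (ηv l - ηv ⟨(l : ℕ) + 1, by omega⟩)))
          else 0)
        + fderiv ℝ (fun th' => α i (k - 1) xv ηv th') th (τ i k xv ηv th)
        + ∑ l ∈ Finset.Icc 2 (k - 1), ehat i l xv ηv th *
            fderiv ℝ (fun th' => α i (l - 1) xv ηv th') th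
              (ψ i ⟨k - 1, by omega⟩ xv
                - ∑ l' : Fin (r i), if (l' : ℕ) < k - 1 then
                    fderiv ℝ (fun x' => α i (k - 1) x' ηv th) xv (Pi.single l' 1) • ψ i l' xv
                  else 0))
    -- the leader trajectory and its output
    (x₀ : ℝ → Fin ν → ℝ)
    (hx₀ : ∀ t, 0 ≤ t → HasDerivWithinAt x₀ (A.mulVec (x₀ t)) (Ici 0) t)
    (y₀ : ℝ → ℝ) (hy₀ : ∀ t, y₀ t = C.mulVec (x₀ t) 0)
    -- the closed-loop trajectories
    (x : (i : Fin N) → ℝ → Fin (r i) → ℝ)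
    (η : (i : Fin N) → Fin (r i + 1) → ℝ → Fin ν → ℝ)
    (th : (i : Fin N) → ℝ → Fin (m i) → ℝ)
    (y : Fin N → ℝ → ℝ) (hy : ∀ i t, y i t = x i t ⟨0, hr i⟩)
    -- the actual control u_i = α_{i,r_i} and parameter update θ̂̇_i = τ_{i,r_i}
    (u : Fin N → ℝ → ℝ)
    (hu : ∀ i t, u i t = α i (r i) (x i t) (fun l => η i l t) (th i t))
    (hth : ∀ i t, 0 ≤ t →
      HasDerivWithinAt (th i) (τ i (r i) (x i t) (fun l => η i l t) (th i t)) (Ici 0) t)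
    -- the plant dynamics: ẋ_{i,l} = x_{i,l+1} + ψ_{i,l}ᵀθ_i, ẋ_{i,r_i} = u_i + ψ_{i,r_i}ᵀθ_i
    (hplant : ∀ i (l : Fin (r i)) (hl : (l : ℕ) + 1 < r i) t, 0 ≤ t →
      HasDerivWithinAt (fun s => x i s l)
        (x i t ⟨(l : ℕ) + 1, hl⟩ + ∑ j, ψ i l (x i t) j * θ i j) (Ici 0) t)
    (hplant_last : ∀ i t, 0 ≤ t →
      HasDerivWithinAt (fun s => x i s ⟨r i - 1, by have := hr i; omega⟩)
        (u i t + ∑ j, ψ i ⟨r i - 1, by have := hr i; omega⟩ (x i t) j * θ i j) (Ici 0) t)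
    -- the distributed dynamic compensator
    (hη₁ : ∀ (i : Fin N) (l : Fin (r i + 1)) (hl : (l : ℕ) < r i) t, 0 ≤ t →
      HasDerivWithinAt (η i l)
        (A.mulVec (η i l t)
          - (K * C).mulVec (η i l t - η i ⟨(l : ℕ) + 1, Nat.succ_lt_succ hl⟩ t))
        (Ici 0) t)
    (hη₂ : ∀ (i : Fin N) (t : ℝ), 0 ≤ t →
      HasDerivWithinAt (η i (Fin.last (r i)))
        (A.mulVec (η i (Fin.last (r i)) t)
          - (∑ j : Fin (N + 1), a i.succ j) •
              (K * C).mulVec (η i (Fin.last (r i)) t - η i 0 t)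
          - (a i.succ 0 * (y i t - y₀ t) + ∑ j : Fin N, a i.succ j.succ * (y i t - y j t)) •
              fun k => K k 0)
        (Ici 0) t) :
    -- conclusion: global uniform boundedness of all closed-loop signals, and
    -- asymptotic output consensus tracking
    (∀ i, ∃ B, ∀ t, 0 ≤ t → ∀ l, |x i t l| ≤ B) ∧
    (∀ i l, ∃ B, ∀ t, 0 ≤ t → ∀ k, |η i l t k| ≤ B) ∧
    (∀ i, ∃ B, ∀ t, 0 ≤ t → ∀ j, |th i t j| ≤ B) ∧
    ∀ i, Tendsto (fun t => y i t - y₀ t) atTop (nhds 0) := by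
  have hdes : ∀ i, IsBacksteppingDesign (hr i) (ψ i) A (K * C) C (c i) (α i) (τ i) (ehat i) :=
    fun i => ⟨hehat1 i, hehatk i, hτ1 i, hα1 i, hτk i, hαk i⟩
  set p : (i : Fin N) → ℝ → AgentSpace (r i) (m i) ν := fun i t =>
    (x i t, fun l => η i l t, th i t) with hp
  have hvel : ∀ i, ∃ v : ℝ → AgentSpace (r i) (m i) ν,
      (∀ t, 0 ≤ t → IsBacksteppingDesign.IsClosedLoopVelocity (ψ i) A (K * C) (α i) (τ i) (θ i)
        (p i t) (v t)) ∧ ∀ t, 0 ≤ t → HasDerivWithinAt (p i) (v t) (Ici 0) t := fun i => by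
    have hx' : ∀ (l : Fin (r i)) t, 0 ≤ t → HasDerivWithinAt (fun s => x i s l)
        ((if hl : (l : ℕ) + 1 < r i then x i t ⟨l + 1, hl⟩ else u i t)
          + ψ i l (x i t) ⬝ᵥ θ i) (Ici 0) t := fun l t ht => by
      split_ifs with hl
      · exact hplant i l hl t ht
      · have hlast : (⟨r i - 1, Nat.sub_lt (hr i) one_pos⟩ : Fin (r i)) = l :=
          Fin.ext (by simp only; omega)
        exact hlast ▸ hplant_last i t ht
    have hη' : ∀ (l : Fin (r i + 1)) t, ∃ d, 0 ≤ t → HasDerivWithinAt (η i l) d (Ici 0) t ∧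
        ∀ hl : (l : ℕ) < r i, d = A.mulVec (η i l t)
          - (K * C).mulVec (η i l t - η i ⟨(l : ℕ) + 1, Nat.succ_lt_succ hl⟩ t) := fun l t => by
      by_cases hl : (l : ℕ) < r i
      · exact ⟨_, fun ht => ⟨hη₁ i l hl t ht, fun _ => rfl⟩⟩
      · obtain rfl : l = Fin.last (r i) := Fin.ext (by simp only [Fin.val_last]; omega)
        exact ⟨_, fun ht => ⟨hη₂ i t ht, fun h => absurd h hl⟩⟩
    choose d hd using hη'
    refine ⟨fun t => (fun l => (if hl : (l : ℕ) + 1 < r i then x i t ⟨l + 1, hl⟩ else u i t)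
      + ψ i l (x i t) ⬝ᵥ θ i, fun l => d l t, τ i (r i) (x i t) (fun l => η i l t) (th i t)),
      fun t ht => ⟨fun l hl => ?_, fun l hl => ?_, fun l hl => (hd l t ht).2 hl, rfl⟩,
      fun t ht => ?_⟩
    · simp only [dif_pos hl, hp]
    · simp only [dif_neg hl.not_lt, hp, hu]
      rfl
    · exact (hasDerivWithinAt_pi.2 fun l => hx' l t ht).prodMk
        ((hasDerivWithinAt_pi.2 fun l => (hd l t ht).1).prodMk (hth i t ht))
  choose v hv hpv using hvel
  have hlyap := fun i => (hdes i).bddSignal_ehat (hψ_smooth i) (hψ_dep i) (hc i) (hv i) (hpv i)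
  set e₁ : Fin N → ℝ → ℝ := fun i t => AgentSpace.unc (ehat i 1) (p i t) with he₁
  have hye : ∀ i t, y i t = C.mulVec (η i 0 t) 0 + e₁ i t := fun i t => by
    simp only [he₁, AgentSpace.unc, hp, hehat1, hy]
    ring
  have he₁s : ∀ i, SqDissipated (e₁ i) := fun i => ((hlyap i).1 1 le_rfl (hr i)).2
  have hH : IsExpandedGraphMatrix r a Hhat := hHhat
  have hKC : K * C = μ • (P₀ * Cᵀ * C) := by rw [hK, Matrix.smul_mul]
  have hKC' : ∀ w : Fin ν → ℝ, (K * C) *ᵥ w = (C *ᵥ w) 0 • fun k => K k 0 := fun w => by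
    rw [← Matrix.mulVec_mulVec]
    ext k
    simp [Matrix.mulVec, dotProduct, mul_comm]
  set G : Fin N → ℝ → ℝ := fun i t =>
    a i.succ 0 * e₁ i t + ∑ j : Fin N, a i.succ j.succ * (e₁ i t + -e₁ j t) with hG
  have hGs : ∀ i, SqDissipated (G i) := fun i => by
    have hmul : ∀ (s : ℝ) {f : ℝ → ℝ}, SqDissipated f → SqDissipated fun t => s * f t :=
      fun s f hf => hf.of_norm_le |s| fun t _ => (norm_mul s (f t)).le
    exact (hmul _ (he₁s i)).add (SqDissipated.sum _ fun j _ => hmul _ ((he₁s i).add (he₁s j).neg))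
  set ε : (q : (i : Fin N) × Fin (r i + 1)) → ℝ → Fin ν → ℝ := fun q t => η q.1 q.2 t - x₀ t
    with hε
  set g : (q : (i : Fin N) × Fin (r i + 1)) → ℝ → Fin ν → ℝ := fun q t =>
    if (q.2 : ℕ) < r q.1 then 0 else -G q.1 t • fun k => K k 0 with hg
  have hgs : ∀ q, SqDissipated (g q) := fun q => by
    by_cases hq : (q.2 : ℕ) < r q.1
    · simpa only [hg, if_pos hq] using SqDissipated.zero
    · simp only [hg, if_neg hq]
      refine (hGs q.1).of_norm_le ‖fun k => K k 0‖ fun t _ => ?_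
      rw [norm_smul, norm_neg, mul_comm]
  have hεd : ∀ q t, 0 ≤ t → HasDerivWithinAt (ε q)
      (A *ᵥ ε q t - (μ • (P₀ * Cᵀ * C)) *ᵥ (∑ q', Hhat q q' • ε q' t) + g q t) (Ici 0) t := by
    rintro ⟨i, l⟩ t ht
    rw [← hKC]
    by_cases hl : (l : ℕ) < r i
    · refine ((hη₁ i l hl t ht).sub (hx₀ t ht)).congr_deriv ?_
      rw [hH.sum_smul_of_lt i l hl fun q => ε q t]
      simp only [hε, hg, if_pos hl, sub_sub_sub_cancel_right, Matrix.mulVec_sub A]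
      abel
    · obtain rfl : l = Fin.last (r i) := Fin.ext (by simp only [Fin.val_last]; omega)
      refine ((hη₂ i t ht).sub (hx₀ t ht)).congr_deriv ?_
      rw [hH.sum_smul_last hr ha_diag i fun q => ε q t]
      have hinput : (∑ j, a i.succ j) * ((C *ᵥ η i (Fin.last (r i)) t) 0 - (C *ᵥ η i 0 t) 0)
          + (a i.succ 0 * (y i t - y₀ t) + ∑ j : Fin N, a i.succ j.succ * (y i t - y j t))
          = (∑ j, a i.succ j) * ((C *ᵥ η i (Fin.last (r i)) t) 0 - (C *ᵥ x₀ t) 0)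
            - ∑ j : Fin N, a i.succ j.succ * ((C *ᵥ η j 0 t) 0 - (C *ᵥ x₀ t) 0) + G i t := by
        simp only [hye, hy₀, hG, Fin.sum_univ_succ, mul_add, mul_sub, mul_neg,
          Finset.sum_add_distrib, Finset.sum_sub_distrib, Finset.sum_neg_distrib,
          ← Finset.sum_mul]
        ring
      simp only [hε, hg, if_neg hl, hKC', Matrix.mulVec_sub, Matrix.mulVec_smul,
        Matrix.mulVec_sum, Pi.sub_apply, Finset.sum_apply, Pi.smul_apply, smul_eq_mul]
      ext k
      simp only [Pi.sub_apply, Pi.add_apply, Pi.smul_apply, smul_eq_mul]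
      linear_combination -K k 0 * hinput
  have hε0 := network_tendsto_of_riccati hP₀ hRic (fun z hz => by
    have hz0 := hH.re_pos_of_mem_spectrum hr ha_diag ha_nonneg htree hz
    have := (div_lt_iff₀ hz0).1 (hμ z hz)
    linarith) hgs hεd
  have hηb : ∀ i l, BddSignal (η i l) := fun i l => by
    have h1 : BddSignal (ε ⟨i, l⟩) := BddSignal.of_tendsto
      (fun t ht => (hεd ⟨i, l⟩ t ht).continuousWithinAt) (hε0 ⟨i, l⟩)
    convert h1.add (bddSignal_of_neutrally_stable hA_ns hx₀) using 2 with t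
    simp [hε]
  have hpb : ∀ i, BddSignal (p i) := fun i =>
    (hdes i).bddSignal_state (hψ_smooth i) (hψ_dep i) (fun k hk hkr => ((hlyap i).1 k hk hkr).1)
      (BddSignal.pi fun l => hηb i l) (hlyap i).2
  refine ⟨fun i => ?_, fun i l => ?_, fun i => ?_, fun i => ?_⟩
  · obtain ⟨B, hB⟩ := (hpb i).comp_continuous continuous_fst
    exact ⟨B, fun t ht l => (norm_le_pi_norm (x i t) l).trans (hB t ht)⟩
  · obtain ⟨B, hB⟩ := hηb i l
    exact ⟨B, fun t ht k => (norm_le_pi_norm (η i l t) k).trans (hB t ht)⟩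
  · obtain ⟨B, hB⟩ := (hlyap i).2
    exact ⟨B, fun t ht j => (norm_le_pi_norm (th i t) j).trans (hB t ht)⟩
  · have h1 := (hdes i).tendsto_ehat (hψ_smooth i) (hψ_dep i) (hv i) (hpv i) (hpb i) (he₁s i)
    have hCc : Continuous fun w : Fin ν → ℝ => (C *ᵥ w) 0 := by fun_prop
    have h2 := ((hCc.tendsto 0).comp (hε0 ⟨i, 0⟩)).add h1
    rw [Matrix.mulVec_zero, Pi.zero_apply, add_zero] at h2
    refine h2.congr fun t => ?_
    simp only [Function.comp_apply, hε, Matrix.mulVec_sub, Pi.sub_apply, hye, hy₀, he₁]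
    ring
end
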